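/- Let n ≥ 1 and let u : ℝⁿ → ℝ be a smooth entire convex function, i.e. D²u(x) is positive semidefinite for all x. Let g(x) = Iₙ + (D²u(x))² and θ(x) = ∑ᵢ arctan λᵢ(x), where λᵢ(x) are the eigenvalues of D²u(x). If u solves the Hamiltonian stationary equation Δ_g θ = 0, i.e. ∑_{i,j} ∂_j( √(det g(x)) (g(x)⁻¹)_{ij} ∂_i θ(x) ) = 0 for all x, then u is a quadratic polynomial, i.e. D²u is constant. -/

import Mathlib

open Matrix MeasureTheory Metric Real

noncomputable section

/-- `ℝⁿ` with the Euclidean structure. -/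
abbrev En (n : ℕ) := EuclideanSpace ℝ (Fin n)

/-- The partial derivative `∂ᵢ f (x)`. -/
def pdrv (n : ℕ) (i : Fin n) (f : En n → ℝ) (x : En n) : ℝ :=
  fderiv ℝ f x (EuclideanSpace.single i 1)

/-- The Hessian matrix `D²u(x)`. -/
def hess (n : ℕ) (u : En n → ℝ) (x : En n) : Matrix (Fin n) (Fin n) ℝ :=
  Matrix.of fun i j => pdrv n j (fun y => pdrv n i u y) x

/-- The divergence-form expression
`∑_{i,j} ∂_j( √(det g(x)) (g(x)⁻¹)_{ij} ∂_i f(x) )` for the Laplace–Beltrami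
operator of the metric `g` in coordinates. -/
def lapBel (n : ℕ) (g : En n → Matrix (Fin n) (Fin n) ℝ) (f : En n → ℝ) (x : En n) : ℝ :=
  ∑ i, ∑ j, pdrv n j (fun y => Real.sqrt (g y).det * (g y)⁻¹ i j * pdrv n i f y) x

section P1
open scoped ContDiff

variable {n : ℕ}

/-- smooth real functions -/
abbrev Sm (f : En n → ℝ) : Prop := ContDiff ℝ ∞ f

/-- gradient vector -/
def grd (f : En n → ℝ) (x : En n) : Fin n → ℝ := fun i => pdrv n i f x

lemma Sm.diff {f : En n → ℝ} (hf : Sm f) : Differentiable ℝ f :=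
  ContDiff.differentiable hf (by simp)

lemma Sm.pd {f : En n → ℝ} (hf : Sm f) (i : Fin n) : Sm (fun x => pdrv n i f x) := by
  have h1 : ContDiff ℝ ∞ (fderiv ℝ f) := hf.fderiv_right (by simp)
  exact h1.clm_apply contDiff_const

lemma Sm.grd_cont {f : En n → ℝ} (hf : Sm f) : Continuous (grd f) :=
  continuous_pi fun i => (hf.pd i).continuous

lemma fderiv_eq_sum (f : En n → ℝ) (x v : En n) :
    fderiv ℝ f x v = ∑ i, v i * pdrv n i f x := by
  have hv : v = ∑ i, v i • (EuclideanSpace.single i (1:ℝ)) := by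
    ext j
    simp [Finset.sum_apply, Pi.single_apply]
  conv_lhs => rw [hv]
  simp [pdrv]

lemma dot_self_nonneg' (v : Fin n → ℝ) : 0 ≤ v ⬝ᵥ v := by
  simp only [dotProduct]; exact Finset.sum_nonneg fun i _ => mul_self_nonneg _

lemma euc_norm_sq (v : En n) : ‖v‖ ^ 2 = ∑ i, v i * v i := by
  rw [EuclideanSpace.norm_sq_eq]; simp [pow_two]

lemma norm_fderiv_le (f : En n → ℝ) (x : En n) :
    ‖fderiv ℝ f x‖ ≤ Real.sqrt (grd f x ⬝ᵥ grd f x) := by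
  refine ContinuousLinearMap.opNorm_le_bound _ (Real.sqrt_nonneg _) fun v => ?_
  rw [fderiv_eq_sum, Real.norm_eq_abs]
  apply Real.abs_le_sqrt _ |>.trans
  · rw [← Real.sqrt_sq (norm_nonneg v), ← Real.sqrt_mul (dot_self_nonneg' _)]
  · have := Finset.sum_mul_sq_le_sq_mul_sq Finset.univ (fun i => v i) (fun i => pdrv n i f x)
    refine this.trans (le_of_eq ?_)
    rw [euc_norm_sq, mul_comm]
    simp [dotProduct, grd, pow_two]

lemma abs_fderiv_le (f : En n → ℝ) (x v : En n) :
    |fderiv ℝ f x v| ≤ Real.sqrt (grd f x ⬝ᵥ grd f x) * ‖v‖ := by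
  rw [← Real.norm_eq_abs]
  exact (ContinuousLinearMap.le_opNorm _ _).trans
    (mul_le_mul_of_nonneg_right (norm_fderiv_le f x) (norm_nonneg _))

section pd
variable {f g : En n → ℝ} {x : En n} (i : Fin n)

lemma pdrv_add (hf : DifferentiableAt ℝ f x) (hg : DifferentiableAt ℝ g x) :
    pdrv n i (fun y => f y + g y) x = pdrv n i f x + pdrv n i g x := by
  simp [pdrv, fderiv_fun_add hf hg]

lemma pdrv_sub (hf : DifferentiableAt ℝ f x) (hg : DifferentiableAt ℝ g x) :
    pdrv n i (fun y => f y - g y) x = pdrv n i f x - pdrv n i g x := by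
  simp [pdrv, fderiv_fun_sub hf hg]

lemma pdrv_neg : pdrv n i (fun y => - f y) x = - pdrv n i f x := by
  simp [pdrv, fderiv_fun_neg]

lemma pdrv_mul (hf : DifferentiableAt ℝ f x) (hg : DifferentiableAt ℝ g x) :
    pdrv n i (fun y => f y * g y) x = pdrv n i f x * g x + f x * pdrv n i g x := by
  simp [pdrv, fderiv_fun_mul hf hg]; ring

lemma pdrv_const (c : ℝ) : pdrv n i (fun _ => c) x = 0 := by
  simp [pdrv]

lemma pdrv_const_mul (c : ℝ) (hf : DifferentiableAt ℝ f x) :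
    pdrv n i (fun y => c * f y) x = c * pdrv n i f x := by
  rw [pdrv_mul i (by fun_prop) hf, pdrv_const]; ring

lemma pdrv_sum {ι : Type*} (s : Finset ι) {F : ι → En n → ℝ}
    (h : ∀ k ∈ s, DifferentiableAt ℝ (F k) x) :
    pdrv n i (fun y => ∑ k ∈ s, F k y) x = ∑ k ∈ s, pdrv n i (F k) x := by
  simp [pdrv, fderiv_fun_sum h]

lemma pdrv_coord (j : Fin n) : pdrv n i (fun y => y j) x = if i = j then 1 else 0 := by
  have : (fun y : En n => y j) = fun y => (EuclideanSpace.proj j : En n →L[ℝ] ℝ) y := by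
    ext; simp
  rw [pdrv, this, ContinuousLinearMap.fderiv]
  simp [eq_comm]

lemma pdrv_comp {h : ℝ → ℝ} {h' : ℝ} (hh : HasDerivAt h h' (f x)) (hf : DifferentiableAt ℝ f x) :
    pdrv n i (fun y => h (f y)) x = h' * pdrv n i f x := by
  have := (hh.comp_hasFDerivAt x hf.hasFDerivAt).fderiv
  have h2 : fderiv ℝ (fun y => h (f y)) x = h' • fderiv ℝ f x := this
  simp [pdrv, h2]

/-- affine rescaling -/
lemma pdrv_scale (hf : Differentiable ℝ f) (r : ℝ) (p z : En n) :
    pdrv n i (fun z => f (p + r • z)) z = r * pdrv n i f (p + r • z) := by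
  have h1 : HasFDerivAt (fun z : En n => p + r • z) (r • ContinuousLinearMap.id ℝ (En n)) z :=
    ((hasFDerivAt_id z).const_smul r).const_add p
  have h2 := ((hf (p + r • z)).hasFDerivAt.comp z h1).fderiv
  have h3 : fderiv ℝ (fun z => f (p + r • z)) z
      = (fderiv ℝ f (p + r • z)).comp (r • ContinuousLinearMap.id ℝ (En n)) := h2
  simp [pdrv, h3]

lemma pdrv_comm {i j : Fin n} (hf : Sm f) :
    pdrv n i (fun y => pdrv n j f y) x = pdrv n j (fun y => pdrv n i f y) x := by
  have hs : IsSymmSndFDerivAt ℝ f x :=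
    (ContDiff.contDiffAt hf).isSymmSndFDerivAt (by simp; exact WithTop.coe_le_coe.2 (le_top : (2:ℕ∞) ≤ ⊤))
  have hd : DifferentiableAt ℝ (fderiv ℝ f) x :=
    ((hf.fderiv_right (m := ∞) (by simp)).differentiable (by simp)) x
  have key : ∀ v w : En n, fderiv ℝ (fun y => fderiv ℝ f y v) x w = fderiv ℝ (fderiv ℝ f) x w v := by
    intro v w
    rw [fderiv_clm_apply hd (by fun_prop)]
    simp
  simp only [pdrv]
  rw [key, key]
  exact hs _ _

end pd

lemma grd_mul {f g : En n → ℝ} (hf : Sm f) (hg : Sm g) (x : En n) :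
    grd (fun y => f y * g y) x = g x • grd f x + f x • grd g x := by
  ext i; simp [grd, pdrv_mul i (hf.diff x) (hg.diff x)]; ring

lemma grd_scale {f : En n → ℝ} (hf : Sm f) (r : ℝ) (p z : En n) :
    grd (fun z => f (p + r • z)) z = r • grd f (p + r • z) := by
  ext i; simp [grd, pdrv_scale i hf.diff]

lemma Sm.scale {f : En n → ℝ} (hf : Sm f) (r : ℝ) (p : En n) : Sm (fun z => f (p + r • z)) :=
  ContDiff.comp hf (by fun_prop)

lemma cs_grd {f : En n → ℝ} (hf : HasCompactSupport f) (i : Fin n) :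
    HasCompactSupport (fun x => pdrv n i f x) :=
  hf.fderiv_apply ℝ _

lemma integral_pdrv_eq_zero {f : En n → ℝ} (hf : Sm f) (hc : HasCompactSupport f) (i : Fin n) :
    ∫ x, pdrv n i f x = 0 := by
  have := integral_mul_fderiv_eq_neg_fderiv_mul_of_integrable (μ := (volume : Measure (En n)))
    (f := fun _ => (1:ℝ)) (g := f) (v := EuclideanSpace.single i 1) (by simp)
    (by simpa [pdrv] using ((hf.pd i).continuous.integrable_of_hasCompactSupport (cs_grd hc i)))
    (by simpa using (hf.continuous.integrable_of_hasCompactSupport hc))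
    (by intro x _; fun_prop) (fun x _ => hf.diff x)
  simpa [pdrv] using this

lemma ibp {f g : En n → ℝ} (hf : Sm f) (hg : Sm g) (hc : HasCompactSupport g) (i : Fin n) :
    ∫ x, f x * pdrv n i g x = - ∫ x, pdrv n i f x * g x := by
  have h := integral_pdrv_eq_zero (hf.mul hg) (hc.mul_left) i
  have h2 : ∀ x, pdrv n i (fun x => f x * g x) x = pdrv n i f x * g x + f x * pdrv n i g x :=
    fun x => pdrv_mul i (hf.diff x) (hg.diff x)
  have h3 : ∫ x, (pdrv n i f x * g x + f x * pdrv n i g x) = 0 := by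
    rw [← h]; exact integral_congr_ae (Filter.Eventually.of_forall fun x => (h2 x).symm)
  rw [integral_add] at h3
  · linarith
  · exact ((hf.pd i).continuous.mul hg.continuous).integrable_of_hasCompactSupport hc.mul_left
  · exact (hf.continuous.mul (hg.pd i).continuous).integrable_of_hasCompactSupport
      (cs_grd hc i).mul_left

/-- The bilinear form of a coefficient matrix. -/
def bil (a : Matrix (Fin n) (Fin n) ℝ) (ξ η : Fin n → ℝ) : ℝ := ξ ⬝ᵥ a *ᵥ η

lemma bil_add_left (a : Matrix (Fin n) (Fin n) ℝ) (ξ ξ' η : Fin n → ℝ) :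
    bil a (ξ + ξ') η = bil a ξ η + bil a ξ' η := by simp [bil, add_dotProduct]
lemma bil_add_right (a : Matrix (Fin n) (Fin n) ℝ) (ξ η η' : Fin n → ℝ) :
    bil a ξ (η + η') = bil a ξ η + bil a ξ η' := by simp [bil, mulVec_add, dotProduct_add]
lemma bil_smul_left (a : Matrix (Fin n) (Fin n) ℝ) (c : ℝ) (ξ η : Fin n → ℝ) :
    bil a (c • ξ) η = c * bil a ξ η := by simp [bil]
lemma bil_smul_right (a : Matrix (Fin n) (Fin n) ℝ) (c : ℝ) (ξ η : Fin n → ℝ) :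
    bil a ξ (c • η) = c * bil a ξ η := by simp [bil, mulVec_smul]
lemma bil_sub_mat (a b : Matrix (Fin n) (Fin n) ℝ) (ξ η : Fin n → ℝ) :
    bil (a - b) ξ η = bil a ξ η - bil b ξ η := by simp [bil, sub_mulVec]
lemma bil_symm {a : Matrix (Fin n) (Fin n) ℝ} (ha : a.IsSymm) (ξ η : Fin n → ℝ) :
    bil a ξ η = bil a η ξ := by
  unfold bil
  rw [dotProduct_mulVec, ← mulVec_transpose, ha.eq, dotProduct_comm]
lemma bil_eq_sum (a : Matrix (Fin n) (Fin n) ℝ) (ξ η : Fin n → ℝ) :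
    bil a ξ η = ∑ i, ∑ j, a i j * ξ i * η j := by
  simp only [bil, dotProduct, mulVec, Finset.mul_sum]
  exact Finset.sum_congr rfl fun i _ => Finset.sum_congr rfl fun j _ => by ring

lemma bil_cont {a : En n → Matrix (Fin n) (Fin n) ℝ} (ha : Continuous a)
    {ξ η : En n → Fin n → ℝ} (hξ : Continuous ξ) (hη : Continuous η) :
    Continuous fun x => bil (a x) (ξ x) (η x) :=
  Continuous.dotProduct hξ (Continuous.matrix_mulVec ha hη)

/-- uniformly elliptic symmetric continuous coefficients -/
structure Ell (l L : ℝ) (a : En n → Matrix (Fin n) (Fin n) ℝ) : Prop where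
  cont : Continuous a
  symm : ∀ x, (a x).IsSymm
  low : ∀ x ξ, l * (ξ ⬝ᵥ ξ) ≤ bil (a x) ξ ξ
  up : ∀ x ξ, bil (a x) ξ ξ ≤ L * (ξ ⬝ᵥ ξ)

/-- weak subsolution -/
def WSub (a : En n → Matrix (Fin n) (Fin n) ℝ) (w : En n → ℝ) : Prop :=
  ∀ φ : En n → ℝ, Sm φ → HasCompactSupport φ → (∀ x, 0 ≤ φ x) →
    ∫ x, bil (a x) (grd w x) (grd φ x) ≤ 0

/-- weak solution -/
def WSol (a : En n → Matrix (Fin n) (Fin n) ℝ) (w : En n → ℝ) : Prop :=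
  ∀ φ : En n → ℝ, Sm φ → HasCompactSupport φ →
    ∫ x, bil (a x) (grd w x) (grd φ x) = 0

lemma cs_grd' {f : En n → ℝ} (hf : HasCompactSupport f) : HasCompactSupport (grd f) := by
  rw [hasCompactSupport_iff_eventuallyEq]
  have := hf.fderiv (𝕜 := ℝ)
  rw [hasCompactSupport_iff_eventuallyEq] at this
  filter_upwards [this] with x hx
  ext i; simp [grd, pdrv, hx]

lemma integrable_bil {a : En n → Matrix (Fin n) (Fin n) ℝ} (ha : Continuous a)
    {ξ η : En n → Fin n → ℝ} (hξ : Continuous ξ) (hη : Continuous η) (hc : HasCompactSupport η) :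
    Integrable fun x => bil (a x) (ξ x) (η x) := by
  refine (bil_cont ha hξ hη).integrable_of_hasCompactSupport ?_
  rw [hasCompactSupport_iff_eventuallyEq] at hc ⊢
  filter_upwards [hc] with x hx
  simp [hx, bil]

end P1


section P2
open scoped ContDiff
variable {n : ℕ}

lemma ts_zero {φ : En n → ℝ} {x : En n} (hx : x ∉ tsupport φ) : φ x = 0 :=
  image_eq_zero_of_notMem_tsupport hx

lemma ts_grd {φ : En n → ℝ} {x : En n} (hx : x ∉ tsupport φ) : grd φ x = 0 := by
  have : fderiv ℝ φ x = 0 := by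
    by_contra h
    exact hx (support_fderiv_subset ℝ h)
  ext i; simp [grd, pdrv, this]

lemma integ_of {F : En n → ℝ} (hF : Continuous F) {φ : En n → ℝ} (hc : HasCompactSupport φ)
    (h0 : ∀ x, x ∉ tsupport φ → F x = 0) : Integrable F :=
  hF.integrable_of_hasCompactSupport (HasCompactSupport.intro hc h0)

lemma grd_comp {f : En n → ℝ} {h : ℝ → ℝ} {h' : ℝ} {x : En n} (hh : HasDerivAt h h' (f x))
    (hf : DifferentiableAt ℝ f x) : grd (fun y => h (f y)) x = h' • grd f x := by
  ext i; simp [grd, pdrv_comp i hh hf]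

lemma grd_neg {f : En n → ℝ} {x : En n} : grd (fun y => - f y) x = - grd f x := by
  ext i; simp [grd, pdrv_neg]

lemma bil_neg_left (a : Matrix (Fin n) (Fin n) ℝ) (ξ η : Fin n → ℝ) :
    bil a (-ξ) η = - bil a ξ η := by simp [bil]
lemma bil_neg_right (a : Matrix (Fin n) (Fin n) ℝ) (ξ η : Fin n → ℝ) :
    bil a ξ (-η) = - bil a ξ η := by simp [bil, mulVec_neg]

variable {l L : ℝ} {a : En n → Matrix (Fin n) (Fin n) ℝ}

lemma Ell.nonneg (ha : Ell l L a) (hl : 0 < l) (x : En n) (ξ : Fin n → ℝ) : 0 ≤ bil (a x) ξ ξ :=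
  (mul_nonneg hl.le (dot_self_nonneg' ξ)).trans (ha.low x ξ)

lemma Ell.young (ha : Ell l L a) (hl : 0 < l) (x : En n) (ξ η : Fin n → ℝ) (s t : ℝ) :
    -(2 * s * t * bil (a x) ξ η) ≤ s ^ 2 * bil (a x) ξ ξ + t ^ 2 * bil (a x) η η := by
  have := ha.nonneg hl x (s • ξ + t • η)
  rw [bil_add_left, bil_add_right, bil_add_right] at this
  simp only [bil_smul_left, bil_smul_right, bil_symm (ha.symm x) η ξ] at this
  nlinarith

lemma caccio_aux (ha : Ell l L a) {f φ : En n → ℝ} (hf : Sm f) (hφ : Sm φ)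
    (hc : HasCompactSupport φ)
    (h : ∫ x, bil (a x) (grd f x) (grd (fun y => φ y * φ y * f y) x) ≤ 0) :
    ∫ x, bil (a x) (grd (fun y => φ y * f y) x) (grd (fun y => φ y * f y) x)
      ≤ ∫ x, f x ^ 2 * bil (a x) (grd φ x) (grd φ x) := by
  have hg : Sm (fun y => φ y * φ y * f y) := (hφ.mul hφ).mul hf
  have e : ∀ x, bil (a x) (grd (fun y => φ y * f y) x) (grd (fun y => φ y * f y) x) =
      bil (a x) (grd f x) (grd (fun y => φ y * φ y * f y) x) +
      f x ^ 2 * bil (a x) (grd φ x) (grd φ x) := by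
    intro x
    rw [grd_mul hφ hf, grd_mul (hφ.mul hφ) hf, grd_mul hφ hφ]
    simp only [bil_add_left, bil_add_right, bil_smul_left, bil_smul_right,
      bil_symm (ha.symm x) (grd φ x) (grd f x)]
    ring
  simp_rw [e]
  rw [integral_add]
  · linarith
  · refine integ_of (bil_cont ha.cont hf.grd_cont hg.grd_cont) (hc.mul_left (f := fun y => φ y * f y)) fun x hx => ?_
    have h2 : (fun y => φ y * f y) * φ = fun y => φ y * φ y * f y := by ext y; simp; ring
    rw [h2] at hx
    rw [ts_grd hx]; simp [bil]
  · refine integ_of ((hf.continuous.pow 2).mul (bil_cont ha.cont hφ.grd_cont hφ.grd_cont)) hc fun x hx => ?_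
    rw [ts_grd hx]; simp [bil]

/-- Caccioppoli, weak form with coefficients -/
lemma caccio_sub (ha : Ell l L a) {f φ : En n → ℝ} (hf : Sm f) (hs : WSub a f) (h0 : ∀ x, 0 ≤ f x)
    (hφ : Sm φ) (hc : HasCompactSupport φ) :
    ∫ x, bil (a x) (grd (fun y => φ y * f y) x) (grd (fun y => φ y * f y) x)
      ≤ ∫ x, f x ^ 2 * bil (a x) (grd φ x) (grd φ x) :=
  caccio_aux ha hf hφ hc (hs _ ((hφ.mul hφ).mul hf)
    (HasCompactSupport.mul_right (HasCompactSupport.mul_left hc))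
    fun x => mul_nonneg (mul_self_nonneg _) (h0 x))

lemma caccio_sol (ha : Ell l L a) {f φ : En n → ℝ} (hf : Sm f) (hs : WSol a f)
    (hφ : Sm φ) (hc : HasCompactSupport φ) :
    ∫ x, bil (a x) (grd (fun y => φ y * f y) x) (grd (fun y => φ y * f y) x)
      ≤ ∫ x, f x ^ 2 * bil (a x) (grd φ x) (grd φ x) :=
  caccio_aux ha hf hφ hc (hs _ ((hφ.mul hφ).mul hf)
    (HasCompactSupport.mul_right (HasCompactSupport.mul_left hc))).le

/-- convert to plain gradients -/
lemma caccio_plain (ha : Ell l L a) {f φ : En n → ℝ} (hf : Sm f) (hφ : Sm φ)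
    (hc : HasCompactSupport φ)
    (h : ∫ x, bil (a x) (grd (fun y => φ y * f y) x) (grd (fun y => φ y * f y) x)
      ≤ ∫ x, f x ^ 2 * bil (a x) (grd φ x) (grd φ x)) :
    l * ∫ x, grd (fun y => φ y * f y) x ⬝ᵥ grd (fun y => φ y * f y) x
      ≤ L * ∫ x, f x ^ 2 * (grd φ x ⬝ᵥ grd φ x) := by
  have hg : Sm (fun y => φ y * f y) := hφ.mul hf
  have hcg : HasCompactSupport (fun y => φ y * f y) := hc.mul_right
  rw [← integral_const_mul, ← integral_const_mul]
  refine le_trans (integral_mono ?_ ?_ fun x => ha.low x _) (h.trans (integral_mono ?_ ?_ fun x => ?_))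
  · refine integ_of (continuous_const.mul (hg.grd_cont.dotProduct hg.grd_cont)) hcg fun x hx => ?_
    simp [ts_grd hx]
  · refine integ_of (bil_cont ha.cont hg.grd_cont hg.grd_cont) hcg fun x hx => ?_
    simp [ts_grd hx, bil]
  · refine integ_of ((hf.continuous.pow 2).mul (bil_cont ha.cont hφ.grd_cont hφ.grd_cont)) hc fun x hx => ?_
    simp [ts_grd hx, bil]
  · refine integ_of (continuous_const.mul ((hf.continuous.pow 2).mul
      (hφ.grd_cont.dotProduct hφ.grd_cont))) hc fun x hx => ?_
    simp [ts_grd hx]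
  · have := mul_le_mul_of_nonneg_left (ha.up x (grd φ x)) (sq_nonneg (f x))
    simp only; linarith

/-- logarithm of a positive supersolution -/
lemma log_super (ha : Ell l L a) {v φ : En n → ℝ} (hv : Sm v) (hpos : ∀ x, 0 < v x)
    (hs : WSub a (fun x => - v x)) (c : ℝ) (hφ : Sm φ)
    (hc : HasCompactSupport φ) (h0 : ∀ x, 0 ≤ φ x) :
    ∫ x, φ x * bil (a x) (grd (fun y => c - Real.log (v y)) x) (grd (fun y => c - Real.log (v y)) x)
      ≤ - ∫ x, bil (a x) (grd (fun y => c - Real.log (v y)) x) (grd φ x) := by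
  have hvi : Sm (fun x => (v x)⁻¹) := ContDiff.inv hv fun x => (hpos x).ne'
  have hw : Sm (fun y => c - Real.log (v y)) := contDiff_const.sub (ContDiff.log hv fun x => (hpos x).ne')
  have gw : ∀ x, grd (fun y => c - Real.log (v y)) x = (-(v x)⁻¹) • grd v x := fun x =>
    grd_comp (h := fun t => c - Real.log t) ((Real.hasDerivAt_log (hpos x).ne').const_sub c) (hv.diff x)
  have gi : ∀ x, grd (fun y => (v y)⁻¹) x = (-(v x ^ 2)⁻¹) • grd v x := fun x =>
    grd_comp (h := fun t => t⁻¹) (hasDerivAt_inv (hpos x).ne') (hv.diff x)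
  have := hs (fun x => φ x * (v x)⁻¹) (hφ.mul hvi) hc.mul_right
    (fun x => mul_nonneg (h0 x) (inv_nonneg.2 (hpos x).le))
  have e : ∀ x, bil (a x) (grd (fun x => - v x) x) (grd (fun x => φ x * (v x)⁻¹) x) =
      φ x * bil (a x) (grd (fun y => c - Real.log (v y)) x) (grd (fun y => c - Real.log (v y)) x)
       + bil (a x) (grd (fun y => c - Real.log (v y)) x) (grd φ x) := by
    intro x
    rw [grd_neg, grd_mul hφ hvi, gw, gi]
    simp only [bil_neg_left, bil_add_right, bil_smul_left, bil_smul_right]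
    have := (hpos x).ne'
    field_simp
    ring
  simp_rw [e] at this
  rw [integral_add] at this
  · linarith
  · refine integ_of (hφ.continuous.mul (bil_cont ha.cont hw.grd_cont hw.grd_cont)) hc fun x hx => ?_
    simp [ts_zero hx]
  · refine integ_of (bil_cont ha.cont hw.grd_cont hφ.grd_cont) hc fun x hx => ?_
    simp [ts_grd hx, bil]

lemma log_sub (ha : Ell l L a) (hl : 0 < l) {v : En n → ℝ} (hv : Sm v) (hpos : ∀ x, 0 < v x)
    (hs : WSub a (fun x => - v x)) (c : ℝ) : WSub a (fun y => c - Real.log (v y)) := by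
  intro φ hφ hc h0
  have h1 := log_super ha hv hpos hs c hφ hc h0
  have h2 : 0 ≤ ∫ x, φ x * bil (a x) (grd (fun y => c - Real.log (v y)) x)
      (grd (fun y => c - Real.log (v y)) x) :=
    integral_nonneg fun x => mul_nonneg (h0 x) (ha.nonneg hl x _)
  linarith

lemma log_energy (ha : Ell l L a) (hl : 0 < l) {v φ : En n → ℝ} (hv : Sm v) (hpos : ∀ x, 0 < v x)
    (hs : WSub a (fun x => - v x)) (c : ℝ) (hφ : Sm φ) (hc : HasCompactSupport φ) :
    ∫ x, φ x ^ 2 * bil (a x) (grd (fun y => c - Real.log (v y)) x)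
      (grd (fun y => c - Real.log (v y)) x) ≤ 4 * ∫ x, bil (a x) (grd φ x) (grd φ x) := by
  have hw : Sm (fun y => c - Real.log (v y)) := contDiff_const.sub (ContDiff.log hv fun x => (hpos x).ne')
  have h1 := log_super ha hv hpos hs c (hφ.mul hφ) hc.mul_left (fun x => mul_self_nonneg _)
  set w := fun y => c - Real.log (v y) with hwd
  have i1 : Integrable fun x => φ x ^ 2 * bil (a x) (grd w x) (grd w x) := by
    refine integ_of ((hφ.continuous.pow 2).mul (bil_cont ha.cont hw.grd_cont hw.grd_cont)) hc fun x hx => ?_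
    simp [ts_zero hx]
  have i2 : Integrable fun x => bil (a x) (grd φ x) (grd φ x) := by
    refine integ_of (bil_cont ha.cont hφ.grd_cont hφ.grd_cont) hc fun x hx => ?_
    simp [ts_grd hx, bil]
  have h2 : - ∫ x, bil (a x) (grd w x) (grd (fun x => φ x * φ x) x) ≤
      ∫ x, ((1/2) * (φ x ^ 2 * bil (a x) (grd w x) (grd w x)) + 2 * bil (a x) (grd φ x) (grd φ x)) := by
    rw [← integral_neg]
    refine integral_mono ?_ ((i1.const_mul _).add (i2.const_mul _)) fun x => ?_
    · refine (integ_of (bil_cont ha.cont hw.grd_cont (Sm.grd_cont (hφ.mul hφ))) hc fun x hx => ?_).neg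
      rw [grd_mul hφ hφ]
      simp [ts_zero hx, bil]
    · have := ha.young hl x (grd w x) (grd φ x) (φ x) 2
      simp only [grd_mul hφ hφ, bil_add_right, bil_smul_right]
      linarith
  rw [integral_add (i1.const_mul _) (i2.const_mul _), integral_const_mul, integral_const_mul] at h2
  have h3 : ∫ x, φ x * φ x * bil (a x) (grd w x) (grd w x) = ∫ x, φ x ^ 2 * bil (a x) (grd w x) (grd w x) := by
    simp_rw [pow_two]
  rw [h3] at h1
  linarith

/-- powers of positive subsolutions -/
lemma rpow_wsub (ha : Ell l L a) (hl : 0 < l) {w : En n → ℝ} (hw : Sm w) (hpos : ∀ x, 0 < w x)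
    (hs : WSub a w) {p : ℝ} (hp : 1 ≤ p) :
    Sm (fun x => w x ^ p) ∧ WSub a (fun x => w x ^ p) := by
  have sm : ∀ q : ℝ, Sm (fun x => w x ^ q) := fun q => ContDiff.rpow_const_of_ne hw fun x => (hpos x).ne'
  have gp : ∀ (q : ℝ) x, grd (fun x => w x ^ q) x = (q * w x ^ (q - 1)) • grd w x := fun q x =>
    grd_comp (h := fun t => t ^ q) (Real.hasDerivAt_rpow_const (Or.inl (hpos x).ne')) (hw.diff x)
  refine ⟨sm p, fun φ hφ hc h0 => ?_⟩
  have h1 := hs (fun x => φ x * w x ^ (p - 1)) (hφ.mul (sm _)) hc.mul_right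
    fun x => mul_nonneg (h0 x) (Real.rpow_nonneg (hpos x).le _)
  refine le_trans ?_ (mul_nonpos_of_nonneg_of_nonpos (zero_le_one.trans hp) h1)
  rw [← integral_const_mul]
  refine integral_mono ?_ ?_ fun x => ?_
  · refine integ_of (bil_cont ha.cont (sm p).grd_cont hφ.grd_cont) hc fun x hx => ?_
    simp [ts_grd hx, bil]
  · refine (integ_of (bil_cont ha.cont hw.grd_cont (Sm.grd_cont (hφ.mul (sm _)))) hc fun x hx => ?_).const_mul _
    rw [grd_mul hφ (sm _)]
    simp [ts_grd hx, ts_zero hx, bil]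
  · simp only
    rw [gp, grd_mul hφ (sm _), gp]
    simp only [bil_add_right, bil_smul_left, bil_smul_right]
    have k : 0 ≤ p * (φ x * ((p - 1) * w x ^ (p - 1 - 1) * bil (a x) (grd w x) (grd w x))) := by
      have := Real.rpow_nonneg (hpos x).le (p - 1 - 1)
      have := ha.nonneg hl x (grd w x)
      have := h0 x
      have : 0 ≤ p - 1 := by linarith
      positivity
    nlinarith

/-- scaling -/
lemma Ell.scale (ha : Ell l L a) (R : ℝ) : Ell l L (fun z => a (0 + R • z)) :=
  ⟨ha.cont.comp (by fun_prop), fun x => ha.symm _, fun x => ha.low _, fun x => ha.up _⟩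

lemma integral_scale (F : En n → ℝ) {R : ℝ} (hR : 0 < R) :
    ∫ z, F (0 + R • z) = (R ^ n)⁻¹ * ∫ x, F x := by
  simp only [zero_add]
  rw [Measure.integral_comp_smul]
  simp [abs_of_pos hR]

lemma scale_aux {f φ : En n → ℝ} (hf : Sm f) (hφ : Sm φ) {R : ℝ} (hR : 0 < R) :
    ∫ z, bil (a (0 + R • z)) (grd (fun z => f (0 + R • z)) z) (grd φ z) =
     R ^ 2 * ((R ^ n)⁻¹ * ∫ x, bil (a x) (grd f x) (grd (fun x => φ (0 + R⁻¹ • x)) x)) := by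
  rw [← integral_scale (fun x => bil (a x) (grd f x) (grd (fun x => φ (0 + R⁻¹ • x)) x)) hR,
    ← integral_const_mul]
  congr 1; ext z
  rw [grd_scale hf, grd_scale hφ, bil_smul_left, bil_smul_right]
  have : (0 : En n) + R⁻¹ • (0 + R • z) = z := by simp [smul_smul, inv_mul_cancel₀ hR.ne']
  rw [this]
  field_simp

lemma cs_scale {φ : En n → ℝ} (hc : HasCompactSupport φ) {R : ℝ} (hR : 0 < R) :
    HasCompactSupport (fun x => φ (0 + R • x)) := by
  have := hc.comp_homeomorph (Homeomorph.smulOfNeZero R hR.ne')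
  simpa [Function.comp_def] using this

lemma WSub.scale {f : En n → ℝ} (hf : Sm f) (hs : WSub a f) {R : ℝ} (hR : 0 < R) :
    WSub (fun z => a (0 + R • z)) (fun z => f (0 + R • z)) := by
  intro φ hφ hc h0
  rw [scale_aux hf hφ hR]
  have := hs _ (hφ.scale R⁻¹ 0) (cs_scale hc (inv_pos.2 hR)) fun x => h0 _
  exact mul_nonpos_of_nonneg_of_nonpos (by positivity)
    (mul_nonpos_of_nonneg_of_nonpos (by positivity) this)

/-- cutoff functions -/
lemma exists_cutoff : ∃ C : ℝ, 0 < C ∧ ∀ (n : ℕ) (s r : ℝ), 0 < s → s < r →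
    ∃ φ : En n → ℝ, Sm φ ∧ HasCompactSupport φ ∧ (∀ x, 0 ≤ φ x) ∧ (∀ x, φ x ≤ 1) ∧
      (∀ x, ‖x‖ ≤ s → φ x = 1) ∧ (∀ x, r < ‖x‖ → φ x = 0 ∧ grd φ x = 0) ∧
      ∀ x, grd φ x ⬝ᵥ grd φ x ≤ C / (r - s) ^ 2 := by
  have hcd : Continuous (deriv Real.smoothTransition) :=
    (Real.smoothTransition.contDiff (n := 1)).continuous_deriv le_rfl
  obtain ⟨K, hK⟩ := (isCompact_Icc (a := (0:ℝ)) (b := 1)).exists_bound_of_continuousOn hcd.continuousOn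
  have hK0 : 0 ≤ K := (norm_nonneg _).trans (hK 0 (by simp))
  refine ⟨4 * K ^ 2 + 1, by positivity, fun n s r hs hr => ?_⟩
  have hd : 0 < r ^ 2 - s ^ 2 := by nlinarith
  set qq : En n → ℝ := fun z => (r ^ 2 - ‖z‖ ^ 2) / (r ^ 2 - s ^ 2) with hq
  have hqs : Sm qq := (contDiff_const.sub (contDiff_norm_sq ℝ)).div_const _
  have hst : ContDiff ℝ ∞ Real.smoothTransition := Real.smoothTransition.contDiff
  have sφ : Sm (fun z => Real.smoothTransition (qq z)) := hst.comp hqs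
  have z0 : ∀ x : En n, r ≤ ‖x‖ → Real.smoothTransition (qq x) = 0 := fun x hx =>
    Real.smoothTransition.zero_of_nonpos (div_nonpos_of_nonpos_of_nonneg (by nlinarith) hd.le)
  have sub : Function.support (fun z : En n => Real.smoothTransition (qq z)) ⊆ closedBall 0 r := by
    intro x hx
    by_contra h
    simp at h
    exact hx (z0 x h.le)
  have tsub : tsupport (fun z : En n => Real.smoothTransition (qq z)) ⊆ closedBall 0 r :=
    closure_minimal sub isClosed_closedBall
  refine ⟨fun z => Real.smoothTransition (qq z), sφ,
    HasCompactSupport.of_support_subset_isCompact (isCompact_closedBall 0 r) sub,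
    fun x => Real.smoothTransition.nonneg _, fun x => Real.smoothTransition.le_one _, ?_, ?_, ?_⟩
  · intro x hx
    apply Real.smoothTransition.one_of_one_le
    rw [hq, le_div_iff₀ hd]
    have := norm_nonneg x
    nlinarith
  · intro x hx
    refine ⟨z0 x hx.le, ts_grd fun h => ?_⟩
    have := tsub h
    simp at this; linarith
  · intro x
    by_cases hx : r < ‖x‖
    · rw [ts_grd fun h => by have := tsub h; simp at this; linarith]
      simp; positivity
    have gq : grd (fun z => Real.smoothTransition (qq z)) x
        = (deriv Real.smoothTransition (qq x)) • grd qq x :=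
      grd_comp (hst.differentiable (by simp) _).hasDerivAt (hqs.diff x)
    have gn : grd qq x = (-2 / (r ^ 2 - s ^ 2)) • (x : Fin n → ℝ) := by
      ext i
      have h1 : HasFDerivAt (fun z : En n => ‖z‖ ^ 2) ((2:ℝ) • (innerSL ℝ x)) x := by
        simpa [two_smul] using (hasStrictFDerivAt_norm_sq x).hasFDerivAt
      have h2 : HasFDerivAt qq ((r ^ 2 - s ^ 2)⁻¹ • (-((2:ℝ) • (innerSL ℝ x)))) x := by
        have := (h1.const_sub (r ^ 2)).const_mul (r ^ 2 - s ^ 2)⁻¹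
        simpa [hq, div_eq_inv_mul] using this
      simp [grd, pdrv, h2.fderiv, EuclideanSpace.inner_single_right]
      field_simp
    have dK : (deriv Real.smoothTransition (qq x)) ^ 2 ≤ K ^ 2 := by
      by_cases h : qq x ≤ 1
      · have hx0 : 0 ≤ qq x := by
          apply div_nonneg _ hd.le
          have := norm_nonneg x
          nlinarith
        have := hK _ ⟨hx0, h⟩
        rw [← sq_abs, ← Real.norm_eq_abs]
        exact pow_le_pow_left₀ (norm_nonneg _) this 2
      · have : deriv Real.smoothTransition (qq x) = 0 := by
          have : Real.smoothTransition =ᶠ[nhds (qq x)] fun _ => 1 := by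
            filter_upwards [lt_mem_nhds (not_le.1 h)] with y hy
            exact Real.smoothTransition.one_of_one_le hy.le
          rw [this.deriv_eq]; simp
        rw [this]; simpa using sq_nonneg K
    rw [gq, gn]
    simp only [smul_dotProduct, dotProduct_smul, smul_eq_mul]
    have hxx : (x : Fin n → ℝ) ⬝ᵥ (x : Fin n → ℝ) = ‖x‖ ^ 2 := by rw [euc_norm_sq]; rfl
    rw [hxx]
    have hn2 : ‖x‖ ^ 2 ≤ r ^ 2 := pow_le_pow_left₀ (norm_nonneg _) (not_lt.1 hx) 2
    have e : deriv Real.smoothTransition (qq x) * (-2 / (r ^ 2 - s ^ 2) *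
        (deriv Real.smoothTransition (qq x) * (-2 / (r ^ 2 - s ^ 2) * ‖x‖ ^ 2)))
        = 4 * (deriv Real.smoothTransition (qq x)) ^ 2 * (‖x‖ ^ 2 / (r ^ 2 - s ^ 2) ^ 2) := by
      field_simp; ring
    have b2 : ‖x‖ ^ 2 / (r ^ 2 - s ^ 2) ^ 2 ≤ 1 / (r - s) ^ 2 := by
      have : 0 < r - s := by linarith
      rw [div_le_div_iff₀ (by positivity) (by positivity)]
      have : (r ^ 2 - s ^ 2) ^ 2 = (r + s) ^ 2 * (r - s) ^ 2 := by ring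
      rw [this]
      have h3 : ‖x‖ ^ 2 ≤ (r + s) ^ 2 := hn2.trans (by nlinarith)
      nlinarith [sq_nonneg (r - s)]
    have fin : 4 * (deriv Real.smoothTransition (qq x)) ^ 2 * (‖x‖ ^ 2 / (r ^ 2 - s ^ 2) ^ 2)
        ≤ 4 * K ^ 2 * (1 / (r - s) ^ 2) :=
      mul_le_mul (by linarith) b2 (by positivity) (by positivity)
    have : (4 * K ^ 2 + 1) / (r - s) ^ 2 = 4 * K ^ 2 * (1 / (r - s) ^ 2) + 1 / (r - s) ^ 2 := by ring
    rw [this]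
    have : 0 ≤ 1 / (r - s) ^ 2 := by positivity
    refine le_trans (le_of_eq ?_) (fin.trans (by linarith))
    rw [← e]; try ring

end P2

section P3
variable {n : ℕ}

lemma integrableOn_cb {F : En n → ℝ} (hF : Continuous F) (r : ℝ) :
    IntegrableOn F (closedBall 0 r) :=
  hF.continuousOn.integrableOn_compact (isCompact_closedBall 0 r)

lemma gns_real (hn : 2 ≤ n) : ∃ C : ℝ, 0 ≤ C ∧ ∀ F : En n → ℝ, Sm F → HasCompactSupport F →
    (∀ x, 0 ≤ F x) → ∫ x, F x ^ ((n:ℝ) / (n - 1)) ≤ C * (∫ x, ‖fderiv ℝ F x‖) ^ ((n:ℝ) / (n - 1)) := by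
  have hn' : (1:ℝ) < n := by exact_mod_cast hn
  have hκ : 0 < (n:ℝ) / (n - 1) := div_pos (by linarith) (by linarith)
  set κ := (n:ℝ) / (n - 1)
  have hconj : ((Module.finrank ℝ (En n) : ℕ) : ℝ).HolderConjugate κ := by
    rw [finrank_euclideanSpace, Fintype.card_fin]
    exact Real.HolderConjugate.conjExponent hn'
  refine ⟨lintegralPowLePowLIntegralFDerivConst (volume : Measure (En n)) κ, NNReal.coe_nonneg _, ?_⟩
  intro F hF hc h0
  have h := lintegral_pow_le_pow_lintegral_fderiv (volume : Measure (En n)) (u := F)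
    (ContDiff.of_le hF (WithTop.coe_le_coe.2 (le_top : (1:ℕ∞) ≤ ⊤))) hc hconj
  have cF : Continuous (fderiv ℝ F) := ContDiff.continuous_fderiv hF (by simp)
  have i1 : Integrable fun x => ‖fderiv ℝ F x‖ :=
    (cF.integrable_of_hasCompactSupport (hc.fderiv (𝕜 := ℝ))).norm
  have e1 : ∫⁻ x, ‖fderiv ℝ F x‖ₑ = ENNReal.ofReal (∫ x, ‖fderiv ℝ F x‖) := by
    rw [ofReal_integral_eq_lintegral_ofReal i1 (Filter.Eventually.of_forall fun x => norm_nonneg _)]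
    simp
  have cp : Continuous fun x => F x ^ κ := (hF.continuous).rpow_const fun x => Or.inr hκ.le
  have i2 : Integrable fun x => F x ^ κ := by
    refine integ_of cp hc fun x hx => ?_
    rw [ts_zero hx, Real.zero_rpow hκ.ne']
  have e2 : ∫⁻ x, ‖F x‖ₑ ^ κ = ENNReal.ofReal (∫ x, F x ^ κ) := by
    rw [ofReal_integral_eq_lintegral_ofReal i2 (Filter.Eventually.of_forall fun x => Real.rpow_nonneg (h0 x) _)]
    refine lintegral_congr fun x => ?_
    rw [Real.enorm_eq_ofReal (h0 x), ENNReal.ofReal_rpow_of_nonneg (h0 x) hκ.le]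
  have hI : 0 ≤ ∫ x, ‖fderiv ℝ F x‖ := integral_nonneg fun x => norm_nonneg _
  rw [e1, e2, ENNReal.ofReal_rpow_of_nonneg hI hκ.le, ← ENNReal.ofReal_coe_nnreal,
    ← ENNReal.ofReal_mul (NNReal.coe_nonneg _)] at h
  exact (ENNReal.ofReal_le_ofReal_iff (by positivity)).1 h

lemma moser_step (hn : 2 ≤ n) {l L : ℝ} (hl : 0 < l) (hL : 0 < L) : ∃ D : ℝ, 0 < D ∧
    ∀ (a : En n → Matrix (Fin n) (Fin n) ℝ), Ell l L a → ∀ f : En n → ℝ, Sm f → WSub a f →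
    (∀ x, 0 ≤ f x) → ∀ s r : ℝ, 0 < s → s < r →
    ∫ x in closedBall (0 : En n) s, (f x ^ 2) ^ ((n:ℝ) / (n - 1)) ≤
      (D / (r - s) * ∫ x in closedBall (0 : En n) r, f x ^ 2) ^ ((n:ℝ) / (n - 1)) := by
  obtain ⟨C, hC, hgns⟩ := gns_real hn
  obtain ⟨C0, hC0, hcut⟩ := exists_cutoff
  have hn' : (1:ℝ) < n := by exact_mod_cast hn
  have hκ : 0 < (n:ℝ) / (n - 1) := div_pos (by linarith) (by linarith)
  set κ := (n:ℝ) / (n - 1)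
  set D := (C + 1) ^ κ⁻¹ * (1 + L / l * C0) with hD
  have hD1 : 0 < 1 + L / l * C0 := by positivity
  refine ⟨D, by positivity, ?_⟩
  intro a ha f hf hs h0 s r hs0 hsr
  obtain ⟨φ, hφ, hc, hφ0, hφ1, hφs, hφr, hφg⟩ := hcut n s r hs0 hsr
  set ρ := r - s with hρ
  have hρ0 : 0 < ρ := by linarith
  set g := fun y => φ y * f y with hg
  have sg : Sm g := hφ.mul hf
  have cg : HasCompactSupport g := hc.mul_right
  set J := ∫ x in closedBall (0 : En n) r, f x ^ 2 with hJ
  have hJ0 : 0 ≤ J := integral_nonneg fun x => sq_nonneg _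
  have cac := caccio_plain ha hf hφ hc (caccio_sub ha hf hs h0 hφ hc)
  have b1 : ∫ x, f x ^ 2 * (grd φ x ⬝ᵥ grd φ x) ≤ C0 / ρ ^ 2 * J := by
    have : ∫ x, f x ^ 2 * (grd φ x ⬝ᵥ grd φ x) =
        ∫ x in closedBall (0:En n) r, f x ^ 2 * (grd φ x ⬝ᵥ grd φ x) := by
      rw [setIntegral_eq_integral_of_forall_compl_eq_zero]
      intro x hx
      rw [(hφr x (by simpa using hx)).2]; simp
    rw [this, hJ, ← integral_const_mul]
    refine integral_mono (integrableOn_cb ((hf.continuous.pow 2).mul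
      (hφ.grd_cont.dotProduct hφ.grd_cont)) r) ((integrableOn_cb (hf.continuous.pow 2) r).const_mul _)
      fun x => ?_
    have := mul_le_mul_of_nonneg_left (hφg x) (sq_nonneg (f x))
    simp only; linarith
  have b2 : ∫ x, grd g x ⬝ᵥ grd g x ≤ L / l * (C0 / ρ ^ 2 * J) := by
    rw [div_mul_eq_mul_div, le_div_iff₀ hl, mul_comm]
    exact cac.trans (mul_le_mul_of_nonneg_left b1 hL.le)
  have b3 : ∫ x, g x ^ 2 ≤ J := by
    have : ∫ x, g x ^ 2 = ∫ x in closedBall (0:En n) r, g x ^ 2 := by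
      rw [setIntegral_eq_integral_of_forall_compl_eq_zero]
      intro x hx
      simp [hg, (hφr x (by simpa using hx)).1]
    rw [this, hJ]
    refine integral_mono (integrableOn_cb (sg.continuous.pow 2) r) (integrableOn_cb (hf.continuous.pow 2) r)
      fun x => ?_
    simp only [hg, mul_pow]
    have : φ x ^ 2 ≤ 1 := pow_le_one₀ (hφ0 x) (hφ1 x)
    nlinarith [sq_nonneg (f x)]
  have sF : Sm (fun x => g x * g x) := sg.mul sg
  have b4 : ∫ x, ‖fderiv ℝ (fun x => g x * g x) x‖ ≤ (1 + L / l * C0) / ρ * J := by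
    have i1 : Integrable fun x => g x ^ 2 := integ_of (sg.continuous.pow 2) cg fun x hx => by simp [ts_zero hx]
    have i2 : Integrable fun x => grd g x ⬝ᵥ grd g x :=
      integ_of (sg.grd_cont.dotProduct sg.grd_cont) cg fun x hx => by simp [ts_grd hx]
    have : ∫ x, ‖fderiv ℝ (fun x => g x * g x) x‖ ≤ ∫ x, (ρ⁻¹ * g x ^ 2 + ρ * (grd g x ⬝ᵥ grd g x)) := by
      refine integral_mono ?_ ((i1.const_mul _).add (i2.const_mul _)) fun x => ?_
      · have cF : Continuous (fderiv ℝ (fun x => g x * g x)) := ContDiff.continuous_fderiv sF (by simp)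
        exact (cF.integrable_of_hasCompactSupport ((cg.mul_left (f := g)).fderiv (𝕜 := ℝ))).norm
      · refine (norm_fderiv_le _ x).trans ?_
        rw [grd_mul sg sg]
        apply Real.sqrt_le_iff.2
        have hd := dot_self_nonneg' (grd g x)
        refine ⟨by positivity, ?_⟩
        simp only [add_dotProduct, dotProduct_add, smul_dotProduct, dotProduct_smul, smul_eq_mul]
        have e : ρ⁻¹ * ρ = 1 := inv_mul_cancel₀ hρ0.ne'
        have := sq_nonneg (ρ⁻¹ * g x ^ 2 - ρ * (grd g x ⬝ᵥ grd g x))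
        nlinarith [mul_comm (g x ^ 2) (grd g x ⬝ᵥ grd g x)]
    rw [integral_add (i1.const_mul _) (i2.const_mul _), integral_const_mul, integral_const_mul] at this
    refine this.trans ?_
    have e : (1 + L / l * C0) / ρ * J = ρ⁻¹ * J + ρ * (L / l * (C0 / ρ ^ 2 * J)) := by
      field_simp
    rw [e]
    gcongr
  have b5 := hgns _ sF (cg.mul_left (f := g)) fun x => mul_self_nonneg _
  have b6 : ∫ x in closedBall (0 : En n) s, (f x ^ 2) ^ κ ≤ ∫ x, (g x * g x) ^ κ := by
    have i : Integrable fun x => (g x * g x) ^ κ :=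
      integ_of (sF.continuous.rpow_const fun x => Or.inr hκ.le) cg fun x hx => by
        simp [ts_zero hx, Real.zero_rpow hκ.ne']
    refine le_trans (le_of_eq ?_) (setIntegral_le_integral (s := closedBall (0 : En n) s) i
      (Filter.Eventually.of_forall fun x => Real.rpow_nonneg (mul_self_nonneg _) _))
    refine setIntegral_congr_fun measurableSet_closedBall fun x hx => ?_
    simp only [hg, hφs x (by simpa using hx), one_mul, pow_two]
  refine b6.trans (b5.trans ?_)
  have hJ2 : 0 ≤ (1 + L / l * C0) / ρ * J := by positivity
  calc C * (∫ x, ‖fderiv ℝ (fun x => g x * g x) x‖) ^ κ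
      ≤ (C + 1) * ((1 + L / l * C0) / ρ * J) ^ κ := by
        refine mul_le_mul (by linarith) (Real.rpow_le_rpow (integral_nonneg fun x => norm_nonneg _) b4 hκ.le)
          (Real.rpow_nonneg (integral_nonneg fun x => norm_nonneg _) _) (by linarith)
    _ = (D / ρ * J) ^ κ := by
        have : D / ρ * J = (C + 1) ^ κ⁻¹ * ((1 + L / l * C0) / ρ * J) := by rw [hD]; ring
        rw [this, Real.mul_rpow (by positivity) hJ2, ← Real.rpow_mul (by linarith), inv_mul_cancel₀ hκ.ne',
          Real.rpow_one]

lemma moser (hn : 2 ≤ n) {l L : ℝ} (hl : 0 < l) (hL : 0 < L) : ∃ c0 : ℝ, 0 < c0 ∧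
    ∀ (a : En n → Matrix (Fin n) (Fin n) ℝ), Ell l L a → ∀ w : En n → ℝ, Sm w → WSub a w →
    (∀ x, 0 < w x) → ∫ x in closedBall (0 : En n) 2, w x ^ 2 ≤ c0 → ∀ x, ‖x‖ < 1 → w x ≤ 1 := by
  obtain ⟨D, hD, hstep⟩ := moser_step hn hl hL
  have hn' : (1:ℝ) < n := by exact_mod_cast hn
  have hn1 : 0 < (n:ℝ) - 1 := by linarith
  have hκ : 0 < (n:ℝ) / (n - 1) := div_pos (by linarith) (by linarith)
  have hκ1 : 1 ≤ (n:ℝ) / (n - 1) := by rw [le_div_iff₀ hn1]; linarith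
  have hκe : ((n:ℝ) / (n - 1)) * (n - 1) = n := by field_simp
  set κ := (n:ℝ) / (n - 1)
  set E := (2 * D) ^ κ * 2 ^ (n:ℝ) with hE
  have hE0 : 0 < E := by positivity
  set c0 := E ^ (-((n:ℝ) - 1)) with hc0
  have hc00 : 0 < c0 := by positivity
  have hcE : E * c0 ^ κ = c0 := by
    rw [hc0, ← Real.rpow_mul hE0.le]
    nth_rewrite 1 [← Real.rpow_one E]
    rw [← Real.rpow_add hE0]
    congr 1
    nlinarith
  refine ⟨c0, hc00, ?_⟩
  intro a ha w hw hs hpos hJ0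
  set J : ℕ → ℝ := fun k => ∫ x in closedBall (0 : En n) (1 + (2⁻¹) ^ k), (w x ^ (κ ^ k)) ^ 2 with hJ
  have hJk : ∀ k, J k ≤ c0 * (2 ^ (-(n:ℝ))) ^ k := by
    intro k
    induction k with
    | zero =>
      simp only [hJ, pow_zero, Real.rpow_one, mul_one]
      norm_num
      exact hJ0
    | succ k ih =>
      have hp : 1 ≤ κ ^ k := one_le_pow₀ hκ1
      obtain ⟨s1, s2⟩ := rpow_wsub ha hl hw hpos hs hp
      have := hstep a ha _ s1 s2 (fun x => Real.rpow_nonneg (hpos x).le _) (1 + (2⁻¹) ^ (k+1))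
        (1 + (2⁻¹) ^ k) (by positivity) (by
          have : (0:ℝ) < 2⁻¹ ^ k := by positivity
          rw [pow_succ]; linarith)
      have e : J (k+1) = ∫ x in closedBall (0 : En n) (1 + (2⁻¹) ^ (k+1)), ((w x ^ (κ ^ k)) ^ 2) ^ κ := by
        simp only [hJ]
        congr 1; ext x
        have := (hpos x).le
        have h3 : 0 ≤ w x ^ (κ ^ k) := Real.rpow_nonneg this _
        rw [pow_succ κ, Real.rpow_mul this, ← Real.rpow_two, ← Real.rpow_two,
          ← Real.rpow_mul h3, ← Real.rpow_mul h3, mul_comm]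
      rw [e]
      refine this.trans ?_
      have e2 : D / (1 + 2⁻¹ ^ k - (1 + 2⁻¹ ^ (k+1))) = 2 * D * 2 ^ k := by
        have : (1:ℝ) + 2⁻¹ ^ k - (1 + 2⁻¹ ^ (k+1)) = (2 * 2 ^ k)⁻¹ := by
          rw [pow_succ, inv_pow]; field_simp; ring
        rw [this]; field_simp
      rw [e2]
      have hJn : 0 ≤ J k := integral_nonneg fun x => sq_nonneg _
      calc (2 * D * 2 ^ k * J k) ^ κ ≤ (2 * D * 2 ^ k * (c0 * (2 ^ (-(n:ℝ))) ^ k)) ^ κ := by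
            gcongr
        _ = (2 * D) ^ κ * c0 ^ κ * ((2 * 2 ^ (-(n:ℝ))) ^ κ) ^ k := by
            have : 2 * D * 2 ^ k * (c0 * (2 ^ (-(n:ℝ))) ^ k) = (2 * D) * c0 * (2 * 2 ^ (-(n:ℝ))) ^ k := by
              rw [mul_pow]; ring
            rw [this, Real.mul_rpow (by positivity) (by positivity), Real.mul_rpow (by positivity) (by positivity)]
            congr 1
            rw [← Real.rpow_natCast, ← Real.rpow_natCast, ← Real.rpow_mul (by positivity),
              ← Real.rpow_mul (by positivity), mul_comm κ]
        _ = (2 * D) ^ κ * c0 ^ κ * (2 ^ (-(n:ℝ))) ^ k := by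
            congr 2
            have : (2:ℝ) * 2 ^ (-(n:ℝ)) = 2 ^ (1 - (n:ℝ)) := by
              rw [sub_eq_add_neg, Real.rpow_add (by norm_num), Real.rpow_one]
            rw [this, ← Real.rpow_mul (by norm_num)]
            congr 1; linarith
        _ = c0 * (2 ^ (-(n:ℝ))) ^ (k+1) := by
            have h1 : (2:ℝ) ^ (n:ℝ) * 2 ^ (-(n:ℝ)) = 1 := by
              rw [← Real.rpow_add (by norm_num)]; simp
            calc _ = (2 * D) ^ κ * c0 ^ κ * ((2:ℝ) ^ (n:ℝ) * 2 ^ (-(n:ℝ))) * (2 ^ (-(n:ℝ))) ^ k := by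
                  rw [h1]; ring
              _ = (E * c0 ^ κ) * (2 ^ (-(n:ℝ))) ^ (k+1) := by rw [hE]; ring
              _ = _ := by rw [hcE]
  intro x hx
  by_contra hcon
  push Not at hcon
  have hopen : IsOpen ({y | 1 < w y} ∩ ball (0 : En n) 1) :=
    (isOpen_lt continuous_const hw.continuous).inter isOpen_ball
  have hvol : 0 < volume ({y | 1 < w y} ∩ ball (0 : En n) 1) :=
    hopen.measure_pos _ ⟨x, hcon, by simpa using hx⟩
  have hfin : volume ({y | 1 < w y} ∩ ball (0 : En n) 1) < ⊤ :=
    (measure_mono Set.inter_subset_right).trans_lt measure_ball_lt_top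
  set m := volume.real ({y | 1 < w y} ∩ ball (0 : En n) 1) with hm
  have hm0 : 0 < m := ENNReal.toReal_pos hvol.ne' hfin.ne
  have hlow : ∀ k, m ≤ J k := by
    intro k
    have cc : Continuous fun x => (w x ^ (κ ^ k)) ^ 2 :=
      (hw.continuous.rpow_const fun x => Or.inl (hpos x).ne').pow 2
    calc m = ∫ x in ({y | 1 < w y} ∩ ball (0 : En n) 1), (1:ℝ) := by simp [hm]
      _ ≤ ∫ x in ({y | 1 < w y} ∩ ball (0 : En n) 1), (w x ^ (κ ^ k)) ^ 2 := by
        refine setIntegral_mono_on (integrableOn_const hfin.ne) ?_ hopen.measurableSet ?_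
        · refine (integrableOn_cb cc 1).mono_set (Set.inter_subset_right.trans ball_subset_closedBall)
        · intro y hy
          have : 1 ≤ w y ^ (κ ^ k) := Real.one_le_rpow (le_of_lt hy.1) (by positivity)
          nlinarith
      _ ≤ J k := by
        refine setIntegral_mono_set (integrableOn_cb cc _)
          (Filter.Eventually.of_forall fun y => sq_nonneg _) (Filter.Eventually.of_forall ?_)
        intro y hy
        have : ‖y‖ < 1 := by simpa using hy.2
        have h2 : (0:ℝ) < 2⁻¹ ^ k := by positivity
        show y ∈ closedBall (0 : En n) _
        simp only [mem_closedBall_zero_iff]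
        linarith
  have hlim : Filter.Tendsto (fun k => c0 * ((2:ℝ) ^ (-(n:ℝ))) ^ k) Filter.atTop (nhds (c0 * 0)) := by
    refine (tendsto_pow_atTop_nhds_zero_of_lt_one (by positivity) ?_).const_mul _
    exact Real.rpow_lt_one_of_one_lt_of_neg (by norm_num) (by linarith)
  have := ge_of_tendsto' hlim fun k => (hlow k).trans (hJk k)
  linarith

end P3

section P4
variable {n : ℕ}

/-- squared length of the gradient -/
def gsq (F : En n → ℝ) (x : En n) : ℝ := grd F x ⬝ᵥ grd F x

lemma gsq_nonneg (F : En n → ℝ) (x : En n) : 0 ≤ gsq F x := dot_self_nonneg' _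

lemma gsq_cont {F : En n → ℝ} (hF : Sm F) : Continuous (gsq F) :=
  hF.grd_cont.dotProduct hF.grd_cont

lemma seg_ineq {F : En n → ℝ} (hF : Sm F) (x y : En n) :
    (F x - F y) ^ 2 ≤ ‖x - y‖ ^ 2 * ∫ t in (0:ℝ)..1, gsq F (y + t • (x - y)) := by
  set p : ℝ → ℝ := fun t => fderiv ℝ F (y + t • (x - y)) (x - y) with hp
  have cF : Continuous (fderiv ℝ F) := ContDiff.continuous_fderiv hF (by simp)
  have cp : Continuous p := (cF.comp (by fun_prop)).clm_apply continuous_const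
  have hd : ∀ t ∈ Set.uIcc (0:ℝ) 1, HasDerivAt (fun t : ℝ => F (y + t • (x - y))) (p t) t := by
    intro t _
    have h1 : HasDerivAt (fun t : ℝ => y + t • (x - y)) (x - y) t := by
      simpa using ((hasDerivAt_id t).smul_const (x - y)).const_add y
    exact (hF.diff _).hasFDerivAt.comp_hasDerivAt t h1
  have h := intervalIntegral.integral_eq_sub_of_hasDerivAt hd (cp.intervalIntegrable _ _)
  simp at h
  rw [← h]
  set c := ∫ t in (0:ℝ)..1, p t with hc
  have h2 : 0 ≤ ∫ t in (0:ℝ)..1, (p t - c) ^ 2 :=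
    intervalIntegral.integral_nonneg zero_le_one fun t _ => sq_nonneg _
  have e : ∀ t, (p t - c) ^ 2 = (p t ^ 2 - (2 * c) * p t) + c ^ 2 := fun t => by ring
  simp_rw [e] at h2
  have cp2 : Continuous fun t => p t ^ 2 := cp.pow 2
  have cp3 : Continuous fun t => 2 * c * p t := continuous_const.mul cp
  have cp4 : Continuous fun t => p t ^ 2 - 2 * c * p t := cp2.sub cp3
  rw [intervalIntegral.integral_add (cp4.intervalIntegrable _ _)
    (continuous_const.intervalIntegrable _ _),
    intervalIntegral.integral_sub (cp2.intervalIntegrable _ _) (cp3.intervalIntegrable _ _),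
    intervalIntegral.integral_const_mul, ← hc] at h2
  simp at h2
  have h3 : ∫ t in (0:ℝ)..1, p t ^ 2 ≤ ‖x - y‖ ^ 2 * ∫ t in (0:ℝ)..1, gsq F (y + t • (x - y)) := by
    rw [← intervalIntegral.integral_const_mul]
    refine intervalIntegral.integral_mono_on zero_le_one (cp2.intervalIntegrable _ _)
      (Continuous.intervalIntegrable (continuous_const.mul ((gsq_cont hF).comp (by fun_prop))) _ _)
      fun t _ => ?_
    have := abs_fderiv_le F (y + t • (x - y)) (x - y)
    have h4 := pow_le_pow_left₀ (abs_nonneg _) this 2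
    rw [sq_abs, mul_pow, Real.sq_sqrt (dot_self_nonneg' _)] at h4
    simp only [hp, gsq]; linarith
  nlinarith

lemma poincare_swap {G : En n → ENNReal} (mG : Measurable G) (c : ENNReal) {B2 : Set (En n)}
    (mB : MeasurableSet B2) :
    ∫⁻ y, ∫⁻ x, c * (B2.indicator 1 (x - y) * ∫⁻ t in Set.Ioc (0:ℝ) 1, G (y + t • (x - y))) =
      c * (volume B2 * ∫⁻ y, G y) := by
  have mH : Measurable fun q : En n × En n => ∫⁻ t in Set.Ioc (0:ℝ) 1, G (q.1 + t • q.2) := by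
    apply Measurable.lintegral_prod_right'
      (f := fun q : (En n × En n) × ℝ => G (q.1.1 + q.2 • q.1.2))
    exact mG.comp (by fun_prop)
  have mI : Measurable fun h : En n => B2.indicator (1 : En n → ENNReal) h :=
    measurable_one.indicator mB
  calc _ = ∫⁻ y, ∫⁻ h, c * (B2.indicator 1 h * ∫⁻ t in Set.Ioc (0:ℝ) 1, G (y + t • h)) := by
        refine lintegral_congr fun y => ?_
        exact lintegral_sub_right_eq_self (fun h => c * (B2.indicator 1 h *
          ∫⁻ t in Set.Ioc (0:ℝ) 1, G (y + t • h))) y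
    _ = ∫⁻ h, ∫⁻ y, c * (B2.indicator 1 h * ∫⁻ t in Set.Ioc (0:ℝ) 1, G (y + t • h)) := by
        refine lintegral_lintegral_swap (Measurable.aemeasurable ?_)
        exact measurable_const.mul ((mI.comp measurable_snd).mul mH)
    _ = ∫⁻ h, c * (B2.indicator 1 h * ∫⁻ y, G y) := by
        refine lintegral_congr fun h => ?_
        have mh : Measurable fun y : En n => ∫⁻ t in Set.Ioc (0:ℝ) 1, G (y + t • h) :=
          mH.comp (measurable_id.prodMk measurable_const)
        rw [lintegral_const_mul _ (mh.const_mul _), lintegral_const_mul _ mh]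
        congr 2
        rw [lintegral_lintegral_swap]
        · have : ∀ t : ℝ, ∫⁻ y, G (y + t • h) = ∫⁻ y, G y := fun t => lintegral_add_right_eq_self G _
          simp_rw [this]
          simp
        · refine Measurable.aemeasurable (mG.comp (f := fun q : En n × ℝ => q.1 + q.2 • h) ?_)
          fun_prop
    _ = _ := by
        rw [lintegral_const_mul _ (mI.mul_const _), lintegral_mul_const _ mI,
          lintegral_indicator_one mB]

lemma poincare_key {F : En n → ℝ} (hF : Sm F) {r : ℝ} (hr : 0 < r) {x y : En n}
    (hy : y ∈ closedBall (0:En n) r) (hx : x ∈ closedBall (0:En n) r) :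
    ENNReal.ofReal ((F x - F y) ^ 2) ≤
      ENNReal.ofReal (4 * r ^ 2) * ((closedBall (0:En n) (2 * r)).indicator 1 (x - y) *
      ∫⁻ t in Set.Ioc (0:ℝ) 1, (closedBall (0:En n) r).indicator
        (fun x => ENNReal.ofReal (gsq F x)) (y + t • (x - y))) := by
  have hy' : ‖y‖ ≤ r := by simpa using hy
  have hx' : ‖x‖ ≤ r := by simpa using hx
  have hxy : ‖x - y‖ ≤ 2 * r := (norm_sub_le _ _).trans (by linarith)
  have hxy2 : x - y ∈ closedBall (0:En n) (2 * r) := by simpa using hxy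
  rw [Set.indicator_of_mem hxy2]
  simp only [Pi.one_apply, one_mul]
  have cc : Continuous fun t : ℝ => gsq F (y + t • (x - y)) := (gsq_cont hF).comp (by fun_prop)
  have e : ∫⁻ t in Set.Ioc (0:ℝ) 1, (closedBall (0:En n) r).indicator
        (fun x => ENNReal.ofReal (gsq F x)) (y + t • (x - y)) =
      ENNReal.ofReal (∫ t in (0:ℝ)..1, gsq F (y + t • (x - y))) := by
    rw [intervalIntegral.integral_of_le zero_le_one,
      ofReal_integral_eq_lintegral_ofReal (cc.integrableOn_Ioc)
        (Filter.Eventually.of_forall fun t => gsq_nonneg _ _)]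
    refine setLIntegral_congr_fun measurableSet_Ioc fun t ht => ?_
    have : y + t • (x - y) ∈ closedBall (0:En n) r := by
      have := (convex_closedBall (0:En n) r) hy hx (a := 1 - t) (b := t) (by linarith [ht.2]) ht.1.le (by ring)
      convert this using 1
      rw [smul_sub, sub_smul, one_smul]; abel
    simp only [Set.indicator_of_mem this]
  rw [e, ← ENNReal.ofReal_mul (by positivity)]
  apply ENNReal.ofReal_le_ofReal
  refine (seg_ineq hF x y).trans ?_
  have : ‖x - y‖ ^ 2 ≤ 4 * r ^ 2 := by
    have := pow_le_pow_left₀ (norm_nonneg _) hxy 2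
    nlinarith
  exact mul_le_mul_of_nonneg_right this
    (intervalIntegral.integral_nonneg zero_le_one fun t _ => gsq_nonneg _ _)

lemma poincare_l {F : En n → ℝ} (hF : Sm F) {r : ℝ} (hr : 0 < r) :
    ∫⁻ y in closedBall (0:En n) r, ∫⁻ x in closedBall (0:En n) r, ENNReal.ofReal ((F x - F y) ^ 2)
    ≤ ENNReal.ofReal (4 * r ^ 2) * (volume (closedBall (0:En n) (2 * r)) *
      ∫⁻ x in closedBall (0:En n) r, ENNReal.ofReal (gsq F x)) := by
  have mG : Measurable ((closedBall (0:En n) r).indicator fun x => ENNReal.ofReal (gsq F x)) :=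
    ((gsq_cont hF).measurable.ennreal_ofReal).indicator measurableSet_closedBall
  have sw := poincare_swap mG (ENNReal.ofReal (4 * r ^ 2))
    (measurableSet_closedBall (x := (0:En n)) (ε := 2 * r))
  rw [lintegral_indicator measurableSet_closedBall] at sw
  rw [← sw]
  refine le_trans (setLIntegral_mono' measurableSet_closedBall fun y hy =>
    setLIntegral_mono' measurableSet_closedBall fun x hx => poincare_key hF hr hy hx) ?_
  exact (setLIntegral_le_lintegral _ _).trans (lintegral_mono fun y => setLIntegral_le_lintegral _ _)

lemma poincare (n : ℕ) {r : ℝ} (hr : 0 < r) : ∃ K : ℝ, 0 < K ∧ ∀ F : En n → ℝ, Sm F →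
    ∫ y in closedBall (0:En n) r, ∫ x in closedBall (0:En n) r, (F x - F y) ^ 2 ≤
      K * ∫ x in closedBall (0:En n) r, gsq F x := by
  refine ⟨4 * r ^ 2 * (volume.real (closedBall (0:En n) (2 * r)) + 1), by positivity, fun F hF => ?_⟩
  have h := poincare_l hF hr
  have ci : ∀ y, Continuous fun x => (F x - F y) ^ 2 := fun y => (hF.continuous.sub continuous_const).pow 2
  have e1 : ∀ y, ∫⁻ x in closedBall (0:En n) r, ENNReal.ofReal ((F x - F y) ^ 2) =
      ENNReal.ofReal (∫ x in closedBall (0:En n) r, (F x - F y) ^ 2) := fun y => by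
    rw [ofReal_integral_eq_lintegral_ofReal (integrableOn_cb (ci y) r)
      (Filter.Eventually.of_forall fun x => sq_nonneg _)]
  have cI : Continuous fun y => ∫ x in closedBall (0:En n) r, (F x - F y) ^ 2 := by
    have : (fun y => ∫ x in closedBall (0:En n) r, (F x - F y) ^ 2) = fun y =>
        (∫ x in closedBall (0:En n) r, F x ^ 2) - (2 * F y) * (∫ x in closedBall (0:En n) r, F x)
         + (∫ x in closedBall (0:En n) r, (1:ℝ)) * F y ^ 2 := by
      ext y
      have e : ∀ x, (F x - F y) ^ 2 = (F x ^ 2 - (2 * F y) * F x) + 1 * F y ^ 2 := fun x => by ring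
      simp_rw [e]
      rw [integral_add, integral_sub, integral_const_mul, integral_mul_const]
      · exact integrableOn_cb (hF.continuous.pow 2) r
      · exact integrableOn_cb (continuous_const.mul hF.continuous) r
      · exact integrableOn_cb ((hF.continuous.pow 2).sub (continuous_const.mul hF.continuous)) r
      · exact integrableOn_cb continuous_const r
    rw [this]
    have := hF.continuous
    fun_prop
  simp_rw [e1] at h
  rw [← ofReal_integral_eq_lintegral_ofReal (integrableOn_cb cI r)
      (Filter.Eventually.of_forall fun x => integral_nonneg fun _ => sq_nonneg _),
    ← ofReal_integral_eq_lintegral_ofReal (integrableOn_cb (gsq_cont hF) r)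
      (Filter.Eventually.of_forall fun x => gsq_nonneg _ _)] at h
  have hv : volume (closedBall (0:En n) (2 * r)) = ENNReal.ofReal (volume.real (closedBall (0:En n) (2 * r))) := by
    rw [Measure.real, ENNReal.ofReal_toReal measure_closedBall_lt_top.ne]
  have hI : 0 ≤ ∫ x in closedBall (0:En n) r, gsq F x := integral_nonneg fun x => gsq_nonneg _ _
  rw [hv, ← ENNReal.ofReal_mul (by positivity), ← ENNReal.ofReal_mul (by positivity),
    ENNReal.ofReal_le_ofReal_iff (by positivity)] at h
  refine h.trans ?_
  have : 0 ≤ r ^ 2 * ∫ x in closedBall (0:En n) r, gsq F x := by positivity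
  nlinarith

end P4

section P5
variable {n : ℕ} {l L : ℝ} {a : En n → Matrix (Fin n) (Fin n) ℝ}

lemma grd_affine {f : En n → ℝ} (hf : Sm f) (c d : ℝ) (x : En n) :
    grd (fun y => c * f y + d) x = c • grd f x :=
  grd_comp (h := fun t => c * t + d) (by simpa using ((hasDerivAt_id (f x)).const_mul c).add_const d) (hf.diff x)

lemma Sm.affine {f : En n → ℝ} (hf : Sm f) (c d : ℝ) : Sm (fun y => c * f y + d) :=
  (contDiff_const.mul hf).add contDiff_const

lemma WSub.affine {f : En n → ℝ} (hf : Sm f) (hs : WSub a f) {c : ℝ} (hc : 0 ≤ c) (d : ℝ) :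
    WSub a (fun y => c * f y + d) := by
  intro φ hφ hcs h0
  simp_rw [grd_affine hf, bil_smul_left]
  rw [integral_const_mul]
  exact mul_nonpos_of_nonneg_of_nonpos hc (hs φ hφ hcs h0)

lemma WSol.wsub {f : En n → ℝ} (hs : WSol a f) : WSub a f := fun φ hφ hc _ => (hs φ hφ hc).le

lemma WSol.neg_wsub {f : En n → ℝ} (hs : WSol a f) : WSub a (fun x => - f x) := by
  intro φ hφ hc _
  simp_rw [grd_neg, bil_neg_left]
  rw [integral_neg, hs φ hφ hc]; simp

/-- total gradient of a cutoff -/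
lemma cut_energy {φ : En n → ℝ} (hφ : Sm φ) {r C : ℝ} (hr : ∀ x, r < ‖x‖ → φ x = 0 ∧ grd φ x = 0)
    (hg : ∀ x, grd φ x ⬝ᵥ grd φ x ≤ C) :
    ∫ x, gsq φ x ≤ C * volume.real (closedBall (0:En n) r) := by
  have : ∫ x, gsq φ x = ∫ x in closedBall (0:En n) r, gsq φ x := by
    rw [setIntegral_eq_integral_of_forall_compl_eq_zero]
    intro x hx
    rw [gsq, (hr x (by simpa using hx)).2]; simp
  rw [this]
  have h2 : ∫ x in closedBall (0:En n) r, C = C * volume.real (closedBall (0:En n) r) := by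
    simp [mul_comm]
  rw [← h2]
  exact integral_mono (integrableOn_cb (gsq_cont hφ) r) (integrableOn_cb continuous_const r) fun x => hg x

lemma log_energy_ball (n : ℕ) (hl : 0 < l) (hL : 0 < L) {r : ℝ} (hr : 0 < r) : ∃ C : ℝ, 0 < C ∧
    ∀ (a : En n → Matrix (Fin n) (Fin n) ℝ), Ell l L a → ∀ v : En n → ℝ, Sm v → (∀ x, 0 < v x) →
    WSub a (fun x => - v x) → ∀ c : ℝ,
    ∫ x in closedBall (0:En n) r, gsq (fun y => c - Real.log (v y)) x ≤ C := by
  obtain ⟨C0, hC0, hcut⟩ := exists_cutoff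
  obtain ⟨φ, hφ, hc, hφ0, hφ1, hφs, hφr, hφg⟩ := hcut n r (r+1) hr (by linarith)
  refine ⟨l⁻¹ * (4 * (L * (C0 * volume.real (closedBall (0:En n) (r+1))))) + 1, by positivity, ?_⟩
  intro a ha v hv hpos hs c
  have hw : Sm (fun y => c - Real.log (v y)) := contDiff_const.sub (ContDiff.log hv fun x => (hpos x).ne')
  have h1 := log_energy ha hl hv hpos hs c hφ hc
  set w := fun y => c - Real.log (v y)
  have e1 : ∫ x, bil (a x) (grd φ x) (grd φ x) ≤ L * ∫ x, gsq φ x := by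
    rw [← integral_const_mul]
    refine integral_mono (integ_of (bil_cont ha.cont hφ.grd_cont hφ.grd_cont) hc fun x hx => by
      simp [ts_grd hx, bil]) (integ_of (continuous_const.mul (gsq_cont hφ)) hc fun x hx => by
      simp [gsq, ts_grd hx]) fun x => ha.up x _
  have e2 := cut_energy hφ hφr hφg
  have e3 : l * ∫ x in closedBall (0:En n) r, gsq w x ≤
      ∫ x, φ x ^ 2 * bil (a x) (grd w x) (grd w x) := by
    have i2 : Integrable fun x => φ x ^ 2 * bil (a x) (grd w x) (grd w x) :=
      integ_of ((hφ.continuous.pow 2).mul (bil_cont ha.cont hw.grd_cont hw.grd_cont)) hc fun x hx => by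
        simp [ts_zero hx]
    rw [← integral_const_mul]
    refine le_trans ?_ (setIntegral_le_integral (s := closedBall (0:En n) r) i2
      (Filter.Eventually.of_forall fun x => mul_nonneg (sq_nonneg _) (ha.nonneg hl x _)))
    refine setIntegral_mono_on (integrableOn_cb (continuous_const.mul (gsq_cont hw)) r)
      i2.integrableOn measurableSet_closedBall fun x hx => ?_
    rw [hφs x (by simpa using hx)]
    rw [one_pow, one_mul]; exact ha.low x (grd w x)
  have e4 : l * ∫ x in closedBall (0:En n) r, gsq w x ≤
      4 * (L * (C0 * volume.real (closedBall (0:En n) (r+1)))) := by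
    have : (r + 1 - r) ^ 2 = 1 := by ring
    rw [this, div_one] at e2
    have := mul_le_mul_of_nonneg_left e2 hL.le
    linarith
  have e5 : ∫ x in closedBall (0:En n) r, gsq w x ≤
      l⁻¹ * (4 * (L * (C0 * volume.real (closedBall (0:En n) (r+1))))) := by
    rw [inv_mul_eq_div, le_div_iff₀ hl]; linarith
  linarith

lemma cont_dev {F : En n → ℝ} (hF : Continuous F) (r : ℝ) :
    Continuous fun y => ∫ x in closedBall (0:En n) r, (F x - F y) ^ 2 := by
  have : (fun y => ∫ x in closedBall (0:En n) r, (F x - F y) ^ 2) = fun y =>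
      (∫ x in closedBall (0:En n) r, F x ^ 2) - (2 * F y) * (∫ x in closedBall (0:En n) r, F x)
       + (∫ x in closedBall (0:En n) r, (1:ℝ)) * F y ^ 2 := by
    ext y
    have e : ∀ x, (F x - F y) ^ 2 = (F x ^ 2 - (2 * F y) * F x) + 1 * F y ^ 2 := fun x => by ring
    simp_rw [e]
    rw [integral_add, integral_sub, integral_const_mul, integral_mul_const]
    · exact integrableOn_cb (hF.pow 2) r
    · exact integrableOn_cb (continuous_const.mul hF) r
    · exact integrableOn_cb ((hF.pow 2).sub (continuous_const.mul hF)) r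
    · exact integrableOn_cb continuous_const r
  rw [this]
  fun_prop

lemma growth (hn : 2 ≤ n) (hl : 0 < l) (hL : 0 < L) {δ η : ℝ} (hδ : 0 < δ) (hη : 0 < η) :
    ∃ c : ℝ, 0 < c ∧
    ∀ (a : En n → Matrix (Fin n) (Fin n) ℝ), Ell l L a → ∀ v : En n → ℝ, Sm v → (∀ x, 0 < v x) →
    (∀ x, v x ≤ 1) → WSub a (fun x => - v x) →
    η ≤ volume.real ({x | δ ≤ v x} ∩ closedBall (0:En n) 2) → ∀ x, ‖x‖ < 1 → c ≤ v x := by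
  obtain ⟨c0, hc0, hmoser⟩ := moser hn hl hL
  obtain ⟨K, hK, hpoin⟩ := poincare n (r := 2) (by norm_num)
  obtain ⟨C, hC, hlog⟩ := log_energy_ball n hl hL (r := 2) (by norm_num)
  set V := volume.real (closedBall (0:En n) 2) with hV
  set k := 1 - Real.log δ with hk
  set K1 := (2 * (K * C) + V * (2 * k ^ 2 * V)) / η with hK1
  have hK10 : 0 < K1 := by positivity
  set m := Real.sqrt (K1 / c0) with hm
  have hm0 : 0 < m := Real.sqrt_pos.2 (by positivity)
  have hm2 : m ^ 2 = K1 / c0 := Real.sq_sqrt (by positivity)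
  refine ⟨Real.exp (1 - m), Real.exp_pos _, ?_⟩
  intro a ha v hv hpos hv1 hs hE x hx
  set w := fun y => 1 - Real.log (v y) with hwd
  have hw : Sm w := contDiff_const.sub (ContDiff.log hv fun x => (hpos x).ne')
  have hw1 : ∀ y, 1 ≤ w y := fun y => by
    have := Real.log_nonpos (hpos y).le (hv1 y)
    simp only [hwd]; linarith
  set E := {x | δ ≤ v x} ∩ closedBall (0:En n) 2 with hEd
  have mE : MeasurableSet E := (isClosed_le continuous_const hv.continuous).measurableSet.inter measurableSet_closedBall
  have hwE : ∀ y ∈ E, w y ≤ k := fun y hy => by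
    have := Real.log_le_log hδ hy.1
    simp only [hwd, hk]; linarith
  set I := ∫ x in closedBall (0:En n) 2, w x ^ 2 with hI
  have p1 := (hpoin w hw).trans (mul_le_mul_of_nonneg_left (hlog a ha v hv hpos hs 1) hK.le)
  have cd := cont_dev hw.continuous 2
  have p2 : ∀ y ∈ E, I ≤ 2 * (∫ x in closedBall (0:En n) 2, (w x - w y) ^ 2) + 2 * k ^ 2 * V := by
    intro y hy
    have e : 2 * k ^ 2 * V = ∫ x in closedBall (0:En n) 2, 2 * k ^ 2 := by simp [hV, mul_comm]
    have c1 : Continuous fun x => 2 * (w x - w y) ^ 2 :=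
      continuous_const.mul ((hw.continuous.sub continuous_const).pow 2)
    rw [e, ← integral_const_mul, ← integral_add (integrableOn_cb c1 2) (integrableOn_cb continuous_const 2)]
    refine integral_mono (integrableOn_cb (hw.continuous.pow 2) 2)
      (integrableOn_cb (c1.add continuous_const) 2) fun x => ?_
    have h1 := hwE y hy
    have h2 := hw1 y
    have h3 : w y ^ 2 ≤ k ^ 2 := pow_le_pow_left₀ (by linarith) h1 2
    simp only
    nlinarith [sq_nonneg (w x - 2 * w y)]
  have hVfin : volume E ≠ ⊤ := ((measure_mono Set.inter_subset_right).trans_lt measure_closedBall_lt_top).ne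
  have p3 : volume.real E * I ≤ 2 * (K * C) + V * (2 * k ^ 2 * V) := by
    have e : volume.real E * I = ∫ y in E, I := by simp
    rw [e]
    have cc : Continuous fun y => 2 * (∫ x in closedBall (0:En n) 2, (w x - w y) ^ 2) + 2 * k ^ 2 * V :=
      (continuous_const.mul cd).add continuous_const
    have iE : IntegrableOn (fun y => 2 * (∫ x in closedBall (0:En n) 2, (w x - w y) ^ 2) + 2 * k ^ 2 * V) E :=
      (integrableOn_cb cc 2).mono_set Set.inter_subset_right
    have i1 : IntegrableOn (fun y => 2 * (∫ x in closedBall (0:En n) 2, (w x - w y) ^ 2))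
      (closedBall (0:En n) 2) := integrableOn_cb (continuous_const.mul cd) 2
    refine (setIntegral_mono_on (integrableOn_const hVfin) iE mE p2).trans ?_
    refine (setIntegral_mono_set (integrableOn_cb cc 2)
      (Filter.Eventually.of_forall fun y => ?_) (Filter.Eventually.of_forall Set.inter_subset_right)).trans ?_
    · have : 0 ≤ ∫ x in closedBall (0:En n) 2, (w x - w y) ^ 2 := integral_nonneg fun _ => sq_nonneg _
      simp only [Pi.zero_apply]; positivity
    · rw [integral_add i1 (integrableOn_cb continuous_const 2), integral_const_mul]
      have : ∫ y in closedBall (0:En n) 2, 2 * k ^ 2 * V = V * (2 * k ^ 2 * V) := by simp [hV]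
      rw [this]
      linarith
  have hI0 : 0 ≤ I := integral_nonneg fun _ => sq_nonneg _
  have p4 : I ≤ K1 := by
    rw [hK1, le_div_iff₀ hη]
    nlinarith
  have hsub := log_sub ha hl hv hpos hs 1
  have hfin := hmoser a ha (fun x => m⁻¹ * w x + 0) (hw.affine _ _) (hsub.affine hw (by positivity) 0)
    (fun x => by have := hw1 x; positivity) ?_ x hx
  · have : w x ≤ m := by
      rw [add_zero, inv_mul_le_iff₀ hm0] at hfin; linarith
    simp only [hwd] at this
    rw [← Real.le_log_iff_exp_le (hpos x)]
    linarith
  · have e : ∀ x, (m⁻¹ * w x + 0) ^ 2 = (m ^ 2)⁻¹ * w x ^ 2 := fun x => by rw [add_zero, mul_pow, inv_pow]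
    simp_rw [e]
    rw [integral_const_mul, hm2, inv_mul_le_iff₀ (by positivity)]
    have : K1 / c0 * c0 = K1 := by field_simp
    rw [this]; exact p4

lemma asym (hn : 2 ≤ n) (hl : 0 < l) (hL : 0 < L) (ha : Ell l L a) {ψ : En n → ℝ} (hψ : Sm ψ)
    (hs : WSub a ψ) {S D : ℝ} (hS : ∀ x, ψ x ≤ S) (hS' : ∀ ε > 0, ∃ x, S - ε < ψ x)
    (hD : ∀ x, S - D ≤ ψ x) {δ η : ℝ} (hδ : 0 < δ) (hη : 0 < η) :
    ∃ R0 : ℝ, 0 < R0 ∧ ∀ R, R0 ≤ R →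
      volume.real ({z : En n | ψ (0 + R • z) ≤ S - δ} ∩ closedBall (0:En n) 2) < η := by
  have hD0 : 0 ≤ D := by linarith [hS 0, hD 0]
  set D' := D + 1 with hD'
  have hD'0 : 0 < D' := by linarith
  obtain ⟨c, hc, hgr⟩ := growth hn hl hL (δ := δ / D') (by positivity) hη
  set ε := min 1 (c * D' / 3) with hε
  have hε0 : 0 < ε := by positivity
  obtain ⟨x, hx⟩ := hS' (c * D' / 3) (by positivity)
  refine ⟨‖x‖ + 1, by positivity, fun R hR => ?_⟩
  by_contra hcon
  push Not at hcon
  have hR0 : 0 < R := by linarith [norm_nonneg x]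
  set v : En n → ℝ := fun z => (-D'⁻¹) * ψ (0 + R • z) + D'⁻¹ * (S + ε) with hv
  have sv : Sm v := (hψ.scale R 0).affine _ _
  have ev : ∀ z, v z = D'⁻¹ * (S - ψ (0 + R • z) + ε) := fun z => by simp only [hv]; ring
  have hneg : (fun z => - v z) = fun z => D'⁻¹ * ψ (0 + R • z) + (-(D'⁻¹ * (S + ε))) := by
    ext z; simp only [hv]; ring
  have h := hgr _ (ha.scale R) v sv (fun z => ?_) (fun z => ?_) ?_ ?_ (R⁻¹ • x) ?_
  · rw [ev] at h
    have e : (0 : En n) + R • (R⁻¹ • x) = x := by simp [smul_smul, mul_inv_cancel₀ hR0.ne']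
    rw [e, inv_mul_eq_div, le_div_iff₀ hD'0] at h
    have : ε ≤ c * D' / 3 := min_le_right _ _
    nlinarith [mul_pos hc hD'0]
  · rw [ev]
    have := hS (0 + R • z)
    have : 0 < S - ψ (0 + R • z) + ε := by linarith
    positivity
  · rw [ev, inv_mul_le_iff₀ hD'0]
    have := hD (0 + R • z)
    have : ε ≤ 1 := min_le_left _ _
    linarith
  · rw [hneg]
    exact (hs.scale hψ hR0).affine (hψ.scale R 0) (by positivity) _
  · refine hcon.trans (measureReal_mono ?_ ?_)
    · refine Set.inter_subset_inter_left _ fun z hz => ?_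
      simp only [Set.mem_ofPred_eq] at hz ⊢
      rw [ev, div_eq_inv_mul]
      exact mul_le_mul_of_nonneg_left (by linarith) (by positivity)
    · exact ((measure_mono Set.inter_subset_right).trans_lt measure_closedBall_lt_top).ne
  · rw [norm_smul, norm_inv, Real.norm_eq_abs, abs_of_pos hR0, inv_mul_lt_iff₀ hR0]
    linarith

lemma liouville2 (hn : 2 ≤ n) (hl : 0 < l) (hL : 0 < L) (ha : Ell l L a) {f : En n → ℝ} (hf : Sm f)
    (hs : WSol a f) {B : ℝ} (hB : ∀ x, |f x| ≤ B) : ∀ x y, f x = f y := by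
  set S := ⨆ x, f x with hS
  set T := ⨆ x, (- f x) with hT
  have b1 : BddAbove (Set.range f) := ⟨B, by rintro _ ⟨x, rfl⟩; exact (abs_le.1 (hB x)).2⟩
  have b2 : BddAbove (Set.range fun x => - f x) :=
    ⟨B, by rintro _ ⟨x, rfl⟩; have := (abs_le.1 (hB x)).1; simp only; linarith⟩
  have h1 : ∀ x, f x ≤ S := fun x => le_ciSup b1 x
  have h2 : ∀ x, - f x ≤ T := fun x => le_ciSup b2 x
  have h1' : ∀ ε > 0, ∃ x, S - ε < f x := fun ε hε => exists_lt_of_lt_ciSup (by linarith)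
  have h2' : ∀ ε > 0, ∃ x, T - ε < - f x := fun ε hε => exists_lt_of_lt_ciSup (f := fun x => - f x) (by linarith)
  suffices hST : S + T ≤ 0 by
    intro x y
    have := h1 x; have := h1 y; have := h2 x; have := h2 y
    linarith
  by_contra hcon
  push Not at hcon
  set V := volume.real (closedBall (0:En n) 2) with hV
  have hV0 : 0 < V := ENNReal.toReal_pos (measure_closedBall_pos _ _ (by norm_num)).ne' measure_closedBall_lt_top.ne
  obtain ⟨R1, hR1, k1⟩ := asym hn hl hL ha hf hs.wsub h1 h1' (D := S + T)
    (fun x => by have := h2 x; linarith) (δ := (S + T) / 2) (η := V / 2) (by linarith) (by linarith)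
  obtain ⟨R2, hR2, k2⟩ := asym hn hl hL ha (ψ := fun x => - f x) (ContDiff.neg hf) hs.neg_wsub h2 h2' (D := S + T)
    (fun x => by have := h1 x; linarith) (δ := (S + T) / 2) (η := V / 2) (by linarith) (by linarith)
  have q1 := k1 (max R1 R2) (le_max_left _ _)
  have q2 := k2 (max R1 R2) (le_max_right _ _)
  set R := max R1 R2
  have hsub : closedBall (0:En n) 2 ⊆ ({z : En n | f (0 + R • z) ≤ S - (S + T) / 2} ∩ closedBall (0:En n) 2) ∪
      ({z : En n | - f (0 + R • z) ≤ T - (S + T) / 2} ∩ closedBall (0:En n) 2) := by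
    intro z hz
    by_cases h : f (0 + R • z) ≤ S - (S + T) / 2
    · exact Or.inl ⟨h, hz⟩
    · refine Or.inr ⟨?_, hz⟩
      simp only [Set.mem_ofPred_eq]
      linarith
  have fin : ∀ A : Set (En n), volume (A ∩ closedBall (0:En n) 2) ≠ ⊤ := fun A =>
    ((measure_mono Set.inter_subset_right).trans_lt measure_closedBall_lt_top).ne
  have := measureReal_mono (μ := volume) hsub (measure_union_ne_top (fin _) (fin _))
  have := this.trans (measureReal_union_le _ _)
  linarith

lemma volume_cb {r : ℝ} (hr : 0 < r) : volume.real (closedBall (0:En n) r) =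
    r ^ n * volume.real (closedBall (0:En n) 1) := by
  rw [Measure.real, Measure.addHaar_closedBall' volume (0 : En n) hr.le, ENNReal.toReal_mul, ENNReal.toReal_ofReal (by positivity)]
  simp [Measure.real]

lemma const_of_gsq {f : En n → ℝ} (hf : Sm f) (h : ∀ x, gsq f x = 0) : ∀ x y, f x = f y := by
  apply is_const_of_fderiv_eq_zero (𝕜 := ℝ) hf.diff
  intro x
  have := norm_fderiv_le f x
  rw [show grd f x ⬝ᵥ grd f x = 0 from h x, Real.sqrt_zero] at this
  exact norm_le_zero_iff.1 this

lemma liouville1 (hn : n = 1) (hl : 0 < l) (hL : 0 < L) (ha : Ell l L a) {f : En n → ℝ} (hf : Sm f)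
    (hs : WSol a f) {B : ℝ} (hB : ∀ x, |f x| ≤ B) : ∀ x y, f x = f y := by
  have hB0 : 0 ≤ B := (abs_nonneg _).trans (hB 0)
  obtain ⟨C0, hC0, hcut⟩ := exists_cutoff
  set V := volume.real (closedBall (0:En n) 1) with hV
  refine const_of_gsq hf fun x => ?_
  have key : ∀ r : ℝ, 1 ≤ r → ∀ s, 0 < s → s < r → ∫ y in closedBall (0:En n) s, gsq f y ≤
      l⁻¹ * (L * (B ^ 2 * (C0 * (2 * V)))) * r⁻¹ := by
    intro r hr s hs0 hsr
    have hr0 : 0 < r := by linarith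
    obtain ⟨φ, hφ, hc, hφ0, hφ1, hφs, hφr, hφg⟩ := hcut n r (2*r) (by linarith) (by linarith)
    have c1 := caccio_plain ha hf hφ hc (caccio_sol ha hf hs hφ hc)
    have c2 : ∫ x, f x ^ 2 * (grd φ x ⬝ᵥ grd φ x) ≤ B ^ 2 * ∫ x, gsq φ x := by
      rw [← integral_const_mul]
      refine integral_mono (integ_of ((hf.continuous.pow 2).mul (gsq_cont hφ)) hc fun x hx => by
        simp [gsq, ts_grd hx]) (integ_of (continuous_const.mul (gsq_cont hφ)) hc fun x hx => by
        simp [gsq, ts_grd hx]) fun x => ?_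
      refine mul_le_mul_of_nonneg_right ?_ (gsq_nonneg _ _)
      rw [← sq_abs]; exact pow_le_pow_left₀ (abs_nonneg _) (hB x) 2
    have c3 := cut_energy hφ hφr hφg
    rw [volume_cb (by linarith), ← hV] at c3
    have sg : Sm (fun y => φ y * f y) := hφ.mul hf
    have c4 : ∫ y in closedBall (0:En n) s, gsq f y ≤ ∫ x, gsq (fun y => φ y * f y) x := by
      have i2 : Integrable (gsq (fun y => φ y * f y)) :=
        integ_of (gsq_cont sg) (hc.mul_right (f' := f)) fun x hx => by
          rw [gsq, ts_grd (φ := fun y => φ y * f y) hx]; simp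
      refine le_trans (le_of_eq ?_) (setIntegral_le_integral (s := closedBall (0:En n) s) i2
        (Filter.Eventually.of_forall fun x => gsq_nonneg _ _))
      refine setIntegral_congr_fun measurableSet_closedBall fun y hy => ?_
      have hy' : ‖y‖ < r := lt_of_le_of_lt (by simpa using hy) hsr
      have : (fun y => φ y * f y) =ᶠ[nhds y] f := by
        filter_upwards [continuous_norm.continuousAt.eventually_lt_const hy'] with z hz
        rw [hφs z hz.le, one_mul]
      have e : grd (fun y => φ y * f y) y = grd f y := by
        funext i; change fderiv ℝ _ _ _ = fderiv ℝ _ _ _; rw [this.fderiv_eq]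
      simp only [gsq, e]
    have c5 : l * ∫ y in closedBall (0:En n) s, gsq f y ≤ L * (B ^ 2 * (C0 * (2 * V))) * r⁻¹ := by
      calc _ ≤ l * ∫ x, gsq (fun y => φ y * f y) x := by gcongr
        _ ≤ _ := c1
        _ ≤ L * (B ^ 2 * (C0 / (2 * r - r) ^ 2 * ((2 * r) ^ n * V))) := by
            gcongr
            exact c2.trans (by gcongr)
        _ = _ := by
            rw [hn, pow_one]; field_simp; ring
    rw [mul_assoc, inv_mul_eq_div, le_div_iff₀ hl]; linarith
  have hz : ∀ s, 0 < s → ∫ y in closedBall (0:En n) s, gsq f y ≤ 0 := by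
    intro s hs0
    have hlim : Filter.Tendsto (fun r : ℝ => l⁻¹ * (L * (B ^ 2 * (C0 * (2 * V)))) * r⁻¹) Filter.atTop
      (nhds (l⁻¹ * (L * (B ^ 2 * (C0 * (2 * V)))) * 0)) := tendsto_inv_atTop_zero.const_mul _
    rw [mul_zero] at hlim
    refine ge_of_tendsto hlim ?_
    filter_upwards [Filter.eventually_gt_atTop (max 1 s)] with r hr
    exact key r ((le_max_left _ _).trans hr.le) s hs0 ((le_max_right _ _).trans_lt hr)
  by_contra hne
  have hpos : 0 < gsq f x := lt_of_le_of_ne (gsq_nonneg _ _) (Ne.symm hne)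
  have := hz (‖x‖ + 1) (by positivity)
  have h3 : 0 < ∫ y in closedBall (0:En n) (‖x‖ + 1), gsq f y := by
    rw [setIntegral_pos_iff_support_of_nonneg_ae (Filter.Eventually.of_forall fun y => gsq_nonneg _ _)
      (integrableOn_cb (gsq_cont hf) _)]
    have ho : IsOpen (Function.support (gsq f) ∩ ball (0:En n) (‖x‖ + 1)) :=
      ((gsq_cont hf).isOpen_support).inter isOpen_ball
    refine lt_of_lt_of_le (ho.measure_pos volume ⟨x, hne, by simp⟩)
      (measure_mono (Set.inter_subset_inter_right _ ball_subset_closedBall))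
  linarith

lemma liouville (hn : 1 ≤ n) (hl : 0 < l) (hL : 0 < L) (ha : Ell l L a) {f : En n → ℝ} (hf : Sm f)
    (hs : WSol a f) {B : ℝ} (hB : ∀ x, |f x| ≤ B) : ∀ x y, f x = f y := by
  rcases Nat.lt_or_ge 1 n with h | h
  · exact liouville2 h hl hL ha hf hs hB
  · exact liouville1 (le_antisymm h hn) hl hL ha hf hs hB

end P5

section P6
variable {n : ℕ}

/-- orthogonal conjugate of a diagonal matrix -/
def cj (Q : Matrix (Fin n) (Fin n) ℝ) (d : Fin n → ℝ) : Matrix (Fin n) (Fin n) ℝ := Q * diagonal d * Qᵀ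

section
variable {Q : Matrix (Fin n) (Fin n) ℝ}

lemma cj_mul (h : Qᵀ * Q = 1) (d e : Fin n → ℝ) : cj Q d * cj Q e = cj Q (fun i => d i * e i) := by
  unfold cj
  rw [← diagonal_mul_diagonal]
  calc Q * diagonal d * Qᵀ * (Q * diagonal e * Qᵀ) = Q * diagonal d * (Qᵀ * Q) * diagonal e * Qᵀ := by
        simp only [Matrix.mul_assoc]
    _ = _ := by rw [h]; simp only [Matrix.mul_assoc, Matrix.one_mul]

lemma cj_one (h : Q * Qᵀ = 1) : cj Q (fun _ => 1) = 1 := by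
  unfold cj; rw [diagonal_one, Matrix.mul_one, h]

lemma cj_add (d e : Fin n → ℝ) : cj Q d + cj Q e = cj Q (fun i => d i + e i) := by
  unfold cj; rw [← diagonal_add, Matrix.mul_add, Matrix.add_mul]

lemma cj_det (h : Q * Qᵀ = 1) (d : Fin n → ℝ) : (cj Q d).det = ∏ i, d i := by
  have : Q.det * Q.det = 1 := by
    have := congrArg det h
    rwa [det_mul, det_transpose, det_one] at this
  unfold cj
  rw [det_mul, det_mul, det_transpose, det_diagonal]
  linear_combination (∏ i, d i) * this

lemma cj_inv (h : Q * Qᵀ = 1) (h' : Qᵀ * Q = 1) {d : Fin n → ℝ} (hd : ∀ i, d i ≠ 0) :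
    (cj Q d)⁻¹ = cj Q (fun i => (d i)⁻¹) := by
  apply inv_eq_right_inv
  rw [cj_mul h']
  simp only [mul_inv_cancel₀ (hd _)]
  exact cj_one h

lemma cj_apply (d : Fin n → ℝ) (i j : Fin n) : cj Q d i j = ∑ a, Q i a * d a * Q j a := by
  rw [cj, Matrix.mul_apply]; simp [Matrix.mul_diagonal]

lemma cj_trace (h' : Qᵀ * Q = 1) (d : Fin n → ℝ) : (cj Q d).trace = ∑ i, d i := by
  unfold cj
  rw [Matrix.trace_mul_comm, ← Matrix.mul_assoc, h', Matrix.one_mul, trace_diagonal]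
end

lemma spec {P : Matrix (Fin n) (Fin n) ℝ} (hP : P.IsHermitian) :
    ∃ Q : Matrix (Fin n) (Fin n) ℝ, Q * Qᵀ = 1 ∧ Qᵀ * Q = 1 ∧ P = cj Q hP.eigenvalues := by
  have h := hP.spectral_theorem
  refine ⟨hP.eigenvectorUnitary, ?_, ?_, ?_⟩
  · have := Unitary.mul_star_self_of_mem (hP.eigenvectorUnitary).2
    simpa [star_eq_conjTranspose] using this
  · have := Unitary.star_mul_self_of_mem (hP.eigenvectorUnitary).2
    simpa [star_eq_conjTranspose] using this
  · conv_lhs => rw [h]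
    simp [cj, Unitary.conjStarAlgAut_apply, star_eq_conjTranspose]

/-- symmetric contractions -/
structure SC (P : Matrix (Fin n) (Fin n) ℝ) : Prop where
  symm : Pᵀ = P
  con : ∀ ξ, (P *ᵥ ξ) ⬝ᵥ (P *ᵥ ξ) ≤ ξ ⬝ᵥ ξ

def Gm (P : Matrix (Fin n) (Fin n) ℝ) : Matrix (Fin n) (Fin n) ℝ := (1 + P * P)⁻¹
def om (P : Matrix (Fin n) (Fin n) ℝ) : ℝ := Real.sqrt (1 + P * P).det

lemma isHerm_of {P : Matrix (Fin n) (Fin n) ℝ} (h : Pᵀ = P) : P.IsHermitian := by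
  rw [Matrix.IsHermitian, conjTranspose_eq_transpose_of_trivial, h]

lemma spec' {P : Matrix (Fin n) (Fin n) ℝ} (hP : Pᵀ = P) :
    ∃ (Q : Matrix (Fin n) (Fin n) ℝ) (μ : Fin n → ℝ), Q * Qᵀ = 1 ∧ Qᵀ * Q = 1 ∧ P = cj Q μ := by
  obtain ⟨Q, h1, h2, h3⟩ := spec (isHerm_of hP)
  exact ⟨Q, _, h1, h2, h3⟩

lemma one_add_sq_cj {Q : Matrix (Fin n) (Fin n) ℝ} {μ : Fin n → ℝ} (h1 : Q * Qᵀ = 1) (h2 : Qᵀ * Q = 1) :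
    1 + cj Q μ * cj Q μ = cj Q (fun i => 1 + μ i * μ i) := by
  rw [cj_mul h2, ← cj_one h1, cj_add]

lemma Gm_cj {Q : Matrix (Fin n) (Fin n) ℝ} {μ : Fin n → ℝ} (h1 : Q * Qᵀ = 1) (h2 : Qᵀ * Q = 1) :
    Gm (cj Q μ) = cj Q (fun i => (1 + μ i * μ i)⁻¹) := by
  rw [Gm, one_add_sq_cj h1 h2, cj_inv h1 h2]
  intro i; nlinarith [mul_self_nonneg (μ i)]

lemma det_pos_of {P : Matrix (Fin n) (Fin n) ℝ} (hP : Pᵀ = P) : 1 ≤ (1 + P * P).det := by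
  obtain ⟨Q, μ, h1, h2, rfl⟩ := spec' hP
  rw [one_add_sq_cj h1 h2, cj_det h1]
  have : (1:ℝ) = ∏ i : Fin n, (1:ℝ) := by simp
  conv_lhs => rw [this]
  exact Finset.prod_le_prod (fun i _ => zero_le_one) fun i _ => by nlinarith [mul_self_nonneg (μ i)]

lemma SC.eig {Q : Matrix (Fin n) (Fin n) ℝ} {μ : Fin n → ℝ} (h2 : Qᵀ * Q = 1)
    (h : SC (cj Q μ)) (i : Fin n) : μ i * μ i ≤ 1 := by
  have e : cj Q μ *ᵥ (fun j => Q j i) = μ i • fun j => Q j i := by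
    have : (fun j => Q j i) = Q *ᵥ (Pi.single i 1) := by ext j; simp
    rw [this, mulVec_mulVec, cj, Matrix.mul_assoc, h2, Matrix.mul_one, ← mulVec_mulVec]
    rw [diagonal_mulVec_single, mul_one, ← mulVec_smul]
    congr 1; ext j; simp [Pi.single_apply]
  have q : (fun j => Q j i) ⬝ᵥ (fun j => Q j i) = 1 := by
    have := congrFun (congrFun h2 i) i
    simpa [Matrix.mul_apply, dotProduct] using this
  have := h.con (fun j => Q j i)
  rw [e] at this
  simpa [q] using this

lemma SC.det_le {P : Matrix (Fin n) (Fin n) ℝ} (h : SC P) : (1 + P * P).det ≤ 2 ^ n := by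
  obtain ⟨Q, μ, h1, h2, rfl⟩ := spec' h.symm
  rw [one_add_sq_cj h1 h2, cj_det h1]
  have : (2:ℝ) ^ n = ∏ i : Fin n, 2 := by simp
  rw [this]
  exact Finset.prod_le_prod (fun i _ => by nlinarith [mul_self_nonneg (μ i)]) fun i _ => by
    have := h.eig h2 i; linarith

lemma Gm_mul {P : Matrix (Fin n) (Fin n) ℝ} (hP : Pᵀ = P) : Gm P * (1 + P * P) = 1 :=
  nonsing_inv_mul _ (isUnit_iff_ne_zero.2 (by linarith [det_pos_of hP]))
lemma mul_Gm {P : Matrix (Fin n) (Fin n) ℝ} (hP : Pᵀ = P) : (1 + P * P) * Gm P = 1 :=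
  mul_nonsing_inv _ (isUnit_iff_ne_zero.2 (by linarith [det_pos_of hP]))
lemma Gm_symm {P : Matrix (Fin n) (Fin n) ℝ} (hP : Pᵀ = P) : (Gm P)ᵀ = Gm P := by
  rw [Gm, transpose_nonsing_inv]; simp [hP]
lemma Gm_comm {P : Matrix (Fin n) (Fin n) ℝ} (hP : Pᵀ = P) : Gm P * P = P * Gm P := by
  have e : P * (1 + P * P) = (1 + P * P) * P := by noncomm_ring
  calc Gm P * P = Gm P * (P * ((1 + P * P) * Gm P)) := by rw [mul_Gm hP, Matrix.mul_one]
    _ = Gm P * (P * (1 + P * P)) * Gm P := by simp only [Matrix.mul_assoc]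
    _ = (Gm P * (1 + P * P)) * P * Gm P := by rw [e]; simp only [Matrix.mul_assoc]
    _ = _ := by rw [Gm_mul hP, Matrix.one_mul]

lemma om_ge {P : Matrix (Fin n) (Fin n) ℝ} (hP : Pᵀ = P) : 1 ≤ om P := by
  rw [om, Real.one_le_sqrt]; exact det_pos_of hP
lemma om_sq {P : Matrix (Fin n) (Fin n) ℝ} (hP : Pᵀ = P) : om P ^ 2 = (1 + P * P).det :=
  Real.sq_sqrt (by linarith [det_pos_of hP])
lemma SC.om_le {P : Matrix (Fin n) (Fin n) ℝ} (hP : SC P) : om P ≤ 2 ^ n := by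
  rw [om, Real.sqrt_le_left (by positivity)]
  refine hP.det_le.trans ?_
  have : (1:ℝ) ≤ 2 ^ n := one_le_pow₀ (by norm_num)
  nlinarith

lemma mul_dot_symm {P : Matrix (Fin n) (Fin n) ℝ} (hP : Pᵀ = P) (ξ η : Fin n → ℝ) :
    (P *ᵥ ξ) ⬝ᵥ η = ξ ⬝ᵥ (P *ᵥ η) := by
  rw [dotProduct_mulVec, ← mulVec_transpose, hP]

lemma Gm_bil {P : Matrix (Fin n) (Fin n) ℝ} (hP : Pᵀ = P) (ξ : Fin n → ℝ) :
    bil (Gm P) ξ ξ = (Gm P *ᵥ ξ) ⬝ᵥ (Gm P *ᵥ ξ) + (P *ᵥ Gm P *ᵥ ξ) ⬝ᵥ (P *ᵥ Gm P *ᵥ ξ) := by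
  have h : ξ = (1 + P * P) *ᵥ (Gm P *ᵥ ξ) := by rw [mulVec_mulVec, mul_Gm hP, one_mulVec]
  have e : bil (Gm P) ξ ξ = ((1 + P * P) *ᵥ (Gm P *ᵥ ξ)) ⬝ᵥ (Gm P *ᵥ ξ) := by rw [← h]; rfl
  rw [e, add_mulVec, one_mulVec, add_dotProduct, ← mulVec_mulVec, mul_dot_symm hP]

lemma Gm_bil_le {P : Matrix (Fin n) (Fin n) ℝ} (hP : Pᵀ = P) (ξ : Fin n → ℝ) :
    bil (Gm P) ξ ξ ≤ ξ ⬝ᵥ ξ := by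
  have h : ξ = (1 + P * P) *ᵥ (Gm P *ᵥ ξ) := by rw [mulVec_mulVec, mul_Gm hP, one_mulVec]
  rw [Gm_bil hP]
  set η := Gm P *ᵥ ξ
  rw [h, add_mulVec, one_mulVec, ← mulVec_mulVec, add_dotProduct, dotProduct_add, dotProduct_add,
    mul_dot_symm hP (P *ᵥ η) η, ← mul_dot_symm hP η (P *ᵥ η)]
  have := dot_self_nonneg' (P *ᵥ η)
  have := dot_self_nonneg' (P *ᵥ P *ᵥ η)
  linarith

lemma SC.Gm_bil_ge {P : Matrix (Fin n) (Fin n) ℝ} (hP : SC P) (ξ : Fin n → ℝ) :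
    3⁻¹ * (ξ ⬝ᵥ ξ) ≤ bil (Gm P) ξ ξ := by
  have h : ξ = (1 + P * P) *ᵥ (Gm P *ᵥ ξ) := by rw [mulVec_mulVec, mul_Gm hP.symm, one_mulVec]
  rw [Gm_bil hP.symm]
  set η := Gm P *ᵥ ξ
  rw [h, add_mulVec, one_mulVec, ← mulVec_mulVec, add_dotProduct, dotProduct_add, dotProduct_add,
    mul_dot_symm hP.symm (P *ᵥ η) η, ← mul_dot_symm hP.symm η (P *ᵥ η)]
  have := hP.con (P *ᵥ η)
  have := dot_self_nonneg' η
  linarith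

/-- the coefficients -/
def am (P : Matrix (Fin n) (Fin n) ℝ) : Matrix (Fin n) (Fin n) ℝ := om P • Gm P

lemma bil_am (P : Matrix (Fin n) (Fin n) ℝ) (ξ η : Fin n → ℝ) : bil (am P) ξ η = om P * bil (Gm P) ξ η := by
  simp [bil, am, smul_mulVec]

lemma Ell_am {M : En n → Matrix (Fin n) (Fin n) ℝ} (hM : ∀ x, SC (M x)) (hc : Continuous M) :
    Ell 3⁻¹ (2 ^ n) (fun x => am (M x)) where
  cont := by
    have h1 : Continuous fun x => (1 + M x * M x) := continuous_const.add (hc.mul hc)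
    have h2 : Continuous fun x => om (M x) := (h1.matrix_det).sqrt
    refine h2.smul ?_
    have e : (fun x => Gm (M x)) = fun x => ((1 + M x * M x).det)⁻¹ • (1 + M x * M x).adjugate := by
      ext1 x; rw [Gm, inv_def, Ring.inverse_eq_inv']
    change Continuous fun x => Gm (M x)
    rw [e]
    refine (h1.matrix_det.inv₀ fun x => ?_).smul h1.matrix_adjugate
    have := det_pos_of (hM x).symm
    exact (by linarith : (0:ℝ) < _).ne'
  symm x := by rw [Matrix.IsSymm, am, transpose_smul, Gm_symm (hM x).symm]
  low x ξ := by
    rw [bil_am]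
    have h1 := om_ge (hM x).symm
    have h2 := (hM x).Gm_bil_ge ξ
    have h3 := dot_self_nonneg' ξ
    nlinarith
  up x ξ := by
    rw [bil_am]
    have h1 := (hM x).om_le
    have h1' := om_ge (hM x).symm
    have h2 := Gm_bil_le (hM x).symm ξ
    have h3 := dot_self_nonneg' ξ
    have h4 := (hM x).Gm_bil_ge ξ
    nlinarith

end P6

section P7
variable {n : ℕ}

lemma weight_ineq {a b c : ℝ} (ha : a * a ≤ 1) (hb : b * b ≤ 1) (hc : c * c ≤ 1) :
    1 / 16 ≤ ((1 + a * a)⁻¹ + b * ((1 + c * c)⁻¹ * (c * (1 + a * a)⁻¹) + (1 + c * c)⁻¹ * (a * (1 + a * a)⁻¹))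
      + ((1 + b * b)⁻¹ + c * ((1 + a * a)⁻¹ * (a * (1 + b * b)⁻¹) + (1 + a * a)⁻¹ * (b * (1 + b * b)⁻¹)))
      + ((1 + c * c)⁻¹ + a * ((1 + b * b)⁻¹ * (b * (1 + c * c)⁻¹) + (1 + b * b)⁻¹ * (c * (1 + c * c)⁻¹)))) / 3 := by
  have pa : 0 < 1 + a * a := by nlinarith
  have pb : 0 < 1 + b * b := by nlinarith
  have pc : 0 < 1 + c * c := by nlinarith
  have e : ((1 + a * a)⁻¹ + b * ((1 + c * c)⁻¹ * (c * (1 + a * a)⁻¹) + (1 + c * c)⁻¹ * (a * (1 + a * a)⁻¹))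
      + ((1 + b * b)⁻¹ + c * ((1 + a * a)⁻¹ * (a * (1 + b * b)⁻¹) + (1 + a * a)⁻¹ * (b * (1 + b * b)⁻¹)))
      + ((1 + c * c)⁻¹ + a * ((1 + b * b)⁻¹ * (b * (1 + c * c)⁻¹) + (1 + b * b)⁻¹ * (c * (1 + c * c)⁻¹)))) / 3
      = ((1 + a * b) * (1 + a * a + b * b + a * b) + (1 + b * c) * (1 + b * b + c * c + b * c)
        + (1 + c * a) * (1 + c * c + a * a + c * a)) / (3 * ((1 + a * a) * (1 + b * b) * (1 + c * c))) := by
    field_simp; ring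
  rw [e, div_le_div_iff₀ (by norm_num) (by positivity)]
  have q : ∀ s t : ℝ, s * s ≤ 1 → t * t ≤ 1 → 1 + s * t ≤ (1 + s * t) * (1 + s * s + t * t + s * t) := by
    intro s t hs ht
    have h1 : 0 ≤ 1 + s * t := by nlinarith [sq_nonneg (s + t)]
    have h2 : 1 ≤ 1 + s * s + t * t + s * t := by nlinarith [sq_nonneg (s + t)]
    nlinarith
  have q1 := q a b ha hb
  have q2 := q b c hb hc
  have q3 := q c a hc ha
  have d : (1 + a * a) * (1 + b * b) * (1 + c * c) ≤ 8 := by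
    calc (1 + a * a) * (1 + b * b) * (1 + c * c) ≤ (2 * 2) * 2 := by gcongr <;> linarith
      _ = 8 := by norm_num
  nlinarith [sq_nonneg (a + b + c)]

/-- rotated tensor -/
def rot (Q : Matrix (Fin n) (Fin n) ℝ) (N : Fin n → Matrix (Fin n) (Fin n) ℝ) (a : Fin n) :
    Matrix (Fin n) (Fin n) ℝ := Qᵀ * (∑ i, Q i a • N i) * Q

lemma rot_apply (Q : Matrix (Fin n) (Fin n) ℝ) (N : Fin n → Matrix (Fin n) (Fin n) ℝ) (a b c : Fin n) :
    rot Q N a b c = ∑ k, ∑ j, ∑ i, Q j b * (Q i a * N i j k) * Q k c := by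
  simp only [rot, Matrix.mul_apply, transpose_apply, Matrix.sum_apply, Matrix.smul_apply, smul_eq_mul,
    Finset.mul_sum, Finset.sum_mul]
  exact Finset.sum_congr rfl fun k _ => Finset.sum_comm

lemma rot_swap (Q : Matrix (Fin n) (Fin n) ℝ) {N : Fin n → Matrix (Fin n) (Fin n) ℝ}
    (hN : ∀ i j k, N i j k = N j i k) (a b c : Fin n) : rot Q N a b c = rot Q N b a c := by
  rw [rot_apply, rot_apply]
  refine Finset.sum_congr rfl fun k _ => ?_
  rw [Finset.sum_comm]
  refine Finset.sum_congr rfl fun i _ => Finset.sum_congr rfl fun j _ => ?_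
  rw [hN j i]; ring

lemma rot_symm (Q : Matrix (Fin n) (Fin n) ℝ) {N : Fin n → Matrix (Fin n) (Fin n) ℝ}
    (hN : ∀ i, (N i)ᵀ = N i) (a : Fin n) : (rot Q N a)ᵀ = rot Q N a := by
  simp [rot, transpose_sum, hN, Matrix.mul_assoc]

def FF (A X Y : Matrix (Fin n) (Fin n) ℝ) (N : Fin n → Matrix (Fin n) (Fin n) ℝ) : ℝ :=
  ∑ i, ∑ j, A i j * (X * N j * Y * N i).trace

lemma FF_cj {Q : Matrix (Fin n) (Fin n) ℝ}
    {N : Fin n → Matrix (Fin n) (Fin n) ℝ} (hN : ∀ i, (N i)ᵀ = N i) (m x y : Fin n → ℝ) :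
    FF (cj Q m) (cj Q x) (cj Q y) N = ∑ a, ∑ b, ∑ c, m a * x b * y c * rot Q N a b c ^ 2 := by
  have h1 : FF (cj Q m) (cj Q x) (cj Q y) N = ∑ a, m a *
      (cj Q x * (∑ j, Q j a • N j) * cj Q y * (∑ i, Q i a • N i)).trace := by
    have e : ∀ a, m a * (cj Q x * (∑ j, Q j a • N j) * cj Q y * (∑ i, Q i a • N i)).trace =
       ∑ i, ∑ j, (Q i a * m a * Q j a) * (cj Q x * N j * cj Q y * N i).trace := by
      intro a
      simp only [Matrix.sum_mul, Matrix.mul_smul, Matrix.smul_mul, trace_sum, trace_smul, smul_eq_mul,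
        Finset.mul_sum]
      refine Finset.sum_congr rfl fun i _ => Finset.sum_congr rfl fun j _ => by ring
    simp_rw [e]
    rw [Finset.sum_comm]
    refine Finset.sum_congr rfl fun i _ => ?_
    rw [Finset.sum_comm]
    refine Finset.sum_congr rfl fun j _ => ?_
    rw [cj_apply, Finset.sum_mul]
  rw [h1]
  refine Finset.sum_congr rfl fun a _ => ?_
  have h2 : (cj Q x * (∑ j, Q j a • N j) * cj Q y * (∑ i, Q i a • N i)).trace =
      (diagonal x * rot Q N a * diagonal y * rot Q N a).trace := by
    unfold cj rot
    set S := ∑ j, Q j a • N j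
    calc (Q * diagonal x * Qᵀ * S * (Q * diagonal y * Qᵀ) * S).trace
        = (Q * (diagonal x * Qᵀ * S * Q * diagonal y * Qᵀ * S)).trace := by simp only [Matrix.mul_assoc]
      _ = ((diagonal x * Qᵀ * S * Q * diagonal y * Qᵀ * S) * Q).trace := Matrix.trace_mul_comm _ _
      _ = _ := by simp only [Matrix.mul_assoc]
  rw [h2]
  have h3 : ∀ b c, (diagonal x * rot Q N a * diagonal y) b c = x b * rot Q N a b c * y c := fun b c => by
    rw [Matrix.mul_diagonal, Matrix.diagonal_mul]
  simp only [Matrix.trace, Matrix.diag]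
  rw [Finset.mul_sum]
  refine Finset.sum_congr rfl fun b _ => ?_
  rw [Matrix.mul_apply, Finset.mul_sum]
  refine Finset.sum_congr rfl fun c _ => ?_
  rw [h3]
  have : rot Q N a c b = rot Q N a b c := congrFun (congrFun (rot_symm Q hN a) b) c
  rw [this]; ring

lemma sum3_cyc (f : Fin n → Fin n → Fin n → ℝ) :
    ∑ a, ∑ b, ∑ c, f a b c = ∑ a, ∑ b, ∑ c, f b c a := by
  rw [Finset.sum_comm]
  have : ∀ b, ∑ a, ∑ c, f a b c = ∑ c, ∑ a, f a b c := fun b => Finset.sum_comm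
  simp_rw [this]
  rw [Finset.sum_comm]
  have : ∀ b, ∑ a, ∑ c, f c a b = ∑ c, ∑ a, f c a b := fun b => Finset.sum_comm
  simp_rw [this]

/-- the key pointwise inequality -/
lemma key_ineq {P : Matrix (Fin n) (Fin n) ℝ} (hP : SC P) {N : Fin n → Matrix (Fin n) (Fin n) ℝ}
    (hN : ∀ i, (N i)ᵀ = N i) (hN' : ∀ i j k, N i j k = N j i k) :
    16⁻¹ * FF 1 1 1 N ≤ FF (Gm P) 1 1 N + FF P (Gm P) (P * Gm P) N + FF P (Gm P * P) (Gm P) N := by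
  obtain ⟨Q, μ, h1, h2, rfl⟩ := spec' hP.symm
  have hμ := hP.eig h2
  rw [Gm_cj h1 h2, cj_mul h2, cj_mul h2, ← cj_one h1, FF_cj hN, FF_cj hN, FF_cj hN, FF_cj hN]
  set t := rot Q N with ht
  have ts : ∀ a b c, t a b c = t b a c := rot_swap Q hN'
  have ts' : ∀ a b c, t a b c = t a c b := fun a b c => (congrFun (congrFun (rot_symm Q hN a) b) c).symm
  have tc : ∀ a b c, t b c a = t a b c := fun a b c => by rw [ts', ts]
  set w := fun i => (1 + μ i * μ i)⁻¹ with hw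
  set W := fun a b c => (w a + μ a * w b * (μ c * w c) + μ a * (w b * μ b) * w c) with hW
  have e1 : ∑ a, ∑ b, ∑ c, w a * 1 * 1 * t a b c ^ 2 + ∑ a, ∑ b, ∑ c, μ a * w b * (μ c * w c) * t a b c ^ 2
      + ∑ a, ∑ b, ∑ c, μ a * (w b * μ b) * w c * t a b c ^ 2 = ∑ a, ∑ b, ∑ c, W a b c * t a b c ^ 2 := by
    simp only [← Finset.sum_add_distrib]
    refine Finset.sum_congr rfl fun a _ => Finset.sum_congr rfl fun b _ => Finset.sum_congr rfl fun c _ => ?_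
    simp only [hW]; ring
  rw [e1]
  have e2 := sum3_cyc fun a b c => W a b c * t a b c ^ 2
  have e3 := sum3_cyc fun a b c => W b c a * t b c a ^ 2
  simp only [tc] at e2 e3
  have e4 : ∑ a, ∑ b, ∑ c, W a b c * t a b c ^ 2 =
      ∑ a, ∑ b, ∑ c, ((W a b c + W b c a + W c a b) / 3) * t a b c ^ 2 := by
    have : ∑ a, ∑ b, ∑ c, ((W a b c + W b c a + W c a b) / 3) * t a b c ^ 2 =
       (∑ a, ∑ b, ∑ c, W a b c * t a b c ^ 2 + ∑ a, ∑ b, ∑ c, W b c a * t a b c ^ 2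
        + ∑ a, ∑ b, ∑ c, W c a b * t a b c ^ 2) / 3 := by
      simp only [← Finset.sum_add_distrib, Finset.sum_div]
      refine Finset.sum_congr rfl fun a _ => Finset.sum_congr rfl fun b _ => Finset.sum_congr rfl fun c _ => ?_
      ring
    rw [this, ← e3, ← e2]; ring
  rw [e4]
  simp only [Finset.mul_sum]
  refine Finset.sum_le_sum fun a _ => Finset.sum_le_sum fun b _ => Finset.sum_le_sum fun c _ => ?_
  have := weight_ineq (hμ a) (hμ b) (hμ c)
  have h0 := sq_nonneg (t a b c)
  have e : (W a b c + W b c a + W c a b) / 3 = ((1 + μ a * μ a)⁻¹ + μ b * ((1 + μ c * μ c)⁻¹ * (μ c * (1 + μ a * μ a)⁻¹) + (1 + μ c * μ c)⁻¹ * (μ a * (1 + μ a * μ a)⁻¹))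
      + ((1 + μ b * μ b)⁻¹ + μ c * ((1 + μ a * μ a)⁻¹ * (μ a * (1 + μ b * μ b)⁻¹) + (1 + μ a * μ a)⁻¹ * (μ b * (1 + μ b * μ b)⁻¹)))
      + ((1 + μ c * μ c)⁻¹ + μ a * ((1 + μ b * μ b)⁻¹ * (μ b * (1 + μ c * μ c)⁻¹) + (1 + μ b * μ b)⁻¹ * (μ c * (1 + μ c * μ c)⁻¹)))) / 3 := by
    simp only [hW, hw]; ring
  rw [e]
  nlinarith

end P7

section P8
variable {n : ℕ}

abbrev MF (n : ℕ) := En n → Matrix (Fin n) (Fin n) ℝ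

/-- smooth matrix functions -/
def SmM (F : MF n) : Prop := ∀ i j, Sm (fun x => F x i j)

/-- entrywise partial derivative -/
def pdm (k : Fin n) (F : MF n) (x : En n) : Matrix (Fin n) (Fin n) ℝ :=
  Matrix.of fun i j => pdrv n k (fun y => F y i j) x

variable {F G : MF n}

lemma Sm.sum {ι : Type*} {s : Finset ι} {f : ι → En n → ℝ} (h : ∀ i ∈ s, Sm (f i)) :
    Sm (fun x => ∑ i ∈ s, f i x) := ContDiff.sum h

lemma Sm.prod {ι : Type*} {s : Finset ι} {f : ι → En n → ℝ} (h : ∀ i ∈ s, Sm (f i)) :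
    Sm (fun x => ∏ i ∈ s, f i x) := contDiff_prod h

lemma SmM.mul (hF : SmM F) (hG : SmM G) : SmM (fun x => F x * G x) := by
  intro i j
  simp only [Matrix.mul_apply]
  exact Sm.sum fun k _ => (hF i k).mul (hG k j)

lemma SmM.add (hF : SmM F) (hG : SmM G) : SmM (fun x => F x + G x) := by
  intro i j
  simp only [Matrix.add_apply]
  exact (hF i j).add (hG i j)

lemma SmM.const (A : Matrix (Fin n) (Fin n) ℝ) : SmM (fun _ => A) := fun _ _ => contDiff_const

lemma SmM.pd (hF : SmM F) (k : Fin n) : SmM (fun x => pdm k F x) := fun i j => (hF i j).pd k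

lemma SmM.cont (hF : SmM F) : Continuous F :=
  continuous_pi fun i => continuous_pi fun j => (hF i j).continuous

lemma SmM.det (hF : SmM F) : Sm (fun x => (F x).det) := by
  simp only [Matrix.det_apply']
  exact Sm.sum fun σ _ => contDiff_const.mul (Sm.prod fun i _ => hF _ _)

lemma SmM.adjugate (hF : SmM F) : SmM (fun x => (F x).adjugate) := by
  intro i j
  simp only [adjugate_apply]
  refine SmM.det (F := fun x => (F x).updateRow j (Pi.single i 1)) fun a b => ?_
  by_cases h : a = j
  · subst h; simp only [updateRow_self]; exact contDiff_const
  · simp only [updateRow_ne h]; exact hF a b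

lemma SmM.inv (hF : SmM F) (h : ∀ x, (F x).det ≠ 0) : SmM (fun x => (F x)⁻¹) := by
  intro i j
  simp only [inv_def, Ring.inverse_eq_inv', Matrix.smul_apply, smul_eq_mul]
  exact (ContDiff.inv hF.det h).mul (hF.adjugate i j)

lemma SmM.trace (hF : SmM F) : Sm (fun x => (F x).trace) := Sm.sum fun i _ => hF i i

lemma pdm_mul (hF : SmM F) (hG : SmM G) (k : Fin n) (x : En n) :
    pdm k (fun y => F y * G y) x = pdm k F x * G x + F x * pdm k G x := by
  ext i j
  simp only [pdm, Matrix.mul_apply, Matrix.of_apply, Matrix.add_apply]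
  rw [pdrv_sum k _ fun l _ => ((hF i l).mul (hG l j)).differentiable (by simp) x]
  rw [← Finset.sum_add_distrib]
  exact Finset.sum_congr rfl fun l _ => pdrv_mul k ((hF i l).diff x) ((hG l j).diff x)

lemma pdm_add (hF : SmM F) (hG : SmM G) (k : Fin n) (x : En n) :
    pdm k (fun y => F y + G y) x = pdm k F x + pdm k G x := by
  ext i j
  simp only [pdm, Matrix.of_apply, Matrix.add_apply]
  exact pdrv_add k ((hF i j).diff x) ((hG i j).diff x)

lemma pdm_const (A : Matrix (Fin n) (Fin n) ℝ) (k : Fin n) (x : En n) : pdm k (fun _ => A) x = 0 := by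
  ext i j; simp only [pdm, Matrix.of_apply, pdrv_const, Matrix.zero_apply]

lemma pdrv_trace (hF : SmM F) (k : Fin n) (x : En n) :
    pdrv n k (fun y => (F y).trace) x = (pdm k F x).trace :=
  pdrv_sum k _ fun i _ => (hF i i).diff x

lemma pdm_inv (hF : SmM F) (h : ∀ x, (F x).det ≠ 0) (k : Fin n) (x : En n) :
    pdm k (fun y => (F y)⁻¹) x = - ((F x)⁻¹ * pdm k F x * (F x)⁻¹) := by
  have h1 := pdm_mul (hF.inv h) hF k x
  have e : (fun y => (F y)⁻¹ * F y) = fun _ => 1 := by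
    ext1 y; exact nonsing_inv_mul _ (isUnit_iff_ne_zero.2 (h y))
  rw [e, pdm_const] at h1
  have h2 : F x * (F x)⁻¹ = 1 := mul_nonsing_inv _ (isUnit_iff_ne_zero.2 (h x))
  have h3 : (pdm k (fun y => (F y)⁻¹) x * F x + (F x)⁻¹ * pdm k F x) * (F x)⁻¹ = 0 := by
    rw [← h1, Matrix.zero_mul]
  rw [Matrix.add_mul, Matrix.mul_assoc, h2, Matrix.mul_one] at h3
  exact eq_neg_of_add_eq_zero_left h3

lemma pdrv_prod {ι : Type*} [DecidableEq ι] (s : Finset ι) {f : ι → En n → ℝ} (h : ∀ i ∈ s, Sm (f i)) (k : Fin n)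
    (x : En n) : pdrv n k (fun y => ∏ i ∈ s, f i y) x =
      ∑ i ∈ s, (∏ j ∈ s.erase i, f j x) * pdrv n k (f i) x := by
  have := (HasFDerivAt.finsetProd (u := s) (x := x) (g := f) (g' := fun i => fderiv ℝ (f i) x)
    fun i hi => ((h i hi).diff x).hasFDerivAt).fderiv
  simp only [pdrv]
  rw [this]
  simp

lemma pdrv_det (hF : SmM F) (k : Fin n) (x : En n) :
    pdrv n k (fun y => (F y).det) x = ((F x).adjugate * pdm k F x).trace := by
  have h1 : ((F x).adjugate * pdm k F x).trace = ∑ i, ((F x).updateCol i (fun j => pdm k F x j i)).det := by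
    simp only [Matrix.trace, Matrix.diag]
    refine Finset.sum_congr rfl fun i _ => ?_
    rw [← cramer_apply, cramer_eq_adjugate_mulVec]
    rfl
  rw [h1]
  simp only [Matrix.det_apply']
  rw [pdrv_sum k _ fun σ _ => (contDiff_const.mul (Sm.prod fun i _ => hF _ _)).differentiable (by simp) x]
  rw [Finset.sum_comm]
  refine Finset.sum_congr rfl fun σ _ => ?_
  rw [pdrv_const_mul k _ ((Sm.prod fun i _ => hF _ _).diff x), pdrv_prod _ (fun i _ => hF _ _), Finset.mul_sum]
  refine Finset.sum_congr rfl fun i _ => ?_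
  rw [← Finset.mul_prod_erase Finset.univ _ (Finset.mem_univ i)]
  have : ∏ j ∈ Finset.univ.erase i, (F x).updateCol i (fun j => pdm k F x j i) (σ j) j =
      ∏ j ∈ Finset.univ.erase i, F x (σ j) j :=
    Finset.prod_congr rfl fun j hj => by rw [updateCol_ne (Finset.ne_of_mem_erase hj)]
  rw [this, updateCol_self]
  simp only [pdm, Matrix.of_apply]; ring

end P8

section P9
variable {n : ℕ}

/-- gradient graphs rotated to be contractions -/
structure LG (M : MF n) : Prop where
  sm : SmM M
  sc : ∀ x, SC (M x)
  tot : ∀ x i j k, pdm k M x i j = pdm j M x i k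

/-- special Lagrangian ones -/
structure SL (M : MF n) : Prop extends LG M where
  tr : ∀ x k, (Gm (M x) * pdm k M x).trace = 0

variable {M : MF n}

lemma LG.pd_symm (h : LG M) (x : En n) (k : Fin n) : (pdm k M x)ᵀ = pdm k M x := by
  ext i j
  simp only [transpose_apply, pdm, of_apply]
  congr 1; ext y
  exact congrFun (congrFun (h.sc y).symm i) j

lemma LG.pd_swap (h : LG M) (x : En n) (i j k : Fin n) : pdm i M x j k = pdm j M x i k := by
  have h1 : ∀ a b c, pdm a M x b c = pdm a M x c b := fun a b c => congrFun (congrFun (h.pd_symm x a) c) b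
  rw [h1 i j k, h.tot x k j i, h1]

lemma LG.smQ (h : LG M) : SmM (fun x => 1 + M x * M x) := (SmM.const 1).add (h.sm.mul h.sm)

lemma LG.smG (h : LG M) : SmM (fun x => Gm (M x)) :=
  h.smQ.inv fun x => by linarith [det_pos_of (h.sc x).symm]

lemma LG.smom (h : LG M) : Sm (fun x => om (M x)) :=
  ContDiff.sqrt h.smQ.det fun x => by linarith [det_pos_of (h.sc x).symm]

lemma LG.pdQ (h : LG M) (k : Fin n) (x : En n) :
    pdm k (fun x => 1 + M x * M x) x = pdm k M x * M x + M x * pdm k M x := by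
  rw [pdm_add (SmM.const 1) (h.sm.mul h.sm), pdm_const, zero_add, pdm_mul h.sm h.sm]

lemma LG.pdG (h : LG M) (k : Fin n) (x : En n) :
    pdm k (fun x => Gm (M x)) x =
      - (Gm (M x) * pdm k M x * (M x * Gm (M x)) + (Gm (M x) * M x) * pdm k M x * Gm (M x)) := by
  have := pdm_inv h.smQ (fun x => by linarith [det_pos_of (h.sc x).symm]) k x
  rw [h.pdQ] at this
  change pdm k (fun x => (1 + M x * M x)⁻¹) x = _
  rw [this]
  simp only [Gm]
  noncomm_ring

lemma LG.pdom (h : LG M) (k : Fin n) (x : En n) :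
    pdrv n k (fun x => om (M x)) x = om (M x) * (Gm (M x) * M x * pdm k M x).trace := by
  have hs := (h.sc x).symm
  have hd := det_pos_of hs
  have h1 : pdrv n k (fun x => om (M x)) x = 1 / (2 * om (M x)) * pdrv n k (fun x => (1 + M x * M x).det) x :=
    pdrv_comp k (Real.hasDerivAt_sqrt (by linarith)) (h.smQ.det.diff x)
  have h2 : (1 + M x * M x).adjugate = om (M x) ^ 2 • Gm (M x) := by
    rw [om_sq hs, Gm, inv_def, Ring.inverse_eq_inv', smul_smul, mul_inv_cancel₀ (by linarith), one_smul]
  have ho := om_ge hs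
  have h3 : (Gm (M x) * (pdm k M x * M x)).trace = (Gm (M x) * M x * pdm k M x).trace := by
    rw [← Matrix.mul_assoc, Matrix.trace_mul_comm, ← Matrix.mul_assoc, Gm_comm hs]
  rw [h1, pdrv_det h.smQ, h.pdQ, h2, Matrix.smul_mul, trace_smul, Matrix.mul_add, trace_add, h3,
    ← Matrix.mul_assoc, smul_eq_mul]
  field_simp; ring

lemma LG.sma (h : LG M) : SmM (fun x => am (M x)) := fun i j => h.smom.mul (h.smG i j)

lemma tr3 (A B C : Matrix (Fin n) (Fin n) ℝ) (i j : Fin n) :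
    (A * B * C) i j = ∑ a, A i a * (∑ b, B a b * C b j) := by
  rw [Matrix.mul_assoc, Matrix.mul_apply]; rfl

lemma SL.div (h : SL M) (x : En n) (i : Fin n) :
    ∑ j, pdrv n j (fun y => am (M y) i j) x = 0 := by
  have hs := (h.sc x).symm
  have h1 : ∀ j, pdrv n j (fun y => am (M y) i j) x =
      om (M x) * ((Gm (M x) * M x * pdm j M x).trace * Gm (M x) i j
        - ((Gm (M x) * pdm j M x * (M x * Gm (M x))) i j + ((Gm (M x) * M x) * pdm j M x * Gm (M x)) i j)) := by
    intro j
    have e : pdrv n j (fun y => am (M y) i j) x =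
      pdrv n j (fun x => om (M x)) x * Gm (M x) i j + om (M x) * pdm j (fun x => Gm (M x)) x i j :=
      pdrv_mul j (h.smom.diff x) ((h.smG i j).diff x)
    rw [e, h.pdom, h.pdG]
    simp only [Matrix.neg_apply, Matrix.add_apply]; ring
  simp_rw [h1]
  rw [← Finset.mul_sum, Finset.sum_sub_distrib, Finset.sum_add_distrib]
  have sw : ∀ (X : Matrix (Fin n) (Fin n) ℝ), Xᵀ = X → ∀ a, ∑ j, ∑ b, pdm j M x a b * X b j = (X * pdm a M x).trace := by
    intro X hX a
    simp only [Matrix.trace, Matrix.diag, Matrix.mul_apply]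
    refine Finset.sum_congr rfl fun j _ => Finset.sum_congr rfl fun b _ => ?_
    have : X b j = X j b := congrFun (congrFun hX j) b
    rw [this, mul_comm, h.pd_swap x j a b]
    congr 1
    exact congrFun (congrFun (h.pd_symm x a) b) j
  have e2 : ∑ j, ((Gm (M x) * M x) * pdm j M x * Gm (M x)) i j = 0 := by
    simp_rw [tr3]
    rw [Finset.sum_comm]
    simp_rw [← Finset.mul_sum]
    simp_rw [sw _ (Gm_symm hs), h.tr]; simp
  have e3 : ∑ j, (Gm (M x) * pdm j M x * (M x * Gm (M x))) i j =
      ∑ j, (Gm (M x) * M x * pdm j M x).trace * Gm (M x) i j := by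
    simp_rw [tr3]
    rw [Finset.sum_comm]
    simp_rw [← Finset.mul_sum]
    have hX : (M x * Gm (M x))ᵀ = M x * Gm (M x) := by
      rw [transpose_mul, Gm_symm hs, hs, Gm_comm hs]
    simp_rw [sw _ hX]
    refine Finset.sum_congr rfl fun j _ => ?_
    rw [Gm_comm hs]; ring
  rw [e2, e3]; simp

lemma div_ibp {X : Fin n → En n → ℝ} (hX : ∀ j, Sm (X j)) {φ : En n → ℝ} (hφ : Sm φ)
    (hc : HasCompactSupport φ) :
    ∫ x, ∑ j, X j x * pdrv n j φ x = - ∫ x, φ x * ∑ j, pdrv n j (X j) x := by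
  have i1 : ∀ j, Integrable fun x => X j x * pdrv n j φ x := fun j =>
    integ_of ((hX j).continuous.mul (hφ.pd j).continuous) hc fun x hx => by
      have := congrFun (ts_grd hx) j
      simp only [grd, Pi.zero_apply] at this
      simp [this]
  have i2 : ∀ j, Integrable fun x => φ x * pdrv n j (X j) x := fun j =>
    integ_of (hφ.continuous.mul ((hX j).pd j).continuous) hc fun x hx => by simp [ts_zero hx]
  rw [integral_finsetSum _ fun j _ => i1 j]
  simp_rw [Finset.mul_sum]
  rw [integral_finsetSum _ fun j _ => i2 j]
  rw [← Finset.sum_neg_distrib]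
  refine Finset.sum_congr rfl fun j _ => ?_
  rw [ibp (hX j) hφ hc]
  simp_rw [mul_comm]

/-- non-divergence operator -/
def ndv (M : MF n) (f : En n → ℝ) (x : En n) : ℝ :=
  ∑ i, ∑ j, Gm (M x) i j * pdrv n j (fun y => pdrv n i f y) x

lemma SL.weak (h : SL M) {f φ : En n → ℝ} (hf : Sm f) (hφ : Sm φ) (hc : HasCompactSupport φ) :
    ∫ x, bil (am (M x)) (grd f x) (grd φ x) = - ∫ x, φ x * (om (M x) * ndv M f x) := by
  have sX : ∀ j, Sm (fun x => ∑ i, am (M x) i j * pdrv n i f x) := fun j =>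
    Sm.sum fun i _ => (h.sma i j).mul (hf.pd i)
  have h1 := div_ibp sX hφ hc
  have e1 : ∀ x, bil (am (M x)) (grd f x) (grd φ x) =
      ∑ j, (∑ i, am (M x) i j * pdrv n i f x) * pdrv n j φ x := by
    intro x
    rw [bil_eq_sum, Finset.sum_comm]
    simp only [Finset.sum_mul, grd]
  simp_rw [e1]
  rw [h1]
  congr 1
  congr 1; ext x
  congr 1
  have e2 : ∀ j, pdrv n j (fun x => ∑ i, am (M x) i j * pdrv n i f x) x =
      ∑ i, (pdrv n j (fun y => am (M y) i j) x * pdrv n i f x + am (M x) i j * pdrv n j (fun y => pdrv n i f y) x) := by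
    intro j
    rw [pdrv_sum j _ fun i _ => ((h.sma i j).mul (hf.pd i)).differentiable (by simp) x]
    exact Finset.sum_congr rfl fun i _ => pdrv_mul j ((h.sma i j).diff x) ((hf.pd i).diff x)
  simp_rw [e2]
  rw [Finset.sum_comm]
  simp_rw [Finset.sum_add_distrib, ← Finset.sum_mul, h.div x, zero_mul]
  simp only [ndv, am, Matrix.smul_apply, smul_eq_mul, Finset.mul_sum, zero_add, mul_assoc, Finset.sum_const_zero]

/-- `ψ = ½|M|²` -/
def psi (M : MF n) (x : En n) : ℝ := 2⁻¹ * (M x * M x).trace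

lemma LG.smpsi (h : LG M) : Sm (psi M) := contDiff_const.mul (h.sm.mul h.sm).trace

lemma LG.pdpsi (h : LG M) (k : Fin n) (x : En n) : pdrv n k (psi M) x = (M x * pdm k M x).trace := by
  have e : pdrv n k (psi M) x = 2⁻¹ * pdrv n k (fun x => (M x * M x).trace) x :=
    pdrv_const_mul k _ ((h.sm.mul h.sm).trace.diff x)
  rw [e, pdrv_trace (h.sm.mul h.sm), pdm_mul h.sm h.sm, trace_add, Matrix.trace_mul_comm]; ring

lemma LG.four (h : LG M) (x : En n) (i j k l : Fin n) :
    pdm l (fun y => pdm k M y) x j i = pdm i (fun y => pdm j M y) x k l := by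
  have s : ∀ a b c d, pdm a (fun y => pdm b M y) x c d = pdm b (fun y => pdm a M y) x c d := fun a b c d =>
    pdrv_comm (h.sm c d)
  have t : ∀ a b c d, pdm a (fun y => pdm b M y) x c d = pdm a (fun y => pdm d M y) x c b := fun a b c d => by
    simp only [pdm, of_apply]; congr 1; ext y; exact h.tot y c d b
  have u : ∀ a b c d, pdm a (fun y => pdm b M y) x c d = pdm a (fun y => pdm b M y) x d c := fun a b c d => by
    simp only [pdm, of_apply]; congr 1; ext y; exact congrFun (congrFun (h.pd_symm y b) d) c
  rw [t, s, u, t]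

lemma SL.ndv_psi (h : SL M) (x : En n) :
    ndv M (psi M) x = FF (Gm (M x)) 1 1 (fun i => pdm i M x)
      + FF (M x) (Gm (M x)) (M x * Gm (M x)) (fun i => pdm i M x)
      + FF (M x) (Gm (M x) * M x) (Gm (M x)) (fun i => pdm i M x) := by
  have hs := (h.sc x).symm
  have e1 : ∀ k l, pdrv n l (fun y => pdrv n k (psi M) y) x =
      (pdm l M x * pdm k M x).trace + (M x * pdm l (fun y => pdm k M y) x).trace := by
    intro k l
    simp_rw [h.pdpsi]
    rw [pdrv_trace (h.sm.mul (h.sm.pd k)), pdm_mul h.sm (h.sm.pd k), trace_add]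
  have e2 : ∀ i j, (Gm (M x) * pdm i (fun y => pdm j M y) x).trace =
      (Gm (M x) * pdm i M x * (M x * Gm (M x)) * pdm j M x).trace
       + (Gm (M x) * M x * pdm i M x * Gm (M x) * pdm j M x).trace := by
    intro i j
    have := pdrv_trace (h.smG.mul (h.sm.pd j)) i x
    simp_rw [h.tr] at this
    rw [pdrv_const, pdm_mul h.smG (h.sm.pd j), h.pdG, trace_add, Matrix.neg_mul, trace_neg, Matrix.add_mul,
      trace_add] at this
    linarith
  have e3 : ∑ k, ∑ l, Gm (M x) k l * (M x * pdm l (fun y => pdm k M y) x).trace =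
      ∑ i, ∑ j, M x i j * (Gm (M x) * pdm i (fun y => pdm j M y) x).trace := by
    simp only [Matrix.trace, Matrix.diag, Matrix.mul_apply]
    have a1 : ∀ k l, Gm (M x) k l * ∑ i, ∑ j, M x i j * pdm l (fun y => pdm k M y) x j i
      = ∑ i, ∑ j, Gm (M x) k l * (M x i j * pdm l (fun y => pdm k M y) x j i) := fun k l => by
      simp only [Finset.mul_sum]
    have a2 : ∀ i j, M x i j * ∑ k, ∑ l, Gm (M x) k l * pdm i (fun y => pdm j M y) x l k
      = ∑ k, ∑ l, Gm (M x) k l * (M x i j * pdm l (fun y => pdm k M y) x j i) := fun i j => by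
      simp only [Finset.mul_sum]
      refine Finset.sum_congr rfl fun k _ => Finset.sum_congr rfl fun l _ => ?_
      rw [h.four x i j k l]
      have : pdm i (fun y => pdm j M y) x l k = pdm i (fun y => pdm j M y) x k l := by
        simp only [pdm, of_apply]; congr 1; ext y; exact congrFun (congrFun (h.pd_symm y j) k) l
      rw [this]; ring
    simp_rw [a1, a2]
    have sc2 : ∀ f : Fin n → Fin n → Fin n → Fin n → ℝ, ∑ k, ∑ l, ∑ i, ∑ j, f k l i j = ∑ i, ∑ j, ∑ k, ∑ l, f k l i j := by
      intro f
      have b1 : ∀ k, ∑ l, ∑ i, ∑ j, f k l i j = ∑ i, ∑ j, ∑ l, f k l i j := fun k => by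
        rw [Finset.sum_comm]
        exact Finset.sum_congr rfl fun i _ => Finset.sum_comm
      simp_rw [b1]
      rw [Finset.sum_comm]
      exact Finset.sum_congr rfl fun i _ => Finset.sum_comm
    exact sc2 _
  unfold ndv
  simp_rw [e1, mul_add, Finset.sum_add_distrib]
  rw [e3]
  simp_rw [e2, mul_add, Finset.sum_add_distrib]
  have sy : ∀ X Y : Matrix (Fin n) (Fin n) ℝ, ∑ i, ∑ j, M x i j * (X * pdm i M x * Y * pdm j M x).trace =
      FF (M x) X Y (fun i => pdm i M x) := by
    intro X Y
    rw [FF, Finset.sum_comm]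
    refine Finset.sum_congr rfl fun i _ => Finset.sum_congr rfl fun j _ => ?_
    have : M x j i = M x i j := congrFun (congrFun hs i) j
    rw [this]
  rw [sy, sy, ← add_assoc]
  congr 2
  simp [FF]

/-- energy density `|DM|²` -/
def en (M : MF n) (x : En n) : ℝ := ∑ i, ∑ j, gsq (fun y => M y i j) x

lemma LG.en_eq (h : LG M) (x : En n) : FF 1 1 1 (fun i => pdm i M x) = en M x := by
  have : ∀ i, (pdm i M x * pdm i M x).trace = ∑ a, ∑ b, pdrv n i (fun y => M y a b) x * pdrv n i (fun y => M y a b) x := by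
    intro i
    simp only [Matrix.trace, Matrix.diag, Matrix.mul_apply]
    refine Finset.sum_congr rfl fun a _ => Finset.sum_congr rfl fun b _ => ?_
    have : pdm i M x b a = pdm i M x a b := congrFun (congrFun (h.pd_symm x i) a) b
    rw [this]; rfl
  simp only [FF, Matrix.mul_one, Matrix.one_apply, ite_mul, one_mul, zero_mul,
    Finset.sum_ite_eq, Finset.mem_univ, if_true, this, en, gsq, grd, dotProduct]
  rw [Finset.sum_comm]
  exact Finset.sum_congr rfl fun a _ => Finset.sum_comm

lemma SL.ndv_ge (h : SL M) (x : En n) : 16⁻¹ * en M x ≤ ndv M (psi M) x := by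
  rw [h.ndv_psi, ← h.en_eq]
  exact key_ineq (h.sc x) (h.pd_symm x) (fun i j k => h.pd_swap x i j k)

lemma en_nonneg (M : MF n) (x : En n) : 0 ≤ en M x :=
  Finset.sum_nonneg fun _ _ => Finset.sum_nonneg fun _ _ => gsq_nonneg _ _

lemma LG.en_cont (h : LG M) : Continuous (en M) :=
  continuous_finsetSum _ fun i _ => continuous_finsetSum _ fun j _ => gsq_cont (h.sm i j)

end P9

section P10
variable {n : ℕ} {M : MF n}

lemma SmM.scale (h : SmM M) (R : ℝ) : SmM (fun z => M (0 + R • z)) := fun i j => (h i j).scale R 0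

lemma pdm_scale (h : SmM M) (R : ℝ) (k : Fin n) (z : En n) :
    pdm k (fun z => M (0 + R • z)) z = R • pdm k M (0 + R • z) := by
  ext i j
  simp only [pdm, of_apply, Matrix.smul_apply, smul_eq_mul]
  exact pdrv_scale k (h i j).diff R 0 z

lemma LG.scale (h : LG M) (R : ℝ) : LG (fun z => M (0 + R • z)) :=
  ⟨h.sm.scale R, fun x => h.sc _, fun x i j k => by
    rw [pdm_scale h.sm, pdm_scale h.sm, Matrix.smul_apply, Matrix.smul_apply, h.tot]⟩

lemma SL.scale (h : SL M) (R : ℝ) : SL (fun z => M (0 + R • z)) :=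
  ⟨h.toLG.scale R, fun x k => by
    rw [pdm_scale h.sm, Matrix.mul_smul, trace_smul, h.tr, smul_zero]⟩

lemma SL.psi_sub (h : SL M) : WSub (fun x => am (M x)) (psi M) := by
  intro φ hφ hc h0
  rw [h.weak h.smpsi hφ hc]
  have : 0 ≤ ∫ x, φ x * (om (M x) * ndv M (psi M) x) := integral_nonneg fun x => by
    have h1 := h.ndv_ge x
    have h2 := en_nonneg M x
    have h3 := om_ge (h.sc x).symm
    have h4 : 0 ≤ ndv M (psi M) x := by linarith
    exact mul_nonneg (h0 x) (mul_nonneg (by linarith) h4)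
  linarith

lemma psi_nonneg (h : LG M) (x : En n) : 0 ≤ psi M x := by
  have : (M x * M x).trace = ∑ i, ∑ k, M x i k * M x i k := by
    simp only [Matrix.trace, Matrix.diag, Matrix.mul_apply]
    refine Finset.sum_congr rfl fun i _ => Finset.sum_congr rfl fun k _ => ?_
    have := congrFun (congrFun (h.sc x).symm i) k
    rw [transpose_apply] at this; rw [this]
  rw [psi, this]
  exact mul_nonneg (by norm_num) (Finset.sum_nonneg fun _ _ => Finset.sum_nonneg fun _ _ => mul_self_nonneg _)

lemma SC.row {P : Matrix (Fin n) (Fin n) ℝ} (h : SC P) (i : Fin n) : ∑ k, P i k * P i k ≤ 1 := by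
  have := h.con (Pi.single i 1)
  simp only [mulVec_single_one, single_dotProduct, Pi.single_eq_same, one_mul] at this
  refine le_trans (le_of_eq ?_) this
  simp only [dotProduct]
  refine Finset.sum_congr rfl fun k _ => ?_
  have := congrFun (congrFun h.symm i) k
  rw [transpose_apply] at this
  simp [this]

lemma SC.entry {P : Matrix (Fin n) (Fin n) ℝ} (h : SC P) (i j : Fin n) : |P i j| ≤ 1 := by
  have h1 : P i j * P i j ≤ 1 :=
    (Finset.single_le_sum (f := fun k => P i k * P i k) (fun k _ => mul_self_nonneg _) (Finset.mem_univ j)).trans (h.row i)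
  exact abs_le_one_iff_mul_self_le_one.2 h1

lemma psi_le (h : LG M) (x : En n) : psi M x ≤ n := by
  have e : (M x * M x).trace = ∑ i, ∑ k, M x i k * M x i k := by
    simp only [Matrix.trace, Matrix.diag, Matrix.mul_apply]
    refine Finset.sum_congr rfl fun i _ => Finset.sum_congr rfl fun k _ => ?_
    have := congrFun (congrFun (h.sc x).symm i) k
    rw [transpose_apply] at this; rw [this]
  have h2 : ∑ i, ∑ k, M x i k * M x i k ≤ ∑ i : Fin n, (1:ℝ) := Finset.sum_le_sum fun i _ => (h.sc x).row i
  simp at h2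
  rw [psi, e]
  have : (0:ℝ) ≤ n := by positivity
  linarith

lemma energy_one (n : ℕ) : ∃ C : ℝ, 0 < C ∧ ∀ M : MF n, SL M → ∀ S e k : ℝ, 0 < e → 0 < k →
    (∀ x, psi M x ≤ S) → ∫ x in closedBall (0:En n) 1, en M x ≤
      C * (k ^ 2 + (k ^ 2)⁻¹ * ∫ x in closedBall (0:En n) 2, (S - psi M x + e) ^ 2) := by
  obtain ⟨C0, hC0, hcut⟩ := exists_cutoff
  obtain ⟨φ, hφ, hc, hφ0, hφ1, hφs, hφr, hφg⟩ := hcut n 1 2 (by norm_num) (by norm_num)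
  obtain ⟨C, hC, hlog⟩ := log_energy_ball n (l := 3⁻¹) (L := 2 ^ n) (by norm_num) (by positivity) (r := 2) (by norm_num)
  have hg : ∀ x, grd φ x ⬝ᵥ grd φ x ≤ C0 := fun x => (hφg x).trans (by norm_num)
  refine ⟨16 * 2 ^ n * (C + C0), by positivity, ?_⟩
  intro M hM S e k he hk hS
  have ha := Ell_am hM.sc hM.sm.cont
  set v : En n → ℝ := fun x => S - psi M x + e with hv
  have ev : v = fun x => (-1) * psi M x + (S + e) := by ext x; simp only [hv]; ring
  have sv : Sm v := by rw [ev]; exact hM.smpsi.affine _ _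
  have vpos : ∀ x, 0 < v x := fun x => by have := hS x; simp only [hv]; linarith
  have hneg : WSub (fun x => am (M x)) (fun x => - v x) := by
    have : (fun x => - v x) = fun x => 1 * psi M x + (-(S + e)) := by ext x; simp only [hv]; ring
    rw [this]; exact hM.psi_sub.affine hM.smpsi (by norm_num) _
  have hl := hlog _ ha v sv vpos hneg 0
  set w : En n → ℝ := fun y => 0 - Real.log (v y) with hw
  have sw : Sm w := contDiff_const.sub (ContDiff.log sv fun x => (vpos x).ne')
  have gw : ∀ x, grd (psi M) x = v x • grd w x := by
    intro x
    have h1 : grd w x = (-(v x)⁻¹) • grd v x :=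
      grd_comp (h := fun t => 0 - Real.log t) (by simpa using (Real.hasDerivAt_log (vpos x).ne').const_sub 0) (sv.diff x)
    have h2 : grd v x = (-1 : ℝ) • grd (psi M) x := by rw [ev]; exact grd_affine hM.smpsi _ _ x
    rw [h1, h2, smul_smul, smul_smul]
    have := (vpos x).ne'
    have : v x * -(v x)⁻¹ * -1 = 1 := by field_simp
    rw [this, one_smul]
  -- step 1
  have hw1 := hM.weak hM.smpsi hφ hc
  have cen : Continuous (en M) := hM.en_cont
  have i1 : Integrable fun x => φ x * en M x := integ_of (hφ.continuous.mul cen) hc fun x hx => by simp [ts_zero hx]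
  have cnd : Continuous (ndv M (psi M)) := by
    unfold ndv
    exact continuous_finsetSum _ fun i _ => continuous_finsetSum _ fun j _ =>
      (hM.smG i j).continuous.mul ((hM.smpsi.pd i).pd j).continuous
  have i2 : Integrable fun x => φ x * (om (M x) * ndv M (psi M) x) :=
    integ_of (hφ.continuous.mul (hM.smom.continuous.mul cnd)) hc fun x hx => by simp [ts_zero hx]
  have s1 : ∫ x in closedBall (0:En n) 1, en M x ≤ ∫ x, φ x * en M x := by
    have : ∫ x in closedBall (0:En n) 1, en M x = ∫ x in closedBall (0:En n) 1, φ x * en M x :=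
      setIntegral_congr_fun measurableSet_closedBall fun x hx => by
        simp only [hφs x (by simpa using hx), one_mul]
    rw [this]
    exact setIntegral_le_integral i1 (Filter.Eventually.of_forall fun x => mul_nonneg (hφ0 x) (en_nonneg M x))
  have s2 : ∫ x, φ x * en M x ≤ 16 * ∫ x, φ x * (om (M x) * ndv M (psi M) x) := by
    rw [← integral_const_mul]
    refine integral_mono i1 (i2.const_mul _) fun x => ?_
    have h1 := hM.ndv_ge x
    have h2 := en_nonneg M x
    have h3 := om_ge (hM.sc x).symm
    have h4 : en M x ≤ 16 * (om (M x) * ndv M (psi M) x) := by nlinarith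
    have := mul_le_mul_of_nonneg_left h4 (hφ0 x)
    simp only; linarith
  have s3 : - ∫ x, bil (am (M x)) (grd (psi M) x) (grd φ x) ≤
      ∫ x in closedBall (0:En n) 2, (k ^ 2 * 2 ^ n * gsq w x + (k ^ 2)⁻¹ * 2 ^ n * C0 * v x ^ 2) := by
    rw [← integral_neg]
    have : ∫ x, - bil (am (M x)) (grd (psi M) x) (grd φ x) =
        ∫ x in closedBall (0:En n) 2, - bil (am (M x)) (grd (psi M) x) (grd φ x) := by
      symm
      refine setIntegral_eq_integral_of_forall_compl_eq_zero fun x hx => ?_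
      have : 2 < ‖x‖ := by simpa using hx
      rw [(hφr x this).2]; simp [bil]
    rw [this]
    have cg := gsq_cont sw
    have cv := sv.continuous
    refine setIntegral_mono_on (integrableOn_cb (bil_cont ha.cont hM.smpsi.grd_cont hφ.grd_cont).neg 2)
      (integrableOn_cb (by fun_prop) 2) measurableSet_closedBall fun x hx => ?_
    have y := ha.young (by norm_num) x (grd w x) (grd φ x) k (v x / (2 * k))
    have e1 : 2 * k * (v x / (2 * k)) = v x := by field_simp
    rw [e1] at y
    rw [gw, bil_smul_left]
    refine y.trans (add_le_add ?_ ?_)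
    · rw [mul_assoc]; exact mul_le_mul_of_nonneg_left (ha.up x _) (by positivity)
    · have h1 : bil (am (M x)) (grd φ x) (grd φ x) ≤ 2 ^ n * C0 :=
        (ha.up x _).trans (mul_le_mul_of_nonneg_left (hg x) (by positivity))
      have e2 : (v x / (2 * k)) ^ 2 = 4⁻¹ * ((k ^ 2)⁻¹ * v x ^ 2) := by field_simp; norm_num
      rw [e2]
      have h2 : 0 ≤ (k ^ 2)⁻¹ * v x ^ 2 := by positivity
      have h3 : 0 ≤ bil (am (M x)) (grd φ x) (grd φ x) := ha.nonneg (by norm_num) x _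
      have := mul_le_mul_of_nonneg_left h1 h2
      have := mul_nonneg h2 h3
      calc _ ≤ (k ^ 2)⁻¹ * v x ^ 2 * bil (am (M x)) (grd φ x) (grd φ x) := by linarith
        _ ≤ _ := by linarith
  have cg := gsq_cont sw
  have cv := sv.continuous
  have j1 : IntegrableOn (fun x => k ^ 2 * 2 ^ n * gsq w x) (closedBall (0:En n) 2) := integrableOn_cb (by fun_prop) 2
  have j2 : IntegrableOn (fun x => (k ^ 2)⁻¹ * 2 ^ n * C0 * v x ^ 2) (closedBall (0:En n) 2) := integrableOn_cb (by fun_prop) 2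
  rw [integral_add j1 j2, integral_const_mul, integral_const_mul] at s3
  set J := ∫ x in closedBall (0:En n) 2, v x ^ 2 with hJ
  have hJ0 : 0 ≤ J := integral_nonneg fun x => sq_nonneg _
  have hl' := mul_le_mul_of_nonneg_left hl (show 0 ≤ k ^ 2 * 2 ^ n by positivity)
  have : 0 ≤ (2:ℝ) ^ n * C0 * k ^ 2 := by positivity
  have : 0 ≤ (2:ℝ) ^ n * C * ((k ^ 2)⁻¹ * J) := by positivity
  have e5 : ∫ x in closedBall (0:En n) 1, en M x ≤ 16 * (k ^ 2 * 2 ^ n * C + (k ^ 2)⁻¹ * 2 ^ n * C0 * J) := by linarith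
  refine e5.trans ?_
  linarith

lemma energy_lim (hn : 2 ≤ n) (h : SL M) {ε : ℝ} (hε : 0 < ε) : ∃ R0 : ℝ, 0 < R0 ∧ ∀ R, R0 ≤ R →
    ∫ x in closedBall (0:En n) 1, en (fun z => M (0 + R • z)) x ≤ ε := by
  obtain ⟨C, hC, hE⟩ := energy_one n
  set S := ⨆ x, psi M x with hS
  have b1 : BddAbove (Set.range (psi M)) := ⟨n, by rintro _ ⟨x, rfl⟩; exact psi_le h.toLG x⟩
  have h1 : ∀ x, psi M x ≤ S := fun x => le_ciSup b1 x
  have h1' : ∀ ε > 0, ∃ x, S - ε < psi M x := fun ε hε => exists_lt_of_lt_ciSup (by linarith)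
  have hS0 : 0 ≤ S := (psi_nonneg h.toLG 0).trans (h1 0)
  set V := volume.real (closedBall (0:En n) 2) with hV
  have hV0 : 0 ≤ V := measureReal_nonneg
  obtain ⟨k, hk, hk2⟩ : ∃ k : ℝ, 0 < k ∧ k ^ 2 = ε / (2 * C) :=
    ⟨√(ε / (2 * C)), Real.sqrt_pos.2 (by positivity), Real.sq_sqrt (by positivity)⟩
  obtain ⟨e2, he2, he2'⟩ : ∃ e2 : ℝ, 0 < e2 ∧ C * ((k ^ 2)⁻¹ * e2) ≤ ε / 2 :=
    ⟨(k ^ 2) * (ε / 2) / C, by positivity, le_of_eq (by field_simp)⟩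
  set δ := min 1 (e2 / (2 * (4 * V + 1))) with hδ
  have hδ0 : 0 < δ := by positivity
  have hδ1 : δ ≤ 1 := min_le_left _ _
  have hδ2 : δ * (2 * (4 * V + 1)) ≤ e2 := by
    rw [← le_div_iff₀ (by positivity)]; exact min_le_right _ _
  obtain ⟨R0, hR0, hA⟩ := asym hn (by norm_num) (by positivity) (Ell_am h.sc h.sm.cont) h.smpsi h.psi_sub
    h1 h1' (D := S) (fun x => by have := psi_nonneg h.toLG x; linarith) hδ0 (η := e2 / (2 * (S + 1) ^ 2)) (by positivity)
  refine ⟨R0, hR0, fun R hR => ?_⟩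
  have hA := hA R hR
  refine (hE _ (h.scale R) S δ k hδ0 hk (fun x => h1 _)).trans ?_
  set E := {z : En n | psi M (0 + R • z) ≤ S - δ} ∩ closedBall (0:En n) 2 with hEd
  have cps : Continuous fun z : En n => psi M (0 + R • z) := (h.smpsi.scale R 0).continuous
  have mE : MeasurableSet E := (isClosed_le cps continuous_const).measurableSet.inter measurableSet_closedBall
  have hVE : volume E ≠ ⊤ := ((measure_mono Set.inter_subset_right).trans_lt measure_closedBall_lt_top).ne
  have key : ∫ x in closedBall (0:En n) 2, (S - psi (fun z => M (0 + R • z)) x + δ) ^ 2 ≤ e2 := by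
    have cE : IntegrableOn (E.indicator fun _ => (S + 1) ^ 2) (closedBall (0:En n) 2) :=
      ((integrable_indicator_iff mE).2 (integrableOn_const hVE)).integrableOn
    have c2 : IntegrableOn (fun _ : En n => (2 * δ) ^ 2) (closedBall (0:En n) 2) := integrableOn_cb continuous_const 2
    have : ∫ x in closedBall (0:En n) 2, (S - psi (fun z => M (0 + R • z)) x + δ) ^ 2 ≤
        ∫ x in closedBall (0:En n) 2, ((2 * δ) ^ 2 + E.indicator (fun _ => (S + 1) ^ 2) x) := by
      refine setIntegral_mono_on (integrableOn_cb (((continuous_const.sub cps).add continuous_const).pow 2) 2)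
        (c2.add cE) measurableSet_closedBall fun x hx => ?_
      have a1 := h1 (0 + R • x)
      have a2 := psi_nonneg h.toLG (0 + R • x)
      change (S - psi M (0 + R • x) + δ) ^ 2 ≤ _
      by_cases hxE : x ∈ E
      · rw [Set.indicator_of_mem hxE]
        have : (S - psi M (0 + R • x) + δ) ^ 2 ≤ (S + 1) ^ 2 := pow_le_pow_left₀ (by linarith) (by linarith) 2
        nlinarith [sq_nonneg (2 * δ)]
      · rw [Set.indicator_of_notMem hxE, add_zero]
        have : S - δ < psi M (0 + R • x) := by
          by_contra hh; exact hxE ⟨not_lt.1 hh, hx⟩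
        exact pow_le_pow_left₀ (by linarith) (by linarith) 2
    refine this.trans ?_
    rw [integral_add c2 cE, setIntegral_indicator mE]
    have e3 : ∫ x in closedBall (0:En n) 2, (2 * δ) ^ 2 = V * (2 * δ) ^ 2 := by simp [hV]
    have e4 : ∫ x in closedBall (0:En n) 2 ∩ E, (S + 1) ^ 2 = volume.real (closedBall (0:En n) 2 ∩ E) * (S + 1) ^ 2 := by simp
    have e5 : closedBall (0:En n) 2 ∩ E = E := Set.inter_eq_right.2 Set.inter_subset_right
    rw [e3, e4, e5]
    have e6 : volume.real E * (S + 1) ^ 2 ≤ e2 / 2 := by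
      have := mul_le_mul_of_nonneg_right hA.le (show 0 ≤ (S + 1) ^ 2 by positivity)
      refine this.trans (le_of_eq ?_)
      field_simp
    have e7 : δ ^ 2 ≤ δ := by nlinarith
    have e8 := mul_le_mul_of_nonneg_left e7 hV0
    nlinarith
  calc _ ≤ C * (k ^ 2 + (k ^ 2)⁻¹ * e2) := by gcongr
    _ ≤ ε := by
      have : C * k ^ 2 = ε / 2 := by rw [hk2]; field_simp
      linarith

/-- closeness to constants in the mean at large scales -/
lemma close_const (hn : 2 ≤ n) (h : SL M) {ε : ℝ} (hε : 0 < ε) : ∃ R0 : ℝ, 0 < R0 ∧ ∀ R, R0 ≤ R →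
    ∃ Q, SC Q ∧ ∫ x in closedBall (0:En n) 1, ∑ i, ∑ j, (M (0 + R • x) i j - Q i j) ^ 2 ≤ ε := by
  obtain ⟨K, hK, hp⟩ := poincare n (r := 1) (by norm_num)
  set V := volume.real (closedBall (0:En n) 1) with hV
  have hV0 : 0 < V := by
    rw [hV, Measure.real, ENNReal.toReal_pos_iff]
    exact ⟨measure_closedBall_pos _ _ (by norm_num), measure_closedBall_lt_top⟩
  obtain ⟨R0, hR0, hE⟩ := energy_lim hn h (ε := ε * V / K) (by positivity)
  refine ⟨R0, hR0, fun R hR => ?_⟩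
  have hE := hE R hR
  by_contra hcon
  push Not at hcon
  have hsm : ∀ i j, Sm fun x => M (0 + R • x) i j := h.sm.scale R
  set F : En n → ℝ := fun y => ∫ x in closedBall (0:En n) 1, ∑ i, ∑ j, (M (0 + R • x) i j - M (0 + R • y) i j) ^ 2 with hF
  have hlt : ∀ y, ε < F y := fun y => hcon _ (h.sc _)
  have ii : ∀ y i j, IntegrableOn (fun x => (M (0 + R • x) i j - M (0 + R • y) i j) ^ 2) (closedBall (0:En n) 1) := fun y i j =>
    integrableOn_cb (((hsm i j).continuous.sub continuous_const).pow 2) 1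
  have eF : F = fun y => ∑ i, ∑ j, ∫ x in closedBall (0:En n) 1, (M (0 + R • x) i j - M (0 + R • y) i j) ^ 2 := by
    ext y
    simp only [hF]
    rw [integral_finsetSum _ fun i _ => integrable_finsetSum _ fun j _ => ii y i j]
    exact Finset.sum_congr rfl fun i _ => integral_finsetSum _ fun j _ => ii y i j
  have cij : ∀ i j, Continuous fun y => ∫ x in closedBall (0:En n) 1, (M (0 + R • x) i j - M (0 + R • y) i j) ^ 2 :=
    fun i j => cont_dev (hsm i j).continuous 1
  have cF : Continuous F := by
    rw [eF]; exact continuous_finsetSum _ fun i _ => continuous_finsetSum _ fun j _ => cij i j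
  have up : ∫ y in closedBall (0:En n) 1, F y ≤ K * ∫ x in closedBall (0:En n) 1, en (fun z => M (0 + R • z)) x := by
    have g : ∀ i j, IntegrableOn (gsq fun y => M (0 + R • y) i j) (closedBall (0:En n) 1) := fun i j =>
      integrableOn_cb (gsq_cont (hsm i j)) 1
    unfold en
    rw [eF, integral_finsetSum _ fun i _ => integrable_finsetSum _ fun j _ => integrableOn_cb (cij i j) 1,
      integral_finsetSum _ fun i _ => integrable_finsetSum _ fun j _ => g i j, Finset.mul_sum]
    refine Finset.sum_le_sum fun i _ => ?_
    rw [integral_finsetSum _ fun j _ => integrableOn_cb (cij i j) 1, integral_finsetSum _ fun j _ => g i j, Finset.mul_sum]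
    exact Finset.sum_le_sum fun j _ => hp _ (hsm i j)
  have lo : ε * V < ∫ y in closedBall (0:En n) 1, F y := by
    have e : ε * V = ∫ y in closedBall (0:En n) 1, ε := by simp [hV, mul_comm]
    rw [e]
    have i1 : IntegrableOn (fun _ : En n => ε) (closedBall (0:En n) 1) := integrableOn_cb continuous_const 1
    have i2 := integrableOn_cb cF 1
    rw [← sub_pos, ← integral_sub i2 i1]
    have i3 : IntegrableOn (fun y => F y - ε) (closedBall (0:En n) 1) := i2.sub i1
    rw [setIntegral_pos_iff_support_of_nonneg_ae (Filter.Eventually.of_forall fun y => by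
      have := hlt y; simp only [Pi.zero_apply]; linarith) i3]
    have : (Function.support fun y => F y - ε) ∩ closedBall (0:En n) 1 = closedBall (0:En n) 1 :=
      Set.inter_eq_right.2 fun y _ => by
        have := hlt y; simp only [Function.mem_support]; linarith
    rw [this]; exact measure_closedBall_pos _ _ (by norm_num)
  have : K * (ε * V / K) = ε * V := by field_simp
  have := mul_le_mul_of_nonneg_left hE hK.le
  linarith

end P10

section P11
open scoped ContDiff
variable {n : ℕ}

/-- decreasing smooth profile supported on `t ≤ 1` -/
def hb (t : ℝ) : ℝ := expNegInvGlue (1 - t)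

lemma hb_smooth : ContDiff ℝ ∞ hb := by
  have : ContDiff ℝ ∞ expNegInvGlue := expNegInvGlue.contDiff
  exact this.comp (by fun_prop)

lemma hb_zero {t : ℝ} (ht : 1 ≤ t) : hb t = 0 := expNegInvGlue.zero_of_nonpos (by linarith)

lemma hb_nonneg (t : ℝ) : 0 ≤ hb t := expNegInvGlue.nonneg _

lemma hb_anti : Antitone hb := fun _ _ h => expNegInvGlue.monotone (by linarith)

lemma hb_has (t : ℝ) : HasDerivAt hb (deriv hb t) t :=
  (hb_smooth.differentiable (by simp) t).hasDerivAt

lemma hb_dcont : Continuous (deriv hb) :=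
  hb_smooth.continuous_deriv (WithTop.coe_le_coe.2 (le_top : (1:ℕ∞) ≤ ⊤))

lemma hb_dnonpos (t : ℝ) : deriv hb t ≤ 0 := hb_anti.deriv_nonpos

lemma hb_dneg {t : ℝ} (ht : t < 1) : deriv hb t < 0 := by
  have h1 : hb =ᶠ[nhds t] fun t => Real.exp (-(1 - t)⁻¹) := by
    filter_upwards [Iio_mem_nhds ht] with s hs
    have : ¬ (1 - s ≤ 0) := by simp only [Set.mem_Iio] at hs; linarith
    simp [hb, expNegInvGlue, this]
  rw [h1.deriv_eq]
  have h2 : HasDerivAt (fun t : ℝ => 1 - t) (-1) t := by simpa using (hasDerivAt_id t).const_sub 1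
  have h3 := ((h2.fun_inv (by linarith)).fun_neg).exp
  rw [h3.deriv]
  have : 0 < Real.exp (-(1 - t)⁻¹) := Real.exp_pos _
  have h4 : 0 < (1 - t) ^ 2 := by have : 0 < 1 - t := by linarith
                                  positivity
  have : -(- -1 / (1 - t) ^ 2) < 0 := by
    have : 0 < - -1 / (1 - t) ^ 2 := by norm_num; linarith
    linarith
  nlinarith

lemma hb_dzero {t : ℝ} (ht : 1 ≤ t) : deriv hb t = 0 := by
  have : IsLocalMin hb t := Filter.Eventually.of_forall fun s => by rw [hb_zero ht]; exact hb_nonneg s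
  exact this.deriv_eq_zero

lemma hb_dbdd : ∃ C : ℝ, 0 < C ∧ ∀ t, 0 ≤ t → |deriv hb t| ≤ C := by
  obtain ⟨C, hC⟩ := isCompact_Icc.exists_bound_of_continuousOn (s := Set.Icc (0:ℝ) 1) hb_dcont.continuousOn
  refine ⟨|C| + 1, by positivity, fun t ht => ?_⟩
  by_cases h1 : t ≤ 1
  · exact (hC t ⟨ht, h1⟩).trans (by have := le_abs_self C; linarith)
  · rw [hb_dzero (by linarith)]; simp; positivity

/-- change of variables -/
lemma cov {T : En n → En n} (hT : ∀ i, Sm (fun x => T x i)) (hb : Function.Bijective T) (g : En n → ℝ) :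
    ∫ x, |(Matrix.of fun i j => pdrv n j (fun y => T y i) x).det| * g (T x) = ∫ y, g y := by
  have hd : ContDiff ℝ ∞ T := contDiff_euclidean.2 hT
  have hD : ∀ x, HasFDerivAt T (fderiv ℝ T x) x := fun x => (hd.differentiable (by simp) x).hasFDerivAt
  have := integral_image_eq_integral_abs_det_fderiv_smul (volume : Measure (En n)) (s := Set.univ) (f := T)
    (f' := fun x => fderiv ℝ T x) MeasurableSet.univ (fun x _ => (hD x).hasFDerivWithinAt) hb.1.injOn g
  rw [Set.image_univ, hb.2.range_eq] at this
  simp only [Measure.restrict_univ, smul_eq_mul] at this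
  rw [this]
  congr 1
  ext x
  congr 2
  rw [ContinuousLinearMap.det, ← LinearMap.det_toMatrix (EuclideanSpace.basisFun (Fin n) ℝ).toBasis]
  congr 1
  ext i j
  rw [LinearMap.toMatrix_apply]
  simp only [of_apply, pdrv, OrthonormalBasis.coe_toBasis, OrthonormalBasis.coe_toBasis_repr_apply,
    EuclideanSpace.basisFun_repr, EuclideanSpace.basisFun_apply]
  have h1 : HasFDerivAt (fun y => T y i) ((EuclideanSpace.proj i : En n →L[ℝ] ℝ).comp (fderiv ℝ T x)) x :=
    (EuclideanSpace.proj i : En n →L[ℝ] ℝ).hasFDerivAt.comp x (hD x)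
  rw [h1.fderiv]
  rfl

/-- matrix acting on `En n` -/
def mv (P : Matrix (Fin n) (Fin n) ℝ) (z : En n) : Fin n → ℝ := P *ᵥ z.ofLp

lemma mv_apply (P : Matrix (Fin n) (Fin n) ℝ) (z : En n) (i : Fin n) : mv P z i = ∑ j, P i j * z j := rfl

lemma sm_coord (j : Fin n) : Sm (fun z : En n => z j) := by
  have : (fun y : En n => y j) = fun y => (EuclideanSpace.proj j : En n →L[ℝ] ℝ) y := by
    ext; simp
  rw [this]; exact ContinuousLinearMap.contDiff _

lemma mv_sm (P : Matrix (Fin n) (Fin n) ℝ) (i : Fin n) : Sm (fun z => mv P z i) := by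
  simp only [mv_apply]
  exact Sm.sum fun j _ => contDiff_const.mul (sm_coord j)

lemma mv_pd (P : Matrix (Fin n) (Fin n) ℝ) (i j : Fin n) (z : En n) : pdrv n j (fun z => mv P z i) z = P i j := by
  simp only [mv_apply]
  rw [pdrv_sum _ _ fun k _ => (contDiff_const.mul (sm_coord k)).differentiable (by simp) z]
  have : ∀ k, pdrv n j (fun y => P i k * y k) z = P i k * if j = k then 1 else 0 := fun k => by
    rw [pdrv_const_mul _ _ ((sm_coord k).diff z), pdrv_coord]
  simp [this]

lemma norm_sq_dot (z : En n) : ‖z‖ ^ 2 = z.ofLp ⬝ᵥ z.ofLp := euc_norm_sq z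

/-- normalizing constant -/
def HH (n : ℕ) : ℝ := ∫ y : En n, hb (‖y‖ ^ 2)

lemma Hconst {P : Matrix (Fin n) (Fin n) ℝ} (hP : Pᵀ = P) :
    ∫ z : En n, om P * hb (‖z‖ ^ 2 + mv P z ⬝ᵥ mv P z) = HH n := by
  obtain ⟨U, μ, h1, h2, rfl⟩ := spec' hP
  set B := cj U (fun i => √(1 + μ i * μ i)) with hB
  have pos : ∀ i, 0 < 1 + μ i * μ i := fun i => by nlinarith [mul_self_nonneg (μ i)]
  have hBt : Bᵀ = B := by simp [hB, cj, Matrix.mul_assoc]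
  have hBB : B * B = 1 + cj U μ * cj U μ := by
    rw [one_add_sq_cj h1 h2, hB, cj_mul h2]
    congr 1; ext i; exact Real.mul_self_sqrt (pos i).le
  have hdet : B.det = om (cj U μ) := by
    rw [om, one_add_sq_cj h1 h2, hB, cj_det h1, cj_det h1, Real.sqrt_prod _ fun i _ => (pos i).le]
  have hdp : 0 < B.det := by rw [hdet]; linarith [om_ge hP]
  have hu : IsUnit B.det := isUnit_iff_ne_zero.2 hdp.ne'
  let T : En n → En n := fun z => WithLp.toLp 2 (mv B z)
  have bij : Function.Bijective T := by
    refine Function.bijective_iff_has_inverse.2 ⟨fun z => WithLp.toLp 2 (mv B⁻¹ z), fun z => ?_, fun z => ?_⟩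
    · simp [T, mv, mulVec_mulVec, nonsing_inv_mul _ hu]
    · simp [T, mv, mulVec_mulVec, mul_nonsing_inv _ hu]
  have := cov (T := T) (fun i => mv_sm B i) bij (fun y => hb (‖y‖ ^ 2))
  rw [HH, ← this]
  congr 1; ext z
  have e1 : (Matrix.of fun i j => pdrv n j (fun y => (T y) i) z) = B := by
    ext i j; exact mv_pd B i j z
  rw [e1, hdet, abs_of_pos (by rw [← hdet]; exact hdp)]
  congr 2
  rw [norm_sq_dot, norm_sq_dot]
  change _ = (B *ᵥ z.ofLp) ⬝ᵥ (B *ᵥ z.ofLp)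
  rw [mul_dot_symm hBt, mulVec_mulVec, hBB, add_mulVec, one_mulVec, dotProduct_add, mv, mul_dot_symm hP, mulVec_mulVec]

/-- gradient-graph potential -/
structure PO (Φ : Fin n → En n → ℝ) (M : MF n) : Prop where
  sm : ∀ i, Sm (Φ i)
  zero : ∀ i, Φ i 0 = 0
  pd : ∀ i j x, pdrv n j (Φ i) x = M x i j

/-- the vector of values -/
def vv (Φ : Fin n → En n → ℝ) (z : En n) : Fin n → ℝ := fun i => Φ i z

lemma PO.le {Φ : Fin n → En n → ℝ} {M : MF n} (h : PO Φ M) (hM : ∀ x, SC (M x)) (z : En n) :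
    vv Φ z ⬝ᵥ vv Φ z ≤ ‖z‖ ^ 2 := by
  set c := vv Φ z with hc
  set f : En n → ℝ := fun y => ∑ i, c i * Φ i y with hf
  have sf : Sm f := Sm.sum fun i _ => contDiff_const.mul (h.sm i)
  have gf : ∀ x, grd f x = M x *ᵥ c := by
    intro x; ext j
    change pdrv n j (fun y => ∑ i, c i * Φ i y) x = _
    rw [pdrv_sum _ _ fun k _ => (contDiff_const.mul (h.sm k)).differentiable (by simp) x]
    simp only [mulVec, dotProduct]
    refine Finset.sum_congr rfl fun i _ => ?_
    rw [pdrv_const_mul _ _ ((h.sm i).diff x), h.pd, mul_comm]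
    have := congrFun (congrFun (hM x).symm j) i
    rw [transpose_apply] at this; rw [this]
  set s := √(c ⬝ᵥ c) with hs
  have hcc := dot_self_nonneg' c
  have bd : ∀ x ∈ Set.univ, ‖fderiv ℝ f x‖ ≤ s := fun x _ =>
    (norm_fderiv_le f x).trans (Real.sqrt_le_sqrt (by rw [gf]; exact (hM x).con c))
  have := Convex.norm_image_sub_le_of_norm_fderiv_le (𝕜 := ℝ) (fun x _ => sf.diff x) bd convex_univ
    (Set.mem_univ (0:En n)) (Set.mem_univ z)
  have f0 : f 0 = 0 := by simp [hf, h.zero]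
  have fz : f z = c ⬝ᵥ c := rfl
  rw [f0, fz, sub_zero, sub_zero, Real.norm_eq_abs, abs_of_nonneg hcc] at this
  have s2 : s ^ 2 = c ⬝ᵥ c := Real.sq_sqrt hcc
  have s0 : 0 ≤ s := Real.sqrt_nonneg _
  rw [← s2] at this ⊢
  rcases eq_or_lt_of_le s0 with h0 | h0
  · rw [← h0]; exact pow_le_pow_left₀ le_rfl (norm_nonneg z) 2
  · have : s ≤ ‖z‖ := by nlinarith
    exact pow_le_pow_left₀ s0 this 2

end P11

section P12
open scoped ContDiff
variable {n : ℕ}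

lemma quad_mod {X : Type*} [PseudoMetricSpace X] {K : Set X} (hK : IsCompact K) {f : X → ℝ} (hf : ContinuousOn f K)
    {ε : ℝ} (hε : 0 < ε) : ∃ C : ℝ, 0 < C ∧ ∀ x ∈ K, ∀ y ∈ K, |f x - f y| ≤ ε + C * dist x y ^ 2 := by
  obtain ⟨δ, hδ, h⟩ := Metric.uniformContinuousOn_iff.1 (hK.uniformContinuousOn_of_continuous hf) ε hε
  obtain ⟨B, hB⟩ := hK.exists_bound_of_continuousOn hf
  refine ⟨2 * (|B| + 1) / δ ^ 2, by positivity, fun x hx y hy => ?_⟩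
  by_cases hd : dist x y < δ
  · have := (h x hx y hy hd).le
    rw [Real.dist_eq] at this
    have : 0 ≤ 2 * (|B| + 1) / δ ^ 2 * dist x y ^ 2 := by positivity
    linarith
  · have h1 := hB x hx
    have h2 := hB y hy
    rw [Real.norm_eq_abs] at h1 h2
    have h3 : |f x - f y| ≤ 2 * (|B| + 1) := by
      have := abs_sub (f x) (f y)
      have := le_abs_self B
      linarith
    have h4 : δ ^ 2 ≤ dist x y ^ 2 := pow_le_pow_left₀ hδ.le (not_lt.1 hd) 2
    have h5 : 2 * (|B| + 1) ≤ 2 * (|B| + 1) / δ ^ 2 * dist x y ^ 2 := by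
      rw [div_mul_eq_mul_div, le_div_iff₀ (by positivity)]
      exact mul_le_mul_of_nonneg_left h4 (by positivity)
    linarith

/-- integrand -/
def WW (p : (Fin n → Fin n → ℝ) × (Fin n → ℝ) × En n) : ℝ :=
  om (Matrix.of p.1) * hb (‖p.2.2‖ ^ 2 + p.2.1 ⬝ᵥ p.2.1)

lemma om_cont : Continuous (fun P : Fin n → Fin n → ℝ => om (Matrix.of P)) := by
  unfold om
  refine Real.continuous_sqrt.comp (Continuous.matrix_det ?_)
  have : Continuous fun P : Fin n → Fin n → ℝ => (Matrix.of P : Matrix (Fin n) (Fin n) ℝ) := continuous_id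
  exact continuous_const.add (this.matrix_mul this)

lemma WW_cont : Continuous (WW (n := n)) := by
  unfold WW
  refine (om_cont.comp continuous_fst).mul (hb_smooth.continuous.comp ?_)
  exact ((continuous_snd.comp continuous_snd).norm.pow 2).add
    ((continuous_fst.comp continuous_snd).dotProduct (continuous_fst.comp continuous_snd))

lemma WW_est (n : ℕ) {ε : ℝ} (hε : 0 < ε) : ∃ C : ℝ, 0 < C ∧ ∀ (P P' : Fin n → Fin n → ℝ) (v v' : Fin n → ℝ) (z : En n),
    (∀ i j, |P i j| ≤ 1) → (∀ i j, |P' i j| ≤ 1) → (∀ i, |v i| ≤ 1) → (∀ i, |v' i| ≤ 1) → ‖z‖ ≤ 1 →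
    |WW (P, v, z) - WW (P', v', z)| ≤ ε + C * (∑ i, ∑ j, (P i j - P' i j) ^ 2 + ∑ i, (v i - v' i) ^ 2) := by
  obtain ⟨C, hC, h⟩ := quad_mod (X := (Fin n → Fin n → ℝ) × (Fin n → ℝ) × En n)
    (isCompact_closedBall 0 1) WW_cont.continuousOn hε
  refine ⟨C, hC, fun P P' v v' z hP hP' hv hv' hz => ?_⟩
  have mem : ∀ (P : Fin n → Fin n → ℝ) (v : Fin n → ℝ), (∀ i j, |P i j| ≤ 1) → (∀ i, |v i| ≤ 1) →
      ((P, v, z) : (Fin n → Fin n → ℝ) × (Fin n → ℝ) × En n) ∈ closedBall 0 1 := by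
    intro P v hP hv
    rw [mem_closedBall, dist_zero_right, norm_prod_le_iff, norm_prod_le_iff]
    refine ⟨?_, ?_, hz⟩
    · exact (pi_norm_le_iff_of_nonneg zero_le_one).2 fun i => (pi_norm_le_iff_of_nonneg zero_le_one).2 fun j => hP i j
    · exact (pi_norm_le_iff_of_nonneg zero_le_one).2 fun j => hv j
  refine (h _ (mem P v hP hv) _ (mem P' v' hP' hv')).trans ?_
  gcongr
  set S := ∑ i, ∑ j, (P i j - P' i j) ^ 2 + ∑ i, (v i - v' i) ^ 2 with hS
  have n1 : 0 ≤ ∑ i, ∑ j, (P i j - P' i j) ^ 2 := Finset.sum_nonneg fun _ _ => Finset.sum_nonneg fun _ _ => sq_nonneg _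
  have n2 : 0 ≤ ∑ i, (v i - v' i) ^ 2 := Finset.sum_nonneg fun _ _ => sq_nonneg _
  have hS0 : 0 ≤ S := by positivity
  have hd : dist ((P, v, z) : (Fin n → Fin n → ℝ) × (Fin n → ℝ) × En n) (P', v', z) ≤ √S := by
    have s0 := Real.sqrt_nonneg S
    rw [Prod.dist_eq, Prod.dist_eq, max_le_iff, max_le_iff]
    refine ⟨(dist_pi_le_iff s0).2 fun i => (dist_pi_le_iff s0).2 fun j => ?_, (dist_pi_le_iff s0).2 fun i => ?_, by simp⟩
    · rw [Real.dist_eq]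
      apply Real.abs_le_sqrt
      have h1 := Finset.single_le_sum (f := fun i => ∑ j, (P i j - P' i j) ^ 2) (fun i _ => Finset.sum_nonneg fun _ _ => sq_nonneg _) (Finset.mem_univ i)
      have h2 := Finset.single_le_sum (f := fun j => (P i j - P' i j) ^ 2) (fun i _ => sq_nonneg _) (Finset.mem_univ j)
      linarith
    · rw [Real.dist_eq]
      apply Real.abs_le_sqrt
      have h2 := Finset.single_le_sum (f := fun j => (v j - v' j) ^ 2) (fun i _ => sq_nonneg _) (Finset.mem_univ i)
      linarith
  calc _ ≤ √S ^ 2 := pow_le_pow_left₀ dist_nonneg hd 2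
    _ = S := Real.sq_sqrt hS0

/-- Poincare for functions vanishing at the origin with linear growth -/
lemma poinc0 (n : ℕ) {ε : ℝ} (hε : 0 < ε) : ∃ C : ℝ, 0 < C ∧ ∀ F : En n → ℝ, Sm F → (∀ x, |F x| ≤ 2 * ‖x‖) →
    ∫ x in closedBall (0:En n) 1, F x ^ 2 ≤ ε + C * ∫ x in closedBall (0:En n) 1, gsq F x := by
  obtain ⟨K, hK, hp⟩ := poincare n (r := 1) (by norm_num)
  set V := volume.real (closedBall (0:En n) 1) with hV
  have hV0 : 0 ≤ V := measureReal_nonneg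
  obtain ⟨ρ, hρ, hρ1, hρ2⟩ : ∃ ρ : ℝ, 0 < ρ ∧ ρ ≤ 1 ∧ 8 * ρ ^ 2 * V ≤ ε := by
    refine ⟨min 1 (ε / (8 * V + 1)), by positivity, min_le_left _ _, ?_⟩
    set ρ := min 1 (ε / (8 * V + 1)) with h
    have h1 : ρ ≤ 1 := min_le_left _ _
    have h0 : 0 < ρ := by positivity
    have h2 : ρ * (8 * V + 1) ≤ ε := by rw [← le_div_iff₀ (by positivity)]; exact min_le_right _ _
    nlinarith [mul_nonneg hV0 (mul_nonneg h0.le (sub_nonneg.2 h1))]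
  set v := volume.real (closedBall (0:En n) ρ) with hv
  have hv0 : 0 < v := by
    rw [hv, Measure.real, ENNReal.toReal_pos_iff]
    exact ⟨measure_closedBall_pos _ _ hρ, measure_closedBall_lt_top⟩
  refine ⟨2 * K / v, by positivity, fun F hF hl => ?_⟩
  set I := ∫ x in closedBall (0:En n) 1, F x ^ 2 with hI
  set E := ∫ x in closedBall (0:En n) 1, gsq F x with hE
  have cd := cont_dev hF.continuous 1
  have p2 : ∀ y ∈ closedBall (0:En n) ρ, I ≤ 2 * (∫ x in closedBall (0:En n) 1, (F x - F y) ^ 2) + 8 * ρ ^ 2 * V := by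
    intro y hy
    have e : 8 * ρ ^ 2 * V = ∫ x in closedBall (0:En n) 1, 8 * ρ ^ 2 := by simp [hV, mul_comm]
    have c1 : Continuous fun x => 2 * (F x - F y) ^ 2 :=
      continuous_const.mul ((hF.continuous.sub continuous_const).pow 2)
    rw [e, ← integral_const_mul, ← integral_add (integrableOn_cb c1 1) (integrableOn_cb continuous_const 1)]
    refine integral_mono (integrableOn_cb (hF.continuous.pow 2) 1)
      (integrableOn_cb (c1.add continuous_const) 1) fun x => ?_
    have h1 : |F y| ≤ 2 * ρ := (hl y).trans (by have : ‖y‖ ≤ ρ := by simpa using hy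
                                                linarith)
    have h3 : F y ^ 2 ≤ (2 * ρ) ^ 2 := by rw [← sq_abs]; exact pow_le_pow_left₀ (abs_nonneg _) h1 2
    simp only
    nlinarith [sq_nonneg (F x - 2 * F y)]
  have p3 : v * I ≤ 2 * (K * E) + v * (8 * ρ ^ 2 * V) := by
    have e : v * I = ∫ y in closedBall (0:En n) ρ, I := by simp [hv]
    rw [e]
    have cc : Continuous fun y => 2 * (∫ x in closedBall (0:En n) 1, (F x - F y) ^ 2) + 8 * ρ ^ 2 * V :=
      (continuous_const.mul cd).add continuous_const
    have i1 : IntegrableOn (fun y => 2 * (∫ x in closedBall (0:En n) 1, (F x - F y) ^ 2))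
      (closedBall (0:En n) ρ) := integrableOn_cb (continuous_const.mul cd) ρ
    refine (setIntegral_mono_on (integrableOn_cb continuous_const ρ) (integrableOn_cb cc ρ) measurableSet_closedBall p2).trans ?_
    rw [integral_add i1 (integrableOn_cb continuous_const ρ), integral_const_mul]
    have : ∫ y in closedBall (0:En n) ρ, 8 * ρ ^ 2 * V = v * (8 * ρ ^ 2 * V) := by simp [hv]
    rw [this]
    have mono : ∫ y in closedBall (0:En n) ρ, ∫ x in closedBall (0:En n) 1, (F x - F y) ^ 2 ≤
        ∫ y in closedBall (0:En n) 1, ∫ x in closedBall (0:En n) 1, (F x - F y) ^ 2 :=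
      setIntegral_mono_set (integrableOn_cb cd 1)
        (Filter.Eventually.of_forall fun y => integral_nonneg fun _ => sq_nonneg _)
        (Filter.Eventually.of_forall (closedBall_subset_closedBall hρ1))
    have := hp F hF
    linarith
  have e : 2 * K / v * E = (2 * (K * E)) / v := by ring
  rw [e]
  have : I ≤ 8 * ρ ^ 2 * V + 2 * (K * E) / v := by
    rw [← sub_le_iff_le_add', le_div_iff₀ hv0]; linarith
  linarith

/-- weighted area -/
def II (Φ : Fin n → En n → ℝ) (M : MF n) : ℝ := ∫ z, om (M z) * hb (‖z‖ ^ 2 + vv Φ z ⬝ᵥ vv Φ z)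

lemma abs_le_of_dot {v : Fin n → ℝ} {s : ℝ} (hs : 0 ≤ s) (h : v ⬝ᵥ v ≤ s ^ 2) (i : Fin n) : |v i| ≤ s := by
  apply abs_le_of_sq_le_sq _ hs
  have := Finset.single_le_sum (f := fun j => v j * v j) (fun j _ => mul_self_nonneg _) (Finset.mem_univ i)
  simp only [dotProduct] at h
  nlinarith

lemma SC.vv {P : Matrix (Fin n) (Fin n) ℝ} (h : SC P) (z : En n) : mv P z ⬝ᵥ mv P z ≤ ‖z‖ ^ 2 := by
  rw [norm_sq_dot]; exact h.con _

lemma vec_cont {Φ : Fin n → En n → ℝ} (h : ∀ i, Sm (Φ i)) : Continuous (vv Φ) :=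
  continuous_pi fun i => (h i).continuous

lemma II_close (n : ℕ) {ε : ℝ} (hε : 0 < ε) : ∃ δ : ℝ, 0 < δ ∧ ∀ (Φ : Fin n → En n → ℝ) (M : MF n) (Q : Matrix (Fin n) (Fin n) ℝ),
    SmM M → (∀ x, SC (M x)) → PO Φ M → SC Q →
    ∫ x in closedBall (0:En n) 1, ∑ i, ∑ j, (M x i j - Q i j) ^ 2 ≤ δ → |II Φ M - HH n| ≤ ε := by
  set V := volume.real (closedBall (0:En n) 1) with hV
  have hV0 : 0 ≤ V := measureReal_nonneg
  obtain ⟨C, hC, hW⟩ := WW_est n (ε := ε / (3 * (V + 1))) (by positivity)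
  obtain ⟨C', hC', hP⟩ := poinc0 n (ε := ε / (3 * C * (n + 1))) (by positivity)
  refine ⟨ε / (3 * C * (1 + C')), by positivity, ?_⟩
  intro Φ M Q smM hM hΦ hQ hd
  set D := ∫ x in closedBall (0:En n) 1, ∑ i, ∑ j, (M x i j - Q i j) ^ 2 with hD
  set F : Fin n → En n → ℝ := fun i z => Φ i z - mv Q z i with hF
  have sF : ∀ i, Sm (F i) := fun i => (hΦ.sm i).sub (mv_sm Q i)
  have gF : ∀ i x, gsq (F i) x = ∑ j, (M x i j - Q i j) ^ 2 := by
    intro i x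
    simp only [gsq, dotProduct, pow_two]
    have : ∀ j, grd (F i) x j = M x i j - Q i j := fun j => by
      simp only [grd, hF]
      rw [pdrv_sub j ((hΦ.sm i).diff x) ((mv_sm Q i).diff x), hΦ.pd, mv_pd]
    simp only [this]
  have bF : ∀ i x, |F i x| ≤ 2 * ‖x‖ := by
    intro i x
    have h1 := abs_le_of_dot (norm_nonneg x) (hΦ.le hM x) i
    have h2 := abs_le_of_dot (norm_nonneg x) (hQ.vv x) i
    have := abs_sub (Φ i x) (mv Q x i)
    simp only [vv] at h1
    simp only [hF]; linarith
  have cF2 : ∀ i, Continuous fun x => F i x ^ 2 := fun i => (sF i).continuous.pow 2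
  have cM2 : ∀ i, Continuous fun x => ∑ j, (M x i j - Q i j) ^ 2 := fun i =>
    continuous_finsetSum _ fun j _ => ((smM i j).continuous.sub continuous_const).pow 2
  have cMM : Continuous fun x => ∑ i, ∑ j, (M x i j - Q i j) ^ 2 := continuous_finsetSum _ fun i _ => cM2 i
  have cFF : Continuous fun x => ∑ i, F i x ^ 2 := continuous_finsetSum _ fun i _ => cF2 i
  have sumF : ∫ x in closedBall (0:En n) 1, ∑ i, F i x ^ 2 ≤ n * (ε / (3 * C * (n + 1))) + C' * D := by
    rw [integral_finsetSum _ fun i _ => integrableOn_cb (cF2 i) 1]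
    refine (Finset.sum_le_sum fun i _ => hP (F i) (sF i) (bF i)).trans (le_of_eq ?_)
    rw [Finset.sum_add_distrib, ← Finset.mul_sum]
    congr 1
    · simp
    · congr 1
      rw [hD, integral_finsetSum _ fun i _ => integrableOn_cb (cM2 i) 1]
      refine Finset.sum_congr rfl fun i _ => ?_
      simp only [gF]
  -- main
  have hconst := Hconst hQ.symm
  have cA : Continuous fun z => om (M z) * hb (‖z‖ ^ 2 + vv Φ z ⬝ᵥ vv Φ z) :=
    (om_cont.comp smM.cont).mul (hb_smooth.continuous.comp
      ((continuous_norm.pow 2).add ((vec_cont hΦ.sm).dotProduct (vec_cont hΦ.sm))))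
  have cmv : Continuous (mv Q) := continuous_pi fun i => (mv_sm Q i).continuous
  have cB : Continuous fun z : En n => om Q * hb (‖z‖ ^ 2 + mv Q z ⬝ᵥ mv Q z) :=
    continuous_const.mul (hb_smooth.continuous.comp
      ((continuous_norm.pow 2).add (cmv.dotProduct cmv)))
  have zA : ∀ z, z ∉ closedBall (0:En n) 1 → om (M z) * hb (‖z‖ ^ 2 + vv Φ z ⬝ᵥ vv Φ z) = 0 := fun z hz => by
    have h1 : 1 < ‖z‖ := by simpa using hz
    rw [hb_zero, mul_zero]
    nlinarith [dot_self_nonneg' (vv Φ z)]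
  have zB : ∀ z, z ∉ closedBall (0:En n) 1 → om Q * hb (‖z‖ ^ 2 + mv Q z ⬝ᵥ mv Q z) = 0 := fun z hz => by
    have h1 : 1 < ‖z‖ := by simpa using hz
    rw [hb_zero, mul_zero]
    nlinarith [dot_self_nonneg' (mv Q z)]
  rw [← hconst, II, ← setIntegral_eq_integral_of_forall_compl_eq_zero zA,
    ← setIntegral_eq_integral_of_forall_compl_eq_zero zB, ← integral_sub (integrableOn_cb cA 1) (integrableOn_cb cB 1)]
  refine (abs_integral_le_integral_abs).trans ?_
  have step : ∫ z in closedBall (0:En n) 1, |om (M z) * hb (‖z‖ ^ 2 + vv Φ z ⬝ᵥ vv Φ z) - om Q * hb (‖z‖ ^ 2 + mv Q z ⬝ᵥ mv Q z)|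
      ≤ ∫ z in closedBall (0:En n) 1, (ε / (3 * (V + 1)) + C * (∑ i, ∑ j, (M z i j - Q i j) ^ 2 + ∑ i, F i z ^ 2)) := by
    refine setIntegral_mono_on (integrableOn_cb (cA.sub cB).abs 1)
      (integrableOn_cb (continuous_const.add (continuous_const.mul (cMM.add cFF))) 1) measurableSet_closedBall fun z hz => ?_
    have hz : ‖z‖ ≤ 1 := by simpa using hz
    have v1 : vv Φ z ⬝ᵥ vv Φ z ≤ 1 ^ 2 := (hΦ.le hM z).trans (pow_le_pow_left₀ (norm_nonneg _) hz 2)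
    have v2 : mv Q z ⬝ᵥ mv Q z ≤ 1 ^ 2 := (hQ.vv z).trans (pow_le_pow_left₀ (norm_nonneg _) hz 2)
    exact hW (M z) Q (vv Φ z) (mv Q z) z (fun i j => (hM z).entry i j) (fun i j => hQ.entry i j)
      (abs_le_of_dot zero_le_one v1) (abs_le_of_dot zero_le_one v2) hz
  refine step.trans ?_
  have j1 : IntegrableOn (fun z => C * (∑ i, ∑ j, (M z i j - Q i j) ^ 2 + ∑ i, F i z ^ 2)) (closedBall (0:En n) 1) :=
    integrableOn_cb (continuous_const.mul (cMM.add cFF)) 1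
  rw [integral_add (integrableOn_cb continuous_const 1) j1, integral_const_mul,
    integral_add (integrableOn_cb cMM 1) (integrableOn_cb cFF 1)]
  have e1 : ∫ z in closedBall (0:En n) 1, ε / (3 * (V + 1)) = V * (ε / (3 * (V + 1))) := by simp [hV]
  rw [e1, ← hD]
  have a1 : V * (ε / (3 * (V + 1))) ≤ ε / 3 := by
    rw [mul_div_assoc', div_le_div_iff₀ (by positivity) (by positivity)]; nlinarith
  have a2 : C * (n * (ε / (3 * C * (n + 1)))) ≤ ε / 3 := by
    have : C * (n * (ε / (3 * C * (n + 1)))) = (ε / 3) * (n / (n + 1)) := by field_simp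
    rw [this]
    have : (n:ℝ) / (n + 1) ≤ 1 := by rw [div_le_one (by positivity)]; linarith
    nlinarith
  have a3 : C * ((1 + C') * D) ≤ ε / 3 := by
    have : C * ((1 + C') * (ε / (3 * C * (1 + C')))) = ε / 3 := by field_simp
    rw [← this]; gcongr
  have := mul_le_mul_of_nonneg_left sumF hC.le
  linarith

end P12

section P13
open scoped ContDiff
variable {n : ℕ} {M : MF n} {Φ : Fin n → En n → ℝ}

/-- squared distance in the graph -/
def qq (Φ : Fin n → En n → ℝ) (x : En n) : ℝ := ∑ i, (x i * x i + Φ i x * Φ i x)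

lemma qq_eq (x : En n) : qq Φ x = ‖x‖ ^ 2 + vv Φ x ⬝ᵥ vv Φ x := by
  rw [qq, Finset.sum_add_distrib, euc_norm_sq]; rfl

lemma PO.smq (h : PO Φ M) : Sm (qq Φ) :=
  Sm.sum fun i _ => ((sm_coord i).mul (sm_coord i)).add ((h.sm i).mul (h.sm i))

/-- half gradient of `qq` -/
def pp (Φ : Fin n → En n → ℝ) (M : MF n) (x : En n) : Fin n → ℝ := x.ofLp + M x *ᵥ vv Φ x

lemma PO.grdq (h : PO Φ M) (hM : ∀ x, (M x)ᵀ = M x) (x : En n) : grd (qq Φ) x = (2:ℝ) • pp Φ M x := by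
  ext i
  change pdrv n i (fun x => ∑ i, (x i * x i + Φ i x * Φ i x)) x = _
  rw [pdrv_sum _ _ fun k _ => (((sm_coord k).mul (sm_coord k)).add ((h.sm k).mul (h.sm k))).differentiable (by simp) x]
  have : ∀ k, pdrv n i (fun x => x k * x k + Φ k x * Φ k x) x = 2 * ((if i = k then x k else 0) + M x i k * Φ k x) := fun k => by
    rw [pdrv_add i (((sm_coord k).mul (sm_coord k)).differentiable (by simp) x) (((h.sm k).mul (h.sm k)).differentiable (by simp) x),
      pdrv_mul i ((sm_coord k).diff x) ((sm_coord k).diff x), pdrv_mul i ((h.sm k).diff x) ((h.sm k).diff x), pdrv_coord, h.pd]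
    have e := congrFun (congrFun (hM x) i) k
    rw [transpose_apply] at e
    rw [e]
    split_ifs <;> ring
  simp only [this]
  rw [← Finset.mul_sum, Finset.sum_add_distrib]
  simp [pp, mulVec, dotProduct, vv]

lemma SL.ndv_q (h : SL M) (hp : PO Φ M) (x : En n) : ndv M (qq Φ) x = 2 * n := by
  have hs := (h.sc x).symm
  have e1 : ∀ i j, pdrv n j (fun y => pdrv n i (qq Φ) y) x =
      2 * ((1 + M x * M x) j i + ∑ k, Φ k x * pdm k M x j i) := by
    intro i j
    have : (fun y => pdrv n i (qq Φ) y) = fun y => 2 * (y i + ∑ k, M y i k * Φ k y) := by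
      ext y; have := congrFun (hp.grdq (fun x => (h.sc x).symm) y) i; simpa [grd, pp, mulVec, dotProduct, vv] using this
    rw [this]
    have d1 : ∀ k, Sm (fun y => M y i k * Φ k y) := fun k => (h.sm i k).mul (hp.sm k)
    have d2 : Sm (fun y => ∑ k, M y i k * Φ k y) := Sm.sum fun k _ => d1 k
    rw [pdrv_const_mul j _ (((sm_coord i).add d2).differentiable (by simp) x), pdrv_add j ((sm_coord i).diff x) (d2.diff x),
      pdrv_coord, pdrv_sum _ _ fun k _ => (d1 k).diff x]
    congr 1
    have e2 : ∀ k, pdrv n j (fun y => M y i k * Φ k y) x = Φ k x * pdm k M x j i + M x j k * M x k i := fun k => by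
      rw [pdrv_mul j ((h.sm i k).diff x) ((hp.sm k).diff x), hp.pd]
      have a1 : pdrv n j (fun y => M y i k) x = pdm k M x i j := h.tot x i k j
      have a2 : pdm k M x i j = pdm k M x j i := congrFun (congrFun (h.pd_symm x k) j) i
      have s1 := congrFun (congrFun hs i) k
      have s2 := congrFun (congrFun hs k) j
      rw [transpose_apply] at s1 s2
      rw [a1, a2, s1, s2]; ring
    simp only [e2]
    rw [Finset.sum_add_distrib, Matrix.add_apply, Matrix.mul_apply, Matrix.one_apply]
    ring
  have e3 : ∀ k, ∑ i, ∑ j, Gm (M x) i j * pdm k M x j i = 0 := fun k => by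
    have := h.tr x k
    simpa only [Matrix.trace, Matrix.diag, Matrix.mul_apply] using this
  have e4 : ∑ i, ∑ j, Gm (M x) i j * (1 + M x * M x) j i = n := by
    have : (Gm (M x) * (1 + M x * M x)).trace = n := by rw [Gm_mul hs]; simp
    rw [← this]
    simp only [Matrix.trace, Matrix.diag, Matrix.mul_apply]
  simp only [ndv, e1]
  calc ∑ i, ∑ j, Gm (M x) i j * (2 * ((1 + M x * M x) j i + ∑ k, Φ k x * pdm k M x j i))
      = 2 * (∑ i, ∑ j, Gm (M x) i j * (1 + M x * M x) j i) + 2 * ∑ i, ∑ j, ∑ k, Φ k x * (Gm (M x) i j * pdm k M x j i) := by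
        simp only [Finset.mul_sum, ← Finset.sum_add_distrib]
        refine Finset.sum_congr rfl fun i _ => Finset.sum_congr rfl fun j _ => ?_
        rw [mul_add, mul_add, Finset.mul_sum, Finset.mul_sum]
        congr 1
        · ring
        · exact Finset.sum_congr rfl fun k _ => by ring
    _ = 2 * n := by
        have : ∑ i, ∑ j, ∑ k, Φ k x * (Gm (M x) i j * pdm k M x j i) = ∑ k, Φ k x * ∑ i, ∑ j, Gm (M x) i j * pdm k M x j i := by
          have : ∀ i, ∑ j, ∑ k, Φ k x * (Gm (M x) i j * pdm k M x j i) = ∑ k, ∑ j, Φ k x * (Gm (M x) i j * pdm k M x j i) :=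
            fun i => Finset.sum_comm
          simp only [this]
          rw [Finset.sum_comm]
          simp only [Finset.mul_sum]
        rw [this, e4]
        simp [e3]

/-- the deviation from a cone -/
def dv (Φ : Fin n → En n → ℝ) (M : MF n) (x : En n) : Fin n → ℝ := vv Φ x - M x *ᵥ x.ofLp

lemma qq_split {M : MF n} (x : En n) (hs : (M x)ᵀ = M x) :
    qq Φ x = bil (Gm (M x)) (pp Φ M x) (pp Φ M x) + bil (Gm (M x)) (dv Φ M x) (dv Φ M x) := by
  have gs := Gm_symm hs
  have gc := Gm_comm hs
  have gm := Gm_mul hs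
  rw [qq_eq, norm_sq_dot]
  set G := Gm (M x)
  set P := M x
  set z := x.ofLp
  set v := vv Φ x
  have k1 : ∀ w, G *ᵥ w + P *ᵥ (G *ᵥ (P *ᵥ w)) = w := fun w => by
    rw [mulVec_mulVec, mulVec_mulVec, ← gc, ← add_mulVec]
    have : G + G * P * P = 1 := by rw [← gm]; noncomm_ring
    rw [this, one_mulVec]
  have bs : ∀ a b, bil G (P *ᵥ a) b = a ⬝ᵥ (P *ᵥ (G *ᵥ b)) := fun a b => by
    unfold bil; rw [mul_dot_symm hs]
  have z1 : z ⬝ᵥ z = bil G z z + bil G (P *ᵥ z) (P *ᵥ z) := by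
    rw [bs]; unfold bil; rw [← dotProduct_add, k1]
  have z2 : v ⬝ᵥ v = bil G v v + bil G (P *ᵥ v) (P *ᵥ v) := by
    rw [bs]; unfold bil; rw [← dotProduct_add, k1]
  have z3 : bil G z (P *ᵥ v) = bil G (P *ᵥ z) v := by
    rw [bs]; unfold bil; rw [mulVec_mulVec, mulVec_mulVec, gc]
  have e1 : pp Φ M x = z + P *ᵥ v := rfl
  have e2 : dv Φ M x = v + -(P *ᵥ z) := by rw [← sub_eq_add_neg]; rfl
  rw [e1, e2, z1, z2]
  simp only [bil_add_left, bil_add_right, bil_neg_left, bil_neg_right]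
  rw [bil_symm gs (P *ᵥ v) z, bil_symm gs v (P *ᵥ z), z3]
  ring

/-- support bound -/
lemma supp_q {t : ℝ} (ht : 0 < t) {x : En n} (hx : x ∉ closedBall (0:En n) t⁻¹) : 1 ≤ t ^ 2 * qq Φ x := by
  have h1 : t⁻¹ < ‖x‖ := by simpa using hx
  rw [qq_eq]
  have := dot_self_nonneg' (vv Φ x)
  have h2 : (t⁻¹) ^ 2 ≤ ‖x‖ ^ 2 := pow_le_pow_left₀ (by positivity) h1.le 2
  have h3 : t ^ 2 * (t⁻¹) ^ 2 = 1 := by field_simp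
  have h4 : 0 ≤ t ^ 2 := sq_nonneg t
  nlinarith [mul_le_mul_of_nonneg_left h2 h4, mul_nonneg h4 this]

lemma qq_nonneg (x : En n) : 0 ≤ qq Φ x := by
  rw [qq_eq]; have := dot_self_nonneg' (vv Φ x); positivity

/-- first variation identity -/
lemma SL.first_var (h : SL M) (hp : PO Φ M) {t : ℝ} (ht : 0 < t) :
    2 * t ^ 2 * ∫ x, om (M x) * deriv hb (t ^ 2 * qq Φ x) * bil (Gm (M x)) (pp Φ M x) (pp Φ M x)
      = - (n * ∫ x, om (M x) * hb (t ^ 2 * qq Φ x)) := by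
  have sφ : Sm (fun x => hb (t ^ 2 * qq Φ x)) := hb_smooth.comp (contDiff_const.mul hp.smq)
  have cs : HasCompactSupport (fun x => hb (t ^ 2 * qq Φ x)) :=
    HasCompactSupport.intro (isCompact_closedBall 0 t⁻¹) fun x hx => hb_zero (supp_q ht hx)
  have gφ : ∀ x, grd (fun x => hb (t ^ 2 * qq Φ x)) x = (deriv hb (t ^ 2 * qq Φ x) * t ^ 2) • grd (qq Φ) x := fun x =>
    grd_comp (h := fun s => hb (t ^ 2 * s)) (by
      have := (hb_has (t ^ 2 * qq Φ x)).comp (qq Φ x) ((hasDerivAt_id (qq Φ x)).const_mul (t ^ 2))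
      simpa [Function.comp_def] using this) (hp.smq.diff x)
  have := h.weak hp.smq sφ cs
  have e1 : ∀ x, bil (am (M x)) (grd (qq Φ) x) (grd (fun x => hb (t ^ 2 * qq Φ x)) x) =
      (4 * t ^ 2) * (om (M x) * deriv hb (t ^ 2 * qq Φ x) * bil (Gm (M x)) (pp Φ M x) (pp Φ M x)) := fun x => by
    rw [gφ, hp.grdq fun x => (h.sc x).symm]
    simp only [bil_smul_left, bil_smul_right, bil_am]
    ring
  have e2 : ∀ x, hb (t ^ 2 * qq Φ x) * (om (M x) * ndv M (qq Φ) x) = (2 * n) * (om (M x) * hb (t ^ 2 * qq Φ x)) := fun x => by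
    rw [h.ndv_q hp]; ring
  simp only [e1, e2] at this
  rw [integral_const_mul, integral_const_mul] at this
  linarith

/-- monotone quantity -/
def It (Φ : Fin n → En n → ℝ) (M : MF n) (t : ℝ) : ℝ := t ^ n * ∫ x, om (M x) * hb (t ^ 2 * qq Φ x)

lemma It_deriv (h : SL M) (hp : PO Φ M) {t : ℝ} (ht : 0 < t) :
    HasDerivAt (It Φ M) (2 * t ^ (n + 1) * ∫ x, om (M x) * deriv hb (t ^ 2 * qq Φ x) * bil (Gm (M x)) (dv Φ M x) (dv Φ M x)) t := by
  obtain ⟨C, hC, hCb⟩ := hb_dbdd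
  have cq := hp.smq.continuous
  have co := h.smom.continuous
  have ch := hb_smooth.continuous
  have cd := hb_dcont
  have cvv := vec_cont hp.sm
  have cz : Continuous fun x : En n => x.ofLp := by fun_prop
  have cpp : Continuous (pp Φ M) := cz.add (h.sm.cont.matrix_mulVec cvv)
  have cdv : Continuous (dv Φ M) := cvv.sub (h.sm.cont.matrix_mulVec cz)
  have cG := h.smG.cont
  have integ : ∀ {s : ℝ}, 0 < s → ∀ {g : En n → ℝ}, Continuous g → Integrable fun x => om (M x) * deriv hb (s ^ 2 * qq Φ x) * g x := by
    intro s hs g hg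
    refine Continuous.integrable_of_hasCompactSupport ((co.mul (cd.comp (continuous_const.mul cq))).mul hg)
      (HasCompactSupport.intro (isCompact_closedBall 0 s⁻¹) fun x hx => ?_)
    rw [hb_dzero (supp_q hs hx)]; ring
  obtain ⟨B, hB⟩ := (isCompact_closedBall (0:En n) (t / 2)⁻¹).exists_bound_of_continuousOn cq.continuousOn
  have hd := (hasDerivAt_integral_of_dominated_loc_of_deriv_le (μ := (volume : Measure (En n))) (𝕜 := ℝ) (x₀ := t)
    (s := Set.Ioo (t / 2) (2 * t)) (F := fun s x => om (M x) * hb (s ^ 2 * qq Φ x))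
    (F' := fun s x => om (M x) * deriv hb (s ^ 2 * qq Φ x) * (2 * s * qq Φ x))
    (bound := (closedBall (0:En n) (t / 2)⁻¹).indicator fun _ => 2 ^ n * C * (2 * (2 * t) * |B|))
    (Ioo_mem_nhds (by linarith) (by linarith)) ?_ ?_ ?_ ?_ ?_ ?_).2
  · have hpow : HasDerivAt (fun t : ℝ => t ^ n) (n * t ^ (n - 1)) t := hasDerivAt_pow n t
    have := hpow.mul hd
    refine this.congr_deriv ?_
    have fv := h.first_var hp ht
    have i1 := integ ht (bil_cont cG cpp cpp)
    have i2 := integ ht (bil_cont cG cdv cdv)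
    have e1 : ∫ x, om (M x) * deriv hb (t ^ 2 * qq Φ x) * (2 * t * qq Φ x) =
        2 * t * (∫ x, om (M x) * deriv hb (t ^ 2 * qq Φ x) * bil (Gm (M x)) (pp Φ M x) (pp Φ M x))
        + 2 * t * ∫ x, om (M x) * deriv hb (t ^ 2 * qq Φ x) * bil (Gm (M x)) (dv Φ M x) (dv Φ M x) := by
      rw [← mul_add, ← integral_add i1 i2, ← integral_const_mul]
      congr 1; ext x
      have qs := qq_split (Φ := Φ) x (h.sc x).symm
      generalize deriv hb (t ^ 2 * qq Φ x) = D
      rw [qs]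
      ring
    rw [e1]
    set A1 := ∫ x, om (M x) * deriv hb (t ^ 2 * qq Φ x) * bil (Gm (M x)) (pp Φ M x) (pp Φ M x)
    set A2 := ∫ x, om (M x) * deriv hb (t ^ 2 * qq Φ x) * bil (Gm (M x)) (dv Φ M x) (dv Φ M x)
    set A3 := ∫ x, om (M x) * hb (t ^ 2 * qq Φ x)
    have : t * (n * t ^ (n - 1) * A3) = t * (- (t ^ n * (2 * t * A1))) := by
      have e2 : t * (n * t ^ (n - 1)) = n * t ^ n := by
        rcases n with _ | m
        · simp
        · simp only [Nat.add_sub_cancel]; ring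
      calc t * (n * t ^ (n - 1) * A3) = t * (n * t ^ (n - 1)) * A3 := by ring
        _ = t ^ n * (n * A3) := by rw [e2]; ring
        _ = t ^ n * (- (2 * t ^ 2 * A1)) := by rw [fv]; ring
        _ = _ := by ring
    have := mul_left_cancel₀ ht.ne' this
    rw [this]; ring
  · exact Filter.Eventually.of_forall fun s => (co.mul (ch.comp (continuous_const.mul cq))).aestronglyMeasurable
  · refine Continuous.integrable_of_hasCompactSupport (co.mul (ch.comp (continuous_const.mul cq)))
      (HasCompactSupport.intro (isCompact_closedBall 0 t⁻¹) fun x hx => ?_)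
    rw [hb_zero (supp_q ht hx)]; ring
  · exact ((co.mul (cd.comp (continuous_const.mul cq))).mul (continuous_const.mul cq)).aestronglyMeasurable
  · refine Filter.Eventually.of_forall fun x s hs => ?_
    have hs0 : 0 < s := by linarith [hs.1]
    by_cases hx : x ∈ closedBall (0:En n) (t / 2)⁻¹
    · rw [Set.indicator_of_mem hx]
      have o1 := om_ge (h.sc x).symm
      have o2 := (h.sc x).om_le
      have o3 := hCb (s ^ 2 * qq Φ x) (mul_nonneg (sq_nonneg s) (qq_nonneg x))
      have o4 := (hB x hx).trans (le_abs_self B)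
      have q0 := qq_nonneg (Φ := Φ) x
      rw [Real.norm_eq_abs, abs_of_nonneg q0] at o4
      rw [Real.norm_eq_abs, abs_mul, abs_mul, abs_of_pos (by linarith : 0 < om (M x)),
        abs_of_nonneg (by positivity : 0 ≤ 2 * s * qq Φ x)]
      have := hs.2.le
      gcongr
    · rw [Set.indicator_of_notMem hx]
      have : x ∉ closedBall (0:En n) s⁻¹ := fun hh => hx (closedBall_subset_closedBall (by
        have := hs.1; gcongr) hh)
      rw [hb_dzero (supp_q hs0 this)]; simp
  · exact (integrable_indicator_iff measurableSet_closedBall).2 (integrableOn_const measure_closedBall_lt_top.ne)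
  · refine Filter.Eventually.of_forall fun x s _ => ?_
    have h1 : HasDerivAt (fun s : ℝ => s ^ 2 * qq Φ x) (2 * s * qq Φ x) s := by
      simpa using (hasDerivAt_pow 2 s).mul_const (qq Φ x)
    have := ((hb_has (s ^ 2 * qq Φ x)).comp s h1).const_mul (om (M x))
    rw [← mul_assoc] at this
    exact this

lemma PO.scale (hM : SmM M) (hp : PO Φ M) {t : ℝ} (ht : 0 < t) :
    PO (fun i z => t * Φ i (0 + t⁻¹ • z)) (fun z => M (0 + t⁻¹ • z)) where
  sm i := contDiff_const.mul ((hp.sm i).scale _ 0)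
  zero i := by simp [hp.zero]
  pd i j x := by
    rw [pdrv_const_mul _ _ (((hp.sm i).scale _ 0).diff x), pdrv_scale _ (hp.sm i).diff, hp.pd]
    field_simp

lemma It_eq {t : ℝ} (ht : 0 < t) : It Φ M t = II (fun i z => t * Φ i (0 + t⁻¹ • z)) (fun z => M (0 + t⁻¹ • z)) := by
  have := integral_scale (fun x => om (M x) * hb (t ^ 2 * qq Φ x)) (inv_pos.2 ht)
  rw [It, II]
  rw [inv_pow, inv_inv] at this
  rw [← this]
  congr 1; ext z
  congr 2
  rw [qq_eq]
  simp only [zero_add, norm_smul, vv, dotProduct, Real.norm_eq_abs]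
  rw [mul_add, Finset.mul_sum]
  congr 1
  · rw [mul_pow, sq_abs]; field_simp
  · exact Finset.sum_congr rfl fun i _ => by ring

end P13

section P14
open scoped ContDiff
variable {n : ℕ} {M : MF n} {Φ : Fin n → En n → ℝ}

lemma cont_zero_of_int {F : En n → ℝ} (hc : Continuous F) (h0 : ∀ x, 0 ≤ F x) (hi : Integrable F)
    (hz : ∫ x, F x = 0) (x : En n) : F x = 0 := by
  have := (integral_eq_zero_iff_of_nonneg h0 hi).1 hz
  have := (Continuous.ae_eq_iff_eq volume hc continuous_const).1 this
  exact congrFun this x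

lemma It_large (hM : SmM M) (hs : ∀ x, SC (M x)) (hp : PO Φ M) {ε : ℝ} (hε : 0 < ε) :
    ∃ T : ℝ, 0 < T ∧ ∀ t, T ≤ t → |It Φ M t - HH n| ≤ ε := by
  obtain ⟨δ, hδ, H⟩ := II_close n hε
  set V := volume.real (closedBall (0:En n) 1) with hV
  have hV0 : 0 ≤ V := measureReal_nonneg
  have cF : Continuous fun x => ∑ i, ∑ j, (M x i j - M 0 i j) ^ 2 := by
    refine continuous_finsetSum _ fun i _ => continuous_finsetSum _ fun j _ => ?_
    exact ((hM i j).continuous.sub continuous_const).pow 2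
  have hδV : 0 < δ / (V + 1) := by positivity
  obtain ⟨ρ, hρ, hb⟩ := Metric.continuous_iff.1 cF 0 _ hδV
  refine ⟨2 / ρ, by positivity, fun t ht => ?_⟩
  have t0 : 0 < t := lt_of_lt_of_le (by positivity) ht
  rw [It_eq t0]
  refine H _ _ (M 0) (hM.scale _) (fun x => hs _) (hp.scale hM t0) (hs 0) ?_
  have key : ∀ x ∈ closedBall (0:En n) 1, ‖∑ i, ∑ j, (M (0 + t⁻¹ • x) i j - M 0 i j) ^ 2‖ ≤ δ / (V + 1) := by
    intro x hx
    have hx' : ‖x‖ ≤ 1 := by simpa using hx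
    have : dist ((0:En n) + t⁻¹ • x) 0 < ρ := by
      rw [zero_add, dist_zero_right, norm_smul, Real.norm_eq_abs, abs_of_pos (inv_pos.2 t0)]
      have : t⁻¹ ≤ ρ / 2 := by
        rw [inv_le_comm₀ t0 (by positivity)]; simpa using ht
      nlinarith [inv_pos.2 t0]
    have := hb _ this
    simpa [dist_eq_norm] using this.le
  have := norm_setIntegral_le_of_norm_le_const (μ := volume) measure_closedBall_lt_top key
  rw [← hV] at this
  refine (le_abs_self _).trans (this.trans ?_)
  rw [div_mul_eq_mul_div, div_le_iff₀ (by positivity)]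
  nlinarith

lemma It_small (hn : 2 ≤ n) (h : SL M) (hp : PO Φ M) {ε : ℝ} (hε : 0 < ε) :
    ∃ T : ℝ, 0 < T ∧ ∀ t, 0 < t → t ≤ T → |It Φ M t - HH n| ≤ ε := by
  obtain ⟨δ, hδ, H⟩ := II_close n hε
  obtain ⟨R0, hR, hc⟩ := close_const hn h hδ
  refine ⟨R0⁻¹, by positivity, fun t t0 ht => ?_⟩
  rw [It_eq t0]
  obtain ⟨Q, hQ, hi⟩ := hc t⁻¹ (by rw [le_inv_comm₀ hR t0]; exact ht)
  exact H _ _ Q (h.sm.scale _) (fun x => h.sc _) (hp.scale h.sm t0) hQ hi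

lemma bilG_nonneg (h : SL M) (x : En n) (ξ : Fin n → ℝ) : 0 ≤ bil (Gm (M x)) ξ ξ :=
  le_trans (mul_nonneg (by norm_num) (dot_self_nonneg' ξ)) ((h.sc x).Gm_bil_ge ξ)

lemma It_const (hn : 2 ≤ n) (h : SL M) (hp : PO Φ M) {t : ℝ} (ht : 0 < t) : It Φ M t = HH n := by
  have an : AntitoneOn (It Φ M) (Set.Ioi 0) := by
    refine antitoneOn_of_deriv_nonpos (convex_Ioi 0)
      (fun s hs => (It_deriv h hp hs).continuousAt.continuousWithinAt)
      (fun s hs => ?_) fun s hs => ?_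
    · rw [interior_Ioi] at hs
      exact (It_deriv h hp hs).differentiableAt.differentiableWithinAt
    · rw [interior_Ioi] at hs
      have hs : 0 < s := hs
      rw [(It_deriv h hp hs).deriv]
      refine mul_nonpos_of_nonneg_of_nonpos (by positivity) (integral_nonpos fun x => ?_)
      have o1 := om_ge (h.sc x).symm
      exact mul_nonpos_of_nonpos_of_nonneg (mul_nonpos_of_nonneg_of_nonpos (by linarith) (hb_dnonpos _)) (bilG_nonneg h x _)
  refine le_antisymm (le_of_forall_pos_le_add fun ε hε => ?_) (le_of_forall_pos_le_add fun ε hε => ?_)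
  · obtain ⟨T, hT, hT'⟩ := It_small hn h hp hε
    have h1 := hT' (min T t) (lt_min hT ht) (min_le_left _ _)
    have h2 := an (lt_min hT ht : (0:ℝ) < min T t) ht (min_le_right _ _)
    linarith [le_abs_self (It Φ M (min T t) - HH n)]
  · obtain ⟨T, hT, hT'⟩ := It_large h.sm h.sc hp hε
    have h1 := hT' (max T t) (le_max_left _ _)
    have h2 := an ht (lt_of_lt_of_le ht (le_max_right _ _) : (0:ℝ) < max T t) (le_max_right _ _)
    linarith [neg_abs_le (It Φ M (max T t) - HH n)]

lemma dv_zero (hn : 2 ≤ n) (h : SL M) (hp : PO Φ M) (x : En n) : dv Φ M x = 0 := by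
  have cq := hp.smq.continuous
  have cz : Continuous fun x : En n => x.ofLp := by fun_prop
  have cdv : Continuous (dv Φ M) := (vec_cont hp.sm).sub (h.sm.cont.matrix_mulVec cz)
  set t : ℝ := (1 + qq Φ x)⁻¹ with ht
  have q0 := qq_nonneg (Φ := Φ) x
  have t0 : 0 < t := by positivity
  have tq : t ^ 2 * qq Φ x < 1 := by
    rw [ht, inv_pow, inv_mul_lt_iff₀ (by positivity)]; nlinarith
  have d1 := It_deriv h hp t0
  have d2 : HasDerivAt (It Φ M) 0 t := (hasDerivAt_const t (HH n)).congr_of_eventuallyEq (by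
    filter_upwards [Ioi_mem_nhds t0] with s hs
    exact It_const hn h hp hs)
  have d3 := d1.unique d2
  have d4 : ∫ x, om (M x) * deriv hb (t ^ 2 * qq Φ x) * bil (Gm (M x)) (dv Φ M x) (dv Φ M x) = 0 := by
    rcases mul_eq_zero.1 d3 with h | h
    · exact absurd h (by positivity)
    · exact h
  have cF : Continuous fun x => -(om (M x) * deriv hb (t ^ 2 * qq Φ x) * bil (Gm (M x)) (dv Φ M x) (dv Φ M x)) :=
    ((h.smom.continuous.mul (hb_dcont.comp (continuous_const.mul cq))).mul (bil_cont h.smG.cont cdv cdv)).neg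
  have key := cont_zero_of_int cF (fun x => ?_) ?_ (by rw [integral_neg, d4, neg_zero]) x
  · have o1 := om_ge (h.sc x).symm
    have o2 := hb_dneg tq
    have o3 := (h.sc x).Gm_bil_ge (dv Φ M x)
    have : bil (Gm (M x)) (dv Φ M x) (dv Φ M x) = 0 := by
      rw [neg_eq_zero] at key
      rcases mul_eq_zero.1 key with k | k
      · rcases mul_eq_zero.1 k with k | k <;> linarith
      · exact k
    have o4 := dot_self_nonneg' (dv Φ M x)
    exact dotProduct_self_eq_zero.1 (by linarith)
  · have o1 := om_ge (h.sc x).symm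
    exact neg_nonneg.2 (mul_nonpos_of_nonpos_of_nonneg (mul_nonpos_of_nonneg_of_nonpos (by linarith) (hb_dnonpos _)) (bilG_nonneg h x _))
  · refine Continuous.integrable_of_hasCompactSupport cF
      (HasCompactSupport.intro (isCompact_closedBall 0 t⁻¹) fun x hx => ?_)
    rw [hb_dzero (supp_q t0 hx)]; ring

lemma rigid2 (hn : 2 ≤ n) (h : SL M) (hp : PO Φ M) (x : En n) : M x = M 0 := by
  have h1 : ∀ i z, Φ i z = ∑ j, M z i j * z j := fun i z => by
    have := congrFun (dv_zero hn h hp z) i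
    simp only [dv, Pi.sub_apply, Pi.zero_apply, sub_eq_zero] at this
    exact this
  have h2 : ∀ i k z, fderiv ℝ (fun y => M y i k) z z = 0 := fun i k z => by
    have e : Φ i = fun z => ∑ j, M z i j * z j := funext (h1 i)
    have p := hp.pd i k z
    rw [e, pdrv_sum _ _ fun j _ => ((h.sm i j).mul (sm_coord j)).differentiable (by simp) z] at p
    have q : ∀ j, pdrv n k (fun z => M z i j * z j) z = z j * pdrv n j (fun y => M y i k) z + M z i j * (if k = j then 1 else 0) := fun j => by
      rw [pdrv_mul k ((h.sm i j).diff z) ((sm_coord j).diff z), pdrv_coord]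
      have : pdrv n k (fun y => M y i j) z = pdrv n j (fun y => M y i k) z := h.tot z i j k
      rw [this]; split_ifs <;> ring
    simp only [q] at p
    rw [Finset.sum_add_distrib] at p
    simp only [mul_ite, mul_one, mul_zero, Finset.sum_ite_eq, Finset.mem_univ, if_true] at p
    rw [fderiv_eq_sum]
    linarith
  ext i k
  have hd : ∀ t : ℝ, HasDerivAt (fun t : ℝ => M (t • x) i k) (fderiv ℝ (fun y => M y i k) (t • x) x) t := fun t => by
    have a := ((h.sm i k).diff (t • x)).hasFDerivAt
    have b : HasDerivAt (fun t : ℝ => t • x) ((1:ℝ) • x) t := (hasDerivAt_id t).smul_const x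
    rw [one_smul] at b
    exact a.comp_hasDerivAt t b
  obtain ⟨c, hc, hs⟩ := exists_hasDerivAt_eq_slope _ _ (zero_lt_one (α := ℝ))
    (fun t _ => (hd t).continuousAt.continuousWithinAt) (fun t _ => hd t)
  have := h2 i k (c • x)
  rw [map_smul, smul_eq_mul] at this
  rcases mul_eq_zero.1 this with k1 | k1
  · exact absurd k1 hc.1.ne'
  · rw [k1] at hs; simp only [one_smul, zero_smul, sub_zero, div_one] at hs; linarith

lemma rigid (hn : 1 ≤ n) (h : SL M) (hp : PO Φ M) (x : En n) : M x = M 0 := by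
  rcases hn.eq_or_lt with e | hn
  · subst e
    have hz : ∀ y k, pdrv 1 k (fun y => M y 0 0) y = 0 := fun y k => by
      have := h.tr y k
      have g := (h.sc y).Gm_bil_ge (fun _ => 1)
      rw [trace_fin_one, Matrix.mul_apply] at this
      simp only [Finset.univ_unique, Fin.default_eq_zero, Finset.sum_singleton] at this
      simp [bil, dotProduct, mulVec] at g
      rcases mul_eq_zero.1 this with k1 | k1
      · rw [k1] at g; norm_num at g
      · exact k1
    ext i j
    obtain rfl : i = 0 := Subsingleton.elim _ _
    obtain rfl : j = 0 := Subsingleton.elim _ _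
    refine const_of_gsq (h.sm 0 0) (fun y => ?_) x 0
    simp [gsq, dotProduct, grd, hz]
  · exact rigid2 hn h hp x

end P14

section P15
open scoped ContDiff
variable {n : ℕ} {A : MF n}

lemma tr_cj (Q B : Matrix (Fin n) (Fin n) ℝ) (d : Fin n → ℝ) :
    (cj Q d * B).trace = ∑ i, d i * (Qᵀ * B * Q) i i := by
  rw [cj, Matrix.mul_assoc, Matrix.mul_assoc, Matrix.trace_mul_comm, Matrix.mul_assoc, Matrix.trace]
  simp only [diag_apply, diagonal_mul]

lemma smG_of (hA : SmM A) (hs : ∀ x, (A x)ᵀ = A x) : SmM (fun x => Gm (A x)) :=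
  ((SmM.const 1).add (hA.mul hA)).inv fun x => by linarith [det_pos_of (hs x)]

lemma smom_of (hA : SmM A) (hs : ∀ x, (A x)ᵀ = A x) : Sm (fun x => om (A x)) :=
  ContDiff.sqrt ((SmM.const 1).add (hA.mul hA)).det fun x => by linarith [det_pos_of (hs x)]

lemma pdG_of (hA : SmM A) (hs : ∀ x, (A x)ᵀ = A x) (k : Fin n) (x : En n) :
    pdm k (fun x => Gm (A x)) x =
      - (Gm (A x) * pdm k A x * (A x * Gm (A x)) + (Gm (A x) * A x) * pdm k A x * Gm (A x)) := by
  have := pdm_inv ((SmM.const 1).add (hA.mul hA)) (fun x => by linarith [det_pos_of (hs x)]) k x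
  rw [pdm_add (SmM.const 1) (hA.mul hA), pdm_const, zero_add, pdm_mul hA hA] at this
  change pdm k (fun x => (1 + A x * A x)⁻¹) x = _
  rw [this]
  simp only [Gm]
  noncomm_ring

/-- integrand for the phase -/
def Fph (A : MF n) (s : ℝ) (x : En n) : ℝ := (Gm (s • A x) * A x).trace

lemma smul_cj (s : ℝ) (Q : Matrix (Fin n) (Fin n) ℝ) (d : Fin n → ℝ) : s • cj Q d = cj Q (fun i => s * d i) := by
  ext i j
  rw [Matrix.smul_apply, cj_apply, cj_apply, smul_eq_mul, Finset.mul_sum]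
  exact Finset.sum_congr rfl fun a _ => by ring

lemma Fph_eig {s : ℝ} {x : En n} {Q : Matrix (Fin n) (Fin n) ℝ} {l : Fin n → ℝ} (h1 : Q * Qᵀ = 1) (h2 : Qᵀ * Q = 1)
    (hx : A x = cj Q l) : Fph A s x = ∑ i, l i / (1 + (s * l i) ^ 2) := by
  rw [Fph, hx, smul_cj, Gm_cj h1 h2, cj_mul h2, cj_trace h2]
  exact Finset.sum_congr rfl fun i _ => by rw [div_eq_inv_mul, sq]

lemma SmM.smul_const (hA : SmM A) (s : ℝ) : SmM (fun x => s • A x) := fun i j => contDiff_const.mul (hA i j)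

lemma pdm_smul_const (hA : SmM A) (s : ℝ) (k : Fin n) (x : En n) : pdm k (fun x => s • A x) x = s • pdm k A x := by
  ext i j
  exact pdrv_const_mul k s ((hA i j).diff x)

lemma Fph_sm (hA : SmM A) (hs : ∀ x, (A x)ᵀ = A x) (s : ℝ) : Sm (Fph A s) :=
  ((smG_of (hA.smul_const s) fun x => by rw [transpose_smul, hs]).mul hA).trace

lemma Fph_pd (hA : SmM A) (hs : ∀ x, (A x)ᵀ = A x) {s : ℝ} {x : En n} {Q : Matrix (Fin n) (Fin n) ℝ} {l : Fin n → ℝ}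
    (h1 : Q * Qᵀ = 1) (h2 : Qᵀ * Q = 1) (hx : A x = cj Q l) (k : Fin n) :
    pdrv n k (Fph A s) x = ∑ i, (1 - (s * l i) ^ 2) / (1 + (s * l i) ^ 2) ^ 2 * (Qᵀ * pdm k A x * Q) i i := by
  have hs' : ∀ x, (s • A x)ᵀ = s • A x := fun x => by rw [transpose_smul, hs]
  have sG := smG_of (hA.smul_const s) hs'
  have e : pdrv n k (Fph A s) x = _ := pdrv_trace (sG.mul hA) k x
  rw [e, pdm_mul sG hA, pdG_of (hA.smul_const s) hs', pdm_smul_const hA]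
  set B := pdm k A x
  have eG : Gm (s • A x) = cj Q (fun i => (1 + (s * l i) * (s * l i))⁻¹) := by rw [hx, smul_cj, Gm_cj h1 h2]
  have t1 : (Gm (s • A x) * s • B * (s • A x * Gm (s • A x)) * A x).trace
      = (cj Q (fun i => s * (s * l i) * (1 + (s * l i) * (s * l i))⁻¹ * l i * (1 + (s * l i) * (s * l i))⁻¹) * B).trace := by
    rw [eG, hx, smul_cj]
    rw [Matrix.mul_smul, Matrix.smul_mul, Matrix.smul_mul, trace_smul, Matrix.mul_assoc, Matrix.mul_assoc, Matrix.trace_mul_comm,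
      Matrix.mul_assoc, Matrix.trace_mul_comm, cj_mul h2, cj_mul h2, cj_mul h2, ← trace_smul, ← Matrix.smul_mul, smul_cj]
    congr 3; ext i; ring
  have t2 : (Gm (s • A x) * s • A x * s • B * Gm (s • A x) * A x).trace
      = (cj Q (fun i => s * (s * l i) * (1 + (s * l i) * (s * l i))⁻¹ * l i * (1 + (s * l i) * (s * l i))⁻¹) * B).trace := by
    rw [eG, hx, smul_cj]
    rw [Matrix.mul_smul, Matrix.smul_mul, Matrix.smul_mul, trace_smul, cj_mul h2, Matrix.mul_assoc, Matrix.mul_assoc,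
      Matrix.trace_mul_comm, Matrix.mul_assoc, Matrix.trace_mul_comm, cj_mul h2, cj_mul h2, ← trace_smul, ← Matrix.smul_mul, smul_cj]
    congr 3; ext i; ring
  rw [trace_add, Matrix.neg_mul, trace_neg, Matrix.add_mul, trace_add, t1, t2, eG, tr_cj, tr_cj, ← Finset.sum_add_distrib,
    ← Finset.sum_neg_distrib, ← Finset.sum_add_distrib]
  refine Finset.sum_congr rfl fun i _ => ?_
  have : (1 + s * l i * (s * l i)) ≠ 0 := by nlinarith [mul_self_nonneg (s * l i)]
  have : (1 + (s * l i) ^ 2) ≠ 0 := by positivity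
  field_simp
  ring

lemma diag_bd {Q B : Matrix (Fin n) (Fin n) ℝ} (h2 : Qᵀ * Q = 1) (i : Fin n) :
    |(Qᵀ * B * Q) i i| ≤ ∑ a, ∑ b, |B a b| := by
  have hq : ∀ a, |Q a i| ≤ 1 := fun a => by
    have := congrFun (congrFun h2 i) i
    rw [Matrix.mul_apply, one_apply_eq] at this
    simp only [transpose_apply] at this
    have k := Finset.single_le_sum (f := fun a => Q a i * Q a i) (fun a _ => mul_self_nonneg _) (Finset.mem_univ a)
    rw [this] at k
    exact abs_le_one_iff_mul_self_le_one.2 k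
  have e : (Qᵀ * B * Q) i i = ∑ a, ∑ b, Q a i * B a b * Q b i := by
    rw [Matrix.mul_assoc, Matrix.mul_apply]
    refine Finset.sum_congr rfl fun a _ => ?_
    rw [Matrix.mul_apply, Finset.mul_sum]
    exact Finset.sum_congr rfl fun b _ => by rw [transpose_apply]; ring
  rw [e]
  refine (Finset.abs_sum_le_sum_abs _ _).trans (Finset.sum_le_sum fun a _ => ?_)
  refine (Finset.abs_sum_le_sum_abs _ _).trans (Finset.sum_le_sum fun b _ => ?_)
  rw [abs_mul, abs_mul]
  have h1 := hq a
  have h2 := hq b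
  calc |Q a i| * |B a b| * |Q b i| ≤ 1 * |B a b| * 1 := by gcongr
    _ = _ := by ring

lemma int1 (l : ℝ) : ∫ s in (0:ℝ)..1, l / (1 + (s * l) ^ 2) = arctan l := by
  have hd : ∀ s ∈ Set.uIcc (0:ℝ) 1, HasDerivAt (fun s => arctan (s * l)) (l / (1 + (s * l) ^ 2)) s := fun s _ => by
    have := (hasDerivAt_id s).mul_const l |>.arctan
    exact this.congr_deriv (by change 1 / (1 + (s * l) ^ 2) * (1 * l) = _; ring)
  rw [intervalIntegral.integral_eq_sub_of_hasDerivAt hd]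
  · simp
  · refine Continuous.intervalIntegrable ?_ _ _
    exact continuous_const.div (by fun_prop) fun s => by positivity

lemma int2 (l : ℝ) : ∫ s in (0:ℝ)..1, (1 - (s * l) ^ 2) / (1 + (s * l) ^ 2) ^ 2 = (1 + l * l)⁻¹ := by
  have hd : ∀ s ∈ Set.uIcc (0:ℝ) 1, HasDerivAt (fun s => s / (1 + (s * l) ^ 2)) ((1 - (s * l) ^ 2) / (1 + (s * l) ^ 2) ^ 2) s := fun s _ => by
    have h1 : HasDerivAt (fun s : ℝ => 1 + (s * l) ^ 2) (2 * (s * l) * l) s := by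
      have := (((hasDerivAt_id s).mul_const l).pow 2).const_add 1
      simpa using this
    have := (hasDerivAt_id s).div h1 (by positivity)
    exact this.congr_deriv (by
      change (1 * (1 + (s * l) ^ 2) - s * (2 * (s * l) * l)) / (1 + (s * l) ^ 2) ^ 2 = _
      congr 1; ring)
  rw [intervalIntegral.integral_eq_sub_of_hasDerivAt hd]
  · simp [sq]
  · refine Continuous.intervalIntegrable ?_ _ _
    exact Continuous.div (by fun_prop) (by fun_prop) fun s => by positivity

/-- phase as an integral -/
def Th (A : MF n) (x : En n) : ℝ := ∫ s in (0:ℝ)..1, Fph A s x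

lemma c1 (l : ℝ) : Continuous fun s : ℝ => l / (1 + (s * l) ^ 2) :=
  continuous_const.div (by fun_prop) fun s => by positivity
lemma c2 (l : ℝ) : Continuous fun s : ℝ => (1 - (s * l) ^ 2) / (1 + (s * l) ^ 2) ^ 2 :=
  Continuous.div (by fun_prop) (by fun_prop) fun s => by positivity

lemma Fph_cont (hs : ∀ x, (A x)ᵀ = A x) (x : En n) : Continuous fun s => Fph A s x := by
  obtain ⟨Q, l, h1, h2, h3⟩ := spec' (hs x)
  have : (fun s => Fph A s x) = fun s => ∑ i, l i / (1 + (s * l i) ^ 2) := funext fun s => Fph_eig h1 h2 h3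
  rw [this]
  exact continuous_finsetSum _ fun i _ => c1 _

lemma Fph_pd_cont (hA : SmM A) (hs : ∀ x, (A x)ᵀ = A x) (k : Fin n) (x : En n) : Continuous fun s => pdrv n k (Fph A s) x := by
  obtain ⟨Q, l, h1, h2, h3⟩ := spec' (hs x)
  have : (fun s => pdrv n k (Fph A s) x) = _ := funext fun s => Fph_pd hA hs h1 h2 h3 k
  rw [this]
  exact continuous_finsetSum _ fun i _ => (c2 _).mul continuous_const

lemma Th_eq (hs : ∀ x, (A x).IsHermitian) (x : En n) : Th A x = ∑ i, arctan ((hs x).eigenvalues i) := by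
  obtain ⟨Q, h1, h2, h3⟩ := spec (hs x)
  have : (fun s => Fph A s x) = _ := funext fun s => Fph_eig h1 h2 h3
  rw [Th, this, intervalIntegral.integral_finsetSum fun i _ => (c1 _).intervalIntegrable _ _]
  exact Finset.sum_congr rfl fun i _ => int1 _

lemma Fph_fd_norm (hA : SmM A) (hs : ∀ x, (A x)ᵀ = A x) (s : ℝ) (x : En n) :
    ‖fderiv ℝ (Fph A s) x‖ ≤ ∑ k, n * ∑ a, ∑ b, |pdm k A x a b| := by
  obtain ⟨Q, l, h1, h2, h3⟩ := spec' (hs x)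
  refine ContinuousLinearMap.opNorm_le_bound _ (Finset.sum_nonneg fun k _ => by positivity) fun v => ?_
  rw [fderiv_eq_sum, Finset.sum_mul]
  refine (norm_sum_le _ _).trans (Finset.sum_le_sum fun k _ => ?_)
  rw [norm_mul, mul_comm]
  have hv : ‖v k‖ ≤ ‖v‖ := PiLp.norm_apply_le v k
  refine mul_le_mul ?_ hv (norm_nonneg _) (by positivity)
  rw [Fph_pd hA hs h1 h2 h3]
  refine (norm_sum_le _ _).trans ?_
  have : ∀ i ∈ (Finset.univ : Finset (Fin n)), ‖(1 - (s * l i) ^ 2) / (1 + (s * l i) ^ 2) ^ 2 * (Qᵀ * pdm k A x * Q) i i‖ ≤ ∑ a, ∑ b, |pdm k A x a b| := by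
    intro i _
    rw [norm_mul, Real.norm_eq_abs, Real.norm_eq_abs]
    have := diag_bd (B := pdm k A x) h2 i
    have h4 : |(1 - (s * l i) ^ 2) / (1 + (s * l i) ^ 2) ^ 2| ≤ 1 := by
      rw [abs_div, abs_of_pos (by positivity : 0 < (1 + (s * l i) ^ 2) ^ 2), div_le_one (by positivity), abs_le]
      constructor <;> nlinarith [sq_nonneg (s * l i)]
    calc _ ≤ 1 * ∑ a, ∑ b, |pdm k A x a b| := by gcongr
      _ = _ := one_mul _
  refine (Finset.sum_le_card_nsmul _ _ _ this).trans ?_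
  simp

lemma fd_eq_sum_clm (f : En n → ℝ) (x : En n) :
    fderiv ℝ f x = ∑ k, pdrv n k f x • (EuclideanSpace.proj k : En n →L[ℝ] ℝ) := by
  ext v
  rw [fderiv_eq_sum]
  simp [mul_comm]

lemma Th_hasFD (hA : SmM A) (hs : ∀ x, (A x)ᵀ = A x) (x : En n) :
    HasFDerivAt (Th A) (∫ s in (0:ℝ)..1, fderiv ℝ (Fph A s) x) x := by
  have cS : Continuous fun x => ∑ k, n * ∑ a, ∑ b, |pdm k A x a b| := by
    refine continuous_finsetSum _ fun k _ => continuous_const.mul (continuous_finsetSum _ fun a _ => continuous_finsetSum _ fun b _ => ?_)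
    exact (hA.pd k a b).continuous.abs
  obtain ⟨C, hC⟩ := (isCompact_closedBall x 1).exists_bound_of_continuousOn cS.continuousOn
  refine intervalIntegral.hasFDerivAt_integral_of_dominated_of_fderiv_le (F := fun x s => Fph A s x)
    (F' := fun x s => fderiv ℝ (Fph A s) x) (bound := fun _ => C) (closedBall_mem_nhds x zero_lt_one) ?_ ?_ ?_ ?_ ?_ ?_
  · exact Filter.Eventually.of_forall fun y => (Fph_cont hs y).aestronglyMeasurable
  · exact (Fph_cont hs x).intervalIntegrable _ _
  · refine Continuous.aestronglyMeasurable ?_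
    simp only [fd_eq_sum_clm]
    exact continuous_finsetSum _ fun k _ => (Fph_pd_cont hA hs k x).smul continuous_const
  · refine Filter.Eventually.of_forall fun s _ y hy => ?_
    exact (Fph_fd_norm hA hs s y).trans ((le_abs_self _).trans (hC y hy))
  · exact intervalIntegrable_const
  · exact Filter.Eventually.of_forall fun s _ y hy => ((Fph_sm hA hs s).diff y).hasFDerivAt

lemma Th_pd (hA : SmM A) (hs : ∀ x, (A x)ᵀ = A x) (k : Fin n) (x : En n) :
    pdrv n k (Th A) x = (Gm (A x) * pdm k A x).trace := by
  obtain ⟨Q, l, h1, h2, h3⟩ := spec' (hs x)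
  have cF : Continuous fun s => fderiv ℝ (Fph A s) x := by
    simp only [fd_eq_sum_clm]
    exact continuous_finsetSum _ fun k _ => (Fph_pd_cont hA hs k x).smul continuous_const
  rw [pdrv, (Th_hasFD hA hs x).fderiv, ContinuousLinearMap.intervalIntegral_apply (cF.intervalIntegrable _ _)]
  have ii : ∀ i ∈ Finset.univ, IntervalIntegrable (fun s => (1 - (s * l i) ^ 2) / (1 + (s * l i) ^ 2) ^ 2 * (Qᵀ * pdm k A x * Q) i i) volume 0 1 :=
    fun i _ => ((c2 _).mul continuous_const).intervalIntegrable _ _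
  have : (fun s => fderiv ℝ (Fph A s) x (EuclideanSpace.single k 1)) = _ := funext fun s => Fph_pd hA hs h1 h2 h3 k
  rw [this, intervalIntegral.integral_finsetSum ii,
    h3, Gm_cj h1 h2, tr_cj]
  refine Finset.sum_congr rfl fun i _ => ?_
  rw [intervalIntegral.integral_mul_const, int2]

lemma Th_sm (hA : SmM A) (hs : ∀ x, (A x)ᵀ = A x) : Sm (Th A) := by
  refine contDiff_infty_iff_fderiv.2 ⟨fun x => (Th_hasFD hA hs x).differentiableAt, ?_⟩
  have : (fun x => fderiv ℝ (Th A) x) = fun x => ∑ k, (Gm (A x) * pdm k A x).trace • (EuclideanSpace.proj k : En n →L[ℝ] ℝ) := by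
    ext1 x
    rw [fd_eq_sum_clm]
    simp only [Th_pd hA hs]
  change ContDiff ℝ ∞ (fun x => fderiv ℝ (Th A) x)
  rw [this]
  exact ContDiff.sum fun k _ => (((smG_of hA hs).mul (hA.pd k)).trace).smul contDiff_const

lemma Th_bd (hs : ∀ x, (A x)ᵀ = A x) (x : En n) : |Th A x| ≤ n * (π / 2) := by
  rw [Th_eq (fun x => isHerm_of (hs x))]
  refine (Finset.abs_sum_le_sum_abs _ _).trans ((Finset.sum_le_card_nsmul _ _ (π / 2) fun i _ => ?_).trans ?_)
  · exact abs_le.2 ⟨(neg_pi_div_two_lt_arctan _).le, (arctan_lt_pi_div_two _).le⟩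
  · simp

end P15

section P16
open scoped ContDiff
variable {n : ℕ} {P : Matrix (Fin n) (Fin n) ℝ}

/-- symmetric and positive -/
structure SP (P : Matrix (Fin n) (Fin n) ℝ) : Prop where
  symm : Pᵀ = P
  pos : ∀ ξ : Fin n → ℝ, 0 ≤ ξ ⬝ᵥ P *ᵥ ξ

lemma SP.eig {Q : Matrix (Fin n) (Fin n) ℝ} {μ : Fin n → ℝ} (h2 : Qᵀ * Q = 1)
    (h : SP (cj Q μ)) (i : Fin n) : 0 ≤ μ i := by
  have e : cj Q μ *ᵥ (fun j => Q j i) = μ i • fun j => Q j i := by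
    have : (fun j => Q j i) = Q *ᵥ (Pi.single i 1) := by ext j; simp
    rw [this, cj, mulVec_mulVec, Matrix.mul_assoc, Matrix.mul_assoc, h2, Matrix.mul_one, ← mulVec_mulVec]
    ext j
    simp [mulVec_single, diagonal_apply, mulVec, dotProduct, Pi.single_apply, mul_comm]
  have := h.pos (fun j => Q j i)
  rw [e, dotProduct_smul, smul_eq_mul] at this
  have k : (fun j => Q j i) ⬝ᵥ (fun j => Q j i) = 1 := by
    have := congrFun (congrFun h2 i) i
    rw [Matrix.mul_apply, one_apply_eq] at this
    exact this
  rwa [k, mul_one] at this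

lemma SP.det_pos (h : SP P) : 0 < (1 + P).det := by
  obtain ⟨Q, l, h1, h2, rfl⟩ := spec' h.symm
  rw [← cj_one h1, cj_add, cj_det h1]
  exact Finset.prod_pos fun i _ => by linarith [h.eig h2 i]

lemma SP.inv_mul (h : SP P) : (1 + P)⁻¹ * (1 + P) = 1 :=
  nonsing_inv_mul _ (isUnit_iff_ne_zero.2 h.det_pos.ne')

lemma SP.mul_inv (h : SP P) : (1 + P) * (1 + P)⁻¹ = 1 :=
  mul_nonsing_inv _ (isUnit_iff_ne_zero.2 h.det_pos.ne')

lemma SP.inv_symm (h : SP P) : ((1 + P)⁻¹)ᵀ = (1 + P)⁻¹ := by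
  rw [transpose_nonsing_inv, transpose_add, transpose_one, h.symm]

/-- rotated matrix -/
def ro (Y : Matrix (Fin n) (Fin n) ℝ) : Matrix (Fin n) (Fin n) ℝ := 1 + (-2:ℝ) • Y

lemma SP.ro_sc (h : SP P) : SC (ro (1 + P)⁻¹) where
  symm := by rw [ro, transpose_add, transpose_one, transpose_smul, h.inv_symm]
  con ξ := by
    set η := (1 + P)⁻¹ *ᵥ ξ with hη
    have e1 : ξ = η + P *ᵥ η := by
      have : (1 + P) *ᵥ η = ξ := by rw [hη, mulVec_mulVec, h.mul_inv, one_mulVec]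
      rw [← this, add_mulVec, one_mulVec]
    have e2 : ro (1 + P)⁻¹ *ᵥ ξ = P *ᵥ η - η := by
      rw [ro, add_mulVec, one_mulVec, smul_mulVec, ← hη]
      nth_rewrite 1 [e1]
      ext i; simp; ring
    have := h.pos η
    have e3 : ξ ⬝ᵥ ξ = (η + P *ᵥ η) ⬝ᵥ (η + P *ᵥ η) := by rw [← e1]
    rw [e2, e3]
    simp only [dotProduct_add, add_dotProduct, sub_dotProduct, dotProduct_sub]
    rw [dotProduct_comm (P *ᵥ η) η]
    linarith

lemma ro_cj {Q : Matrix (Fin n) (Fin n) ℝ} {l : Fin n → ℝ} (h1 : Q * Qᵀ = 1) (h2 : Qᵀ * Q = 1) (hl : ∀ i, 0 ≤ l i) :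
    ro (1 + cj Q l)⁻¹ = cj Q (fun i => (l i - 1) / (l i + 1)) := by
  rw [← cj_one h1, cj_add, cj_inv h1 h2 (fun i => by linarith [hl i]), ro, smul_cj, ← cj_one h1, cj_add]
  congr 1; ext i
  have : l i + 1 ≠ 0 := by linarith [hl i]
  have : 1 + l i ≠ 0 := by linarith [hl i]
  field_simp; ring

lemma SP.ro_G (h : SP P) : (1 + P)⁻¹ * Gm (ro (1 + P)⁻¹) * (1 + P)⁻¹ = (2⁻¹:ℝ) • Gm P := by
  obtain ⟨Q, l, h1, h2, rfl⟩ := spec' h.symm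
  have hl := h.eig h2
  rw [ro_cj h1 h2 hl, Gm_cj h1 h2, Gm_cj h1 h2, ← cj_one h1, cj_add, cj_inv h1 h2 (fun i => by linarith [hl i]), cj_mul h2, cj_mul h2, smul_cj]
  congr 1; ext i
  have a1 : l i + 1 ≠ 0 := by linarith [hl i]
  have a2 : 1 + l i ≠ 0 := by linarith [hl i]
  have a3 : 1 + l i * l i ≠ 0 := by nlinarith [hl i]
  have a4 : 1 + (l i - 1) / (l i + 1) * ((l i - 1) / (l i + 1)) = 2 * (1 + l i * l i) / (1 + l i) ^ 2 := by
    field_simp; ring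
  rw [a4]
  field_simp

lemma SP.ro_om (h : SP P) : om (ro (1 + P)⁻¹) * (1 + P).det = √(2 ^ n) * om P := by
  have dp := h.det_pos
  have hs := h.ro_sc.symm
  have key : (om (ro (1 + P)⁻¹) * (1 + P).det) ^ 2 = (√(2 ^ n) * om P) ^ 2 := by
    rw [mul_pow, mul_pow, om_sq hs, om_sq h.symm, Real.sq_sqrt (by positivity)]
    obtain ⟨Q, l, h1, h2, rfl⟩ := spec' h.symm
    have hl := h.eig h2
    rw [ro_cj h1 h2 hl, one_add_sq_cj h1 h2, one_add_sq_cj h1 h2, ← cj_one h1, cj_add, cj_det h1, cj_det h1, cj_det h1]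
    have : (2:ℝ) ^ n = ∏ i : Fin n, 2 := by simp
    rw [this, ← Finset.prod_pow, ← Finset.prod_mul_distrib, ← Finset.prod_mul_distrib]
    refine Finset.prod_congr rfl fun i _ => ?_
    have a1 : l i + 1 ≠ 0 := by linarith [hl i]
    field_simp; ring
  have o1 := om_ge hs
  have o2 := om_ge h.symm
  exact (pow_left_inj₀ (by positivity) (by positivity) two_ne_zero).1 key

lemma SP.ro_bil (h : SP P) (ξ η : Fin n → ℝ) :
    (1 + P).det * bil (am (ro (1 + P)⁻¹)) ξ η = √(2 ^ n) * 2⁻¹ * bil (am P) ((1 + P) *ᵥ ξ) ((1 + P) *ᵥ η) := by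
  have e : Gm (ro (1 + P)⁻¹) = (1 + P) * ((2⁻¹:ℝ) • Gm P) * (1 + P) := by
    rw [← h.ro_G]
    calc Gm (ro (1 + P)⁻¹) = ((1 + P) * (1 + P)⁻¹) * Gm (ro (1 + P)⁻¹) * ((1 + P)⁻¹ * (1 + P)) := by
          rw [h.mul_inv, h.inv_mul]; simp
      _ = _ := by simp only [Matrix.mul_assoc]
  have hs : (1 + P)ᵀ = 1 + P := by rw [transpose_add, transpose_one, h.symm]
  rw [bil_am, bil_am, ← mul_assoc, mul_comm (det _), h.ro_om, e]
  have : bil ((1 + P) * ((2⁻¹:ℝ) • Gm P) * (1 + P)) ξ η = 2⁻¹ * bil (Gm P) ((1 + P) *ᵥ ξ) ((1 + P) *ᵥ η) := by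
    unfold bil
    rw [mul_dot_symm hs, ← mulVec_mulVec, ← mulVec_mulVec, smul_mulVec, mulVec_smul, dotProduct_smul, smul_eq_mul]
  rw [this]; ring

end P16

section P17
open scoped ContDiff
variable {n : ℕ} {A : MF n} {g : Fin n → En n → ℝ}

/-- gradient data of a convex function -/
structure HU (g : Fin n → En n → ℝ) (A : MF n) : Prop where
  sm : ∀ i, Sm (g i)
  pd : ∀ i j x, pdrv n j (g i) x = A x i j
  sp : ∀ x, SP (A x)

lemma HU.smA (h : HU g A) : SmM A := fun i j => by
  have : (fun x => A x i j) = fun x => pdrv n j (g i) x := funext fun x => (h.pd i j x).symm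
  rw [this]; exact (h.sm i).pd j

/-- the rotation map -/
def TT (g : Fin n → En n → ℝ) (x : En n) : En n := WithLp.toLp 2 (fun i => x i + g i x)

lemma HU.smT (h : HU g A) (i : Fin n) : Sm (fun x => TT g x i) := (sm_coord i).add (h.sm i)

lemma HU.pdT (h : HU g A) (i j : Fin n) (x : En n) : pdrv n j (fun x => TT g x i) x = (1 + A x) i j := by
  have : pdrv n j (fun x => TT g x i) x = _ := pdrv_add j ((sm_coord i).diff x) ((h.sm i).diff x)
  rw [this, pdrv_coord, h.pd, Matrix.add_apply, one_apply]
  simp only [eq_comm]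

lemma HU.cdT (h : HU g A) : ContDiff ℝ ∞ (TT g) := contDiff_euclidean.2 h.smT

lemma fderiv_coord {S : En n → En n} (hS : ContDiff ℝ ∞ S) (x v : En n) (i : Fin n) :
    (fderiv ℝ S x v) i = fderiv ℝ (fun y => S y i) x v := by
  have h1 := (hS.differentiable (by simp) x).hasFDerivAt
  have h2 := ((EuclideanSpace.proj i : En n →L[ℝ] ℝ).hasFDerivAt (x := S x)).comp x h1
  have h3 : fderiv ℝ (fun y => S y i) x = (EuclideanSpace.proj i : En n →L[ℝ] ℝ).comp (fderiv ℝ S x) := h2.fderiv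
  rw [h3]; rfl

lemma pdrv_chain {S : En n → En n} (hS : ContDiff ℝ ∞ S) {f : En n → ℝ} (hf : Sm f) (j : Fin n) (x : En n) :
    pdrv n j (fun y => f (S y)) x = ∑ k, pdrv n j (fun y => S y k) x * pdrv n k f (S x) := by
  have h1 := (hS.differentiable (by simp) x).hasFDerivAt
  have h2 := ((hf.diff (S x)).hasFDerivAt).comp x h1
  have h3 : fderiv ℝ (fun y => f (S y)) x = (fderiv ℝ f (S x)).comp (fderiv ℝ S x) := h2.fderiv
  rw [pdrv, h3, ContinuousLinearMap.comp_apply, fderiv_eq_sum]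
  refine Finset.sum_congr rfl fun k _ => ?_
  rw [fderiv_coord hS]; rfl

lemma HU.fdT (h : HU g A) (x v : En n) (i : Fin n) : (fderiv ℝ (TT g) x v) i = ((1 + A x) *ᵥ v.ofLp) i := by
  rw [fderiv_coord h.cdT, fderiv_eq_sum]
  simp only [mulVec, dotProduct]
  exact Finset.sum_congr rfl fun k _ => by rw [h.pdT, mul_comm]

lemma SP.dot_ge {P : Matrix (Fin n) (Fin n) ℝ} (h : SP P) (v : Fin n → ℝ) : v ⬝ᵥ v ≤ v ⬝ᵥ (1 + P) *ᵥ v := by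
  rw [add_mulVec, one_mulVec, dotProduct_add]; linarith [h.pos v]

lemma HU.mono (h : HU g A) (x y : En n) : ‖x - y‖ ^ 2 ≤ (x - y).ofLp ⬝ᵥ (TT g x - TT g y).ofLp := by
  set v := x - y with hv
  have hd : ∀ t : ℝ, HasDerivAt (fun t : ℝ => ∑ i, v i * (TT g (y + t • v) i) - t * ‖v‖ ^ 2)
      (v.ofLp ⬝ᵥ ((1 + A (y + t • v)) *ᵥ v.ofLp) - 1 * ‖v‖ ^ 2) t := fun t => by
    refine HasDerivAt.sub ?_ ((hasDerivAt_id t).mul_const _)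
    simp only [dotProduct]
    refine HasDerivAt.fun_sum fun i _ => HasDerivAt.const_mul _ ?_
    have a := ((h.smT i).diff (y + t • v)).hasFDerivAt
    have b : HasDerivAt (fun t : ℝ => y + t • v) ((1:ℝ) • v) t := ((hasDerivAt_id t).smul_const v).const_add y
    rw [one_smul] at b
    have := a.comp_hasDerivAt t b
    rw [← fderiv_coord h.cdT, h.fdT] at this
    exact this
  obtain ⟨c, hc, hs⟩ := exists_hasDerivAt_eq_slope _ _ (zero_lt_one (α := ℝ))
    (fun t _ => (hd t).continuousAt.continuousWithinAt) (fun t _ => hd t)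
  have h1 := (h.sp (y + c • v)).dot_ge v.ofLp
  rw [← norm_sq_dot] at h1
  have e1 : y + (1:ℝ) • v = x := by rw [hv]; simp
  have e0 : y + (0:ℝ) • v = y := by simp
  rw [e1, e0] at hs
  have e2 : v.ofLp ⬝ᵥ (TT g x - TT g y).ofLp = ∑ i, v i * TT g x i - ∑ i, v i * TT g y i := by
    simp only [dotProduct, WithLp.ofLp_sub, Pi.sub_apply, mul_sub, Finset.sum_sub_distrib]
  rw [e2]
  linarith

lemma HU.expand (h : HU g A) (x y : En n) : ‖x - y‖ ≤ ‖TT g x - TT g y‖ := by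
  have h1 := h.mono x y
  have h2 : (x - y).ofLp ⬝ᵥ (TT g x - TT g y).ofLp ≤ ‖x - y‖ * ‖TT g x - TT g y‖ := by
    have := real_inner_le_norm (TT g x - TT g y) (x - y)
    rw [EuclideanSpace.inner_eq_star_dotProduct] at this
    simpa [mul_comm] using this
  rcases (norm_nonneg (x - y)).eq_or_lt with h3 | h3
  · rw [← h3]; positivity
  · nlinarith

lemma HU.inj (h : HU g A) : Function.Injective (TT g) := fun x y e => by
  have := h.expand x y
  rw [e, sub_self, norm_zero] at this
  exact sub_eq_zero.1 (norm_le_zero_iff.1 this)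

lemma HU.surj (h : HU g A) : Function.Surjective (TT g) := fun z => by
  have cont : Continuous fun x => ‖TT g x - z‖ := (h.cdT.continuous.sub continuous_const).norm
  have tends : Filter.Tendsto (fun x => ‖TT g x - z‖) (Filter.cocompact (En n)) Filter.atTop := by
    refine Filter.tendsto_atTop_mono (f := fun x => ‖x‖ - ‖TT g 0 - z‖) (fun x => ?_)
      (Filter.tendsto_atTop_add_const_right _ _ tendsto_norm_cocompact_atTop)
    have h1 := h.expand x 0
    rw [sub_zero] at h1
    have h2 : ‖TT g x - TT g 0‖ ≤ ‖TT g x - z‖ + ‖TT g 0 - z‖ := by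
      have := norm_sub_le (TT g x - z) (TT g 0 - z)
      simpa using this
    linarith
  obtain ⟨x, hx⟩ := cont.exists_forall_le tends
  refine ⟨x, ?_⟩
  have hN : ∀ y, ‖TT g y - z‖ ^ 2 = ∑ i, (TT g y i - z i) * (TT g y i - z i) := fun y => by
    rw [euc_norm_sq]; simp
  have sm1 : ∀ i, Sm (fun y => TT g y i - z i) := fun i => (h.smT i).sub contDiff_const
  have hm : IsLocalMin (fun y => ∑ i, (TT g y i - z i) * (TT g y i - z i)) x := Filter.Eventually.of_forall fun y => by
    change ∑ i, (TT g x i - z i) * (TT g x i - z i) ≤ ∑ i, (TT g y i - z i) * (TT g y i - z i)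
    rw [← hN, ← hN]
    exact pow_le_pow_left₀ (norm_nonneg _) (hx y) 2
  have h0 := hm.fderiv_eq_zero
  set w : Fin n → ℝ := fun i => TT g x i - z i with hw
  have hj : ∀ j, ((1 + A x) *ᵥ w) j = 0 := fun j => by
    have : pdrv n j (fun y => ∑ i, (TT g y i - z i) * (TT g y i - z i)) x = 0 := by rw [pdrv, h0]; rfl
    rw [pdrv_sum _ _ fun i _ => ((sm1 i).mul (sm1 i)).differentiable (by simp) x] at this
    have e : ∀ i, pdrv n j (fun y => (TT g y i - z i) * (TT g y i - z i)) x = 2 * ((1 + A x) j i * w i) := fun i => by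
      rw [pdrv_mul j ((sm1 i).diff x) ((sm1 i).diff x), pdrv_sub j ((h.smT i).diff x) (by fun_prop), pdrv_const, h.pdT]
      have : (1 + A x) i j = (1 + A x) j i := by
        have : (1 + A x)ᵀ = 1 + A x := by rw [transpose_add, transpose_one, (h.sp x).symm]
        exact congrFun (congrFun this j) i
      rw [this]; ring
    simp only [e] at this
    rw [← Finset.mul_sum] at this
    exact (mul_eq_zero.1 this).resolve_left two_ne_zero
  have h1 := (h.sp x).dot_ge w
  rw [show (1 + A x) *ᵥ w = 0 from funext hj, dotProduct_zero] at h1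
  have hw0 : w = 0 := dotProduct_self_eq_zero.1 (le_antisymm h1 (dot_self_nonneg' w))
  ext i
  have := congrFun hw0 i
  exact sub_eq_zero.1 this

/-- the rotation homeomorphism -/
def HU.homeo (h : HU g A) : En n ≃ₜ En n where
  toEquiv := Equiv.ofBijective (TT g) ⟨h.inj, h.surj⟩
  continuous_toFun := h.cdT.continuous
  continuous_invFun := by
    refine (LipschitzWith.of_dist_le_mul (K := 1) fun x y => ?_).continuous
    have := h.expand ((Equiv.ofBijective (TT g) ⟨h.inj, h.surj⟩).symm x) ((Equiv.ofBijective (TT g) ⟨h.inj, h.surj⟩).symm y)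
    rw [Equiv.ofBijective_apply_symm_apply (TT g) ⟨h.inj, h.surj⟩ x, Equiv.ofBijective_apply_symm_apply (TT g) ⟨h.inj, h.surj⟩ y] at this
    rw [dist_eq_norm, dist_eq_norm, NNReal.coe_one, one_mul]
    exact this

lemma HU.homeo_apply (h : HU g A) (x : En n) : h.homeo x = TT g x := rfl

lemma HU.TS (h : HU g A) (z : En n) : TT g (h.homeo.symm z) = z := h.homeo.apply_symm_apply z
lemma HU.ST (h : HU g A) (x : En n) : h.homeo.symm (TT g x) = x := h.homeo.symm_apply_apply x

lemma HU.fd_inj (h : HU g A) (x : En n) : Function.Injective (fderiv ℝ (TT g) x) := by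
  refine (injective_iff_map_eq_zero _).2 fun v hv => ?_
  have h1 := (h.sp x).dot_ge v.ofLp
  have : (1 + A x) *ᵥ v.ofLp = 0 := by
    ext i; rw [← h.fdT, hv]; rfl
  rw [this, dotProduct_zero, ← norm_sq_dot] at h1
  have : ‖v‖ ^ 2 = 0 := le_antisymm h1 (sq_nonneg _)
  exact norm_eq_zero.1 (pow_eq_zero_iff two_ne_zero |>.1 this)

lemma HU.cdS (h : HU g A) : ContDiff ℝ ∞ h.homeo.symm := by
  refine h.homeo.contDiff_symm (f₀' := fun x =>
    (LinearEquiv.ofInjectiveEndo (fderiv ℝ (TT g) x : En n →ₗ[ℝ] En n) (h.fd_inj x)).toContinuousLinearEquiv) (fun x => ?_) h.cdT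
  have := (h.cdT.differentiable (by simp) x).hasFDerivAt
  exact this

lemma HU.smS (h : HU g A) (i : Fin n) : Sm (fun z => h.homeo.symm z i) := contDiff_euclidean.1 h.cdS i

/-- derivative of the inverse -/
def YY (A : MF n) (S : En n → En n) : MF n := fun z => (1 + A (S z))⁻¹

lemma HU.pdS (h : HU g A) (i j : Fin n) (z : En n) : pdrv n j (fun z => h.homeo.symm z i) z = YY A h.homeo.symm z i j := by
  set S := h.homeo.symm with hS
  set D : Matrix (Fin n) (Fin n) ℝ := Matrix.of fun i j => pdrv n j (fun z => S z i) z with hD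
  have key : (1 + A (S z)) * D = 1 := by
    ext a b
    have e : (fun y => TT g (S y) a) = fun y => y a := funext fun y => by rw [hS, h.TS]
    have c := pdrv_chain (S := S) h.cdS (h.smT a) b z
    rw [e, pdrv_coord] at c
    rw [Matrix.mul_apply, one_apply]
    simp only [eq_comm (a := a)]
    rw [c]
    refine Finset.sum_congr rfl fun k _ => ?_
    rw [h.pdT, mul_comm]; rfl
  have : D = (1 + A (S z))⁻¹ := by
    calc D = (1 + A (S z))⁻¹ * (1 + A (S z)) * D := by rw [(h.sp _).inv_mul, Matrix.one_mul]
      _ = _ := by rw [Matrix.mul_assoc, key, Matrix.mul_one]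
  exact congrFun (congrFun this i) j

end P17

section P18
open scoped ContDiff
variable {n : ℕ} {A : MF n} {g : Fin n → En n → ℝ}

/-- rotated Hessian -/
def HU.M (h : HU g A) : MF n := fun z => ro (YY A h.homeo.symm z)

lemma HU.smAS (h : HU g A) : SmM (fun z => A (h.homeo.symm z)) := fun i j =>
  ContDiff.comp (h.smA i j) h.cdS

lemma HU.smY (h : HU g A) : SmM (YY A h.homeo.symm) :=
  ((SmM.const 1).add h.smAS).inv fun z => (h.sp _).det_pos.ne'

lemma HU.pdM (h : HU g A) (k : Fin n) (z : En n) : pdm k h.M z = (-2:ℝ) • pdm k (YY A h.homeo.symm) z := by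
  have : pdm k h.M z = _ := pdm_add (SmM.const 1) (h.smY.smul_const (-2)) k z
  rw [this, pdm_const, zero_add, pdm_smul_const h.smY]

lemma HU.lg (h : HU g A) : LG h.M where
  sm := (SmM.const 1).add (h.smY.smul_const (-2))
  sc z := (h.sp _).ro_sc
  tot z i j k := by
    rw [h.pdM, h.pdM, Matrix.smul_apply, Matrix.smul_apply]
    congr 1
    have e : ∀ a b, (fun z => YY A h.homeo.symm z a b) = fun z => pdrv n b (fun z => h.homeo.symm z a) z :=
      fun a b => funext fun z => (h.pdS a b z).symm
    change pdrv n k (fun z => YY A h.homeo.symm z i j) z = pdrv n j (fun z => YY A h.homeo.symm z i k) z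
    rw [e, e]
    exact pdrv_comm (h.smS i)

lemma HU.po (h : HU g A) : PO (fun i z => z i + (-2) * (h.homeo.symm z i - h.homeo.symm 0 i)) h.M where
  sm i := (sm_coord i).add (contDiff_const.mul ((h.smS i).sub contDiff_const))
  zero i := by simp
  pd i j z := by
    have sS := (h.smS i).sub (contDiff_const (c := h.homeo.symm 0 i))
    rw [pdrv_add j ((sm_coord i).diff z) ((contDiff_const.mul sS).differentiable (by simp) z),
      pdrv_const_mul j (-2) (sS.differentiable (by simp) z), pdrv_sub j ((h.smS i).diff z) (by fun_prop), pdrv_const, h.pdS, pdrv_coord]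
    simp [HU.M, ro, one_apply, eq_comm]

lemma HU.grd_comp (h : HU g A) {f : En n → ℝ} (hf : Sm f) (x : En n) :
    grd (fun x => f (TT g x)) x = (1 + A x) *ᵥ grd f (TT g x) := by
  ext j
  have : grd (fun x => f (TT g x)) x j = _ := pdrv_chain h.cdT hf j x
  rw [this]
  refine Finset.sum_congr rfl fun k _ => ?_
  rw [h.pdT]
  have : (1 + A x)ᵀ = 1 + A x := by rw [transpose_add, transpose_one, (h.sp x).symm]
  rw [← congrFun (congrFun this k) j]; rfl

lemma HU.wsol (h : HU g A) {f : En n → ℝ} (hf : Sm f) (hw : WSol (fun x => am (A x)) f) :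
    WSol (fun z => am (h.M z)) (fun z => f (h.homeo.symm z)) := by
  intro φ hφ hc
  have sf : Sm (fun z => f (h.homeo.symm z)) := ContDiff.comp hf h.cdS
  rw [← cov h.smT ⟨h.inj, h.surj⟩]
  have hψ : Sm (fun x => φ (TT g x)) := ContDiff.comp hφ h.cdT
  have hψc : HasCompactSupport (fun x => φ (TT g x)) := hc.comp_homeomorph h.homeo
  have w := hw _ hψ hψc
  have e : ∀ x, |(Matrix.of fun i j => pdrv n j (fun y => TT g y i) x).det| *
      bil (am (h.M (TT g x))) (grd (fun z => f (h.homeo.symm z)) (TT g x)) (grd φ (TT g x)) =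
      √(2 ^ n) * 2⁻¹ * bil (am (A x)) (grd f x) (grd (fun x => φ (TT g x)) x) := fun x => by
    have e1 : (Matrix.of fun i j => pdrv n j (fun y => TT g y i) x) = 1 + A x := by
      ext i j; rw [of_apply, h.pdT]
    have e2 : f = fun x => f (h.homeo.symm (TT g x)) := funext fun x => by rw [h.ST]
    have e3 : h.M (TT g x) = ro (1 + A x)⁻¹ := by rw [HU.M, YY, h.ST]
    have e4 : grd f x = (1 + A x) *ᵥ grd (fun z => f (h.homeo.symm z)) (TT g x) := by
      rw [← h.grd_comp sf]; simp only [h.ST]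
    rw [e1, abs_of_pos (h.sp x).det_pos, e3, (h.sp x).ro_bil, h.grd_comp hφ, e4]
  simp only [e]
  rw [integral_const_mul, w, mul_zero]

lemma HU.sl (h : HU g A) (ht : ∀ x k, (Gm (A x) * pdm k A x).trace = 0) : SL h.M where
  toLG := h.lg
  tr z k := by
    set S := h.homeo.symm
    have e1 := pdm_inv ((SmM.const 1).add h.smAS) (fun z => (h.sp _).det_pos.ne') k z
    rw [pdm_add (SmM.const 1) h.smAS, pdm_const, zero_add] at e1
    have e2 : pdm k (fun z => A (S z)) z = ∑ l, YY A S z l k • pdm l A (S z) := by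
      ext a b
      rw [Matrix.sum_apply]
      have : pdm k (fun z => A (S z)) z a b = _ := pdrv_chain h.cdS (h.smA a b) k z
      rw [this]
      refine Finset.sum_congr rfl fun l _ => ?_
      rw [h.pdS, Matrix.smul_apply, smul_eq_mul]; rfl
    have e3 : pdm k (YY A S) z = _ := e1
    have e4 := (h.sp (S z)).ro_G
    rw [h.pdM, e3, smul_neg, neg_smul, neg_neg, Matrix.mul_smul, trace_smul]
    have e5 : (Gm (h.M z) * ((1 + A (S z))⁻¹ * pdm k (fun z => A (S z)) z * (1 + A (S z))⁻¹)).trace = 0 := by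
      rw [← Matrix.mul_assoc, Matrix.trace_mul_comm, ← Matrix.mul_assoc, ← Matrix.mul_assoc]
      change ((1 + A (S z))⁻¹ * Gm (ro (1 + A (S z))⁻¹) * (1 + A (S z))⁻¹ * pdm k (fun z => A (S z)) z).trace = 0
      rw [e4, e2, Matrix.mul_sum, trace_sum]
      refine Finset.sum_eq_zero fun l _ => ?_
      rw [Matrix.mul_smul, Matrix.smul_mul, trace_smul, trace_smul, ht]; simp
    rw [e5, smul_zero]

lemma HU.const (hn : 1 ≤ n) (h : HU g A) (hw : WSol (fun x => am (A x)) (Th A)) (x y : En n) : A x = A y := by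
  have hs : ∀ x, (A x)ᵀ = A x := fun x => (h.sp x).symm
  have sT := Th_sm h.smA hs
  have lv := liouville hn (by norm_num) (by positivity) (Ell_am h.lg.sc h.lg.sm.cont)
    (ContDiff.comp sT h.cdS) (h.wsol sT hw) (fun z => Th_bd hs _)
  have tc : ∀ x y, Th A x = Th A y := fun x y => by
    have := lv (TT g x) (TT g y)
    simpa only [Function.comp_apply, h.ST] using this
  have tr0 : ∀ x k, (Gm (A x) * pdm k A x).trace = 0 := fun x k => by
    rw [← Th_pd h.smA hs]
    have : Th A = fun _ => Th A 0 := funext fun x => tc x 0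
    rw [this, pdrv_const]
  have hsl := h.sl tr0
  have hM := rigid hn hsl h.po
  have hY : ∀ z, A (h.homeo.symm z) = A (h.homeo.symm 0) := fun z => by
    have e : YY A h.homeo.symm z = YY A h.homeo.symm 0 := by
      have := hM z
      simp only [HU.M, ro] at this
      exact smul_right_injective _ (by norm_num : (-2:ℝ) ≠ 0) (add_left_cancel this)
    have i := (h.sp (h.homeo.symm z)).mul_inv
    have j := (h.sp (h.homeo.symm 0)).inv_mul
    have e' : (1 + A (h.homeo.symm z))⁻¹ = (1 + A (h.homeo.symm 0))⁻¹ := e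
    have : 1 + A (h.homeo.symm z) = 1 + A (h.homeo.symm 0) := by
      rw [e'] at i
      calc _ = (1 + A (h.homeo.symm z)) * ((1 + A (h.homeo.symm 0))⁻¹ * (1 + A (h.homeo.symm 0))) := by rw [j, Matrix.mul_one]
        _ = _ := by rw [← Matrix.mul_assoc, i, Matrix.one_mul]
    exact add_left_cancel this
  have a := hY (TT g x)
  have b := hY (TT g y)
  rw [h.ST] at a b
  rw [a, b]

end P18

/-- Bernstein theorem for the Hamiltonian stationary equation, convex case: an entire smooth
convex solution of `Δ_g θ = 0`, where `θ = ∑ arctan λᵢ(D²u)` is the Lagrangian phase, must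
have constant Hessian, i.e. `u` is a quadratic polynomial. -/
theorem bernstein_hamiltonian_stationary_convex
    (n : ℕ) (hn : 1 ≤ n)
    (u : En n → ℝ) (hu : ContDiff ℝ (⊤ : ℕ∞) u)
    (hsym : ∀ x, (hess n u x).IsHermitian)
    (hconv : ∀ x, (hess n u x).PosSemidef)
    (hpde : ∀ x, lapBel n (fun y => 1 + hess n u y * hess n u y)
      (fun y => ∑ i, Real.arctan ((hsym y).eigenvalues i)) x = 0) :
    ∀ x y, hess n u x = hess n u y := by
  have hs : Sm u := hu
  have hU : HU (fun i x => pdrv n i u x) (hess n u) :=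
    { sm := fun i => hs.pd i
      pd := fun i j x => rfl
      sp := fun x =>
        { symm := by
            have := (hsym x)
            rwa [Matrix.IsHermitian, conjTranspose_eq_transpose_of_trivial] at this
          pos := fun ξ => by
            have := (hconv x).dotProduct_mulVec_nonneg ξ
            simpa using this } }
  have hsy : ∀ x, (hess n u x)ᵀ = hess n u x := fun x => (hU.sp x).symm
  refine hU.const hn fun φ hφ hc => ?_
  have sT := Th_sm hU.smA hsy
  have eT : (fun y => ∑ i, Real.arctan ((hsym y).eigenvalues i)) = Th (hess n u) :=
    funext fun y => (Th_eq hsym y).symm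
  rw [eT] at hpde
  have sa : ∀ i j, Sm (fun y => am (hess n u y) i j * pdrv n i (Th (hess n u)) y) := fun i j =>
    ContDiff.mul (ContDiff.mul (smom_of hU.smA hsy) (smG_of hU.smA hsy i j)) (sT.pd i)
  have key := div_ibp (X := fun j y => ∑ i, am (hess n u y) i j * pdrv n i (Th (hess n u)) y)
    (fun j => Sm.sum fun i _ => sa i j) hφ hc
  have e1 : ∀ x, ∑ j, pdrv n j (fun y => ∑ i, am (hess n u y) i j * pdrv n i (Th (hess n u)) y) x = 0 := fun x => by
    rw [← hpde x, lapBel, Finset.sum_comm]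
    refine Finset.sum_congr rfl fun j _ => ?_
    rw [pdrv_sum _ _ fun i _ => (sa i j).diff x]
    rfl
  simp only [e1, mul_zero, integral_zero, neg_zero] at key
  rw [← key]
  congr 1; ext x
  rw [bil_eq_sum, Finset.sum_comm]
  refine Finset.sum_congr rfl fun j _ => ?_
  rw [Finset.sum_mul]; rfl
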